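/- Main theorem: for any right ideal I of the first Weyl algebra A₁ over a field k of characteristic zero, the Stafford subgroup H(I) = {σ ∈ Aut_k(A₁) : σ(I) ≅ I as right A₁-modules} is equal to its own normalizer in Aut_k(A₁): if γ ∈ Aut_k(A₁) satisfies γH(I)γ⁻¹ = H(I), then γ ∈ H(I). -/

import Mathlib

open Polynomial

set_option synthInstance.maxHeartbeats 1000000
set_option maxHeartbeats 1000000

/-- Multiplication by `t` as a `k`-linear endomorphism of `k[t]`. -/
noncomputable def Tmul (k : Type) [Field k] : Module.End k (Polynomial k) :=
  Algebra.lmul k (Polynomial k) X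

/-- The derivative `∂ = d/dt` as a `k`-linear endomorphism of `k[t]`. -/
noncomputable def Dop (k : Type) [Field k] : Module.End k (Polynomial k) :=
  Polynomial.derivative

/-- The first Weyl algebra `A₁ = k⟨t,∂⟩`, realized as the subalgebra of
`End_k(k[t])` generated by multiplication by `t` and the derivative. -/
noncomputable def WeylA (k : Type) [Field k] : Subalgebra k (Module.End k (Polynomial k)) :=
  Algebra.adjoin k {Tmul k, Dop k}

open MulOpposite in
/-- The image `σ(I)` of a right ideal `I` of `A₁` (a submodule of `A₁` as a
right module over itself, i.e. an `A₁ᵐᵒᵖ`-submodule) under an automorphism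
`σ ∈ Aut_k(A₁)`, again a right ideal. -/
noncomputable def rmap {k : Type} [Field k] (σ : WeylA k ≃ₐ[k] WeylA k)
    (I : Submodule (WeylA k)ᵐᵒᵖ (WeylA k)) : Submodule (WeylA k)ᵐᵒᵖ (WeylA k) where
  carrier := σ '' I
  add_mem' := by
    rintro _ _ ⟨x, hx, rfl⟩ ⟨y, hy, rfl⟩
    exact ⟨x + y, I.add_mem hx hy, map_add σ x y⟩
  zero_mem' := ⟨0, I.zero_mem, map_zero σ⟩
  smul_mem' := by
    rintro a _ ⟨x, hx, rfl⟩
    refine ⟨x * σ.symm a.unop, I.smul_mem (op (σ.symm a.unop)) hx, ?_⟩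
    simp [MulOpposite.smul_eq_mul_unop, map_mul]

/-- The Stafford subgroup of a right ideal `I` of `A₁`:
`H(I) = {σ ∈ Aut_k(A₁) : σ(I) ≅ I as right A₁-modules}`. -/
noncomputable def Hgrp {k : Type} [Field k] (I : Submodule (WeylA k)ᵐᵒᵖ (WeylA k)) :
    Set (WeylA k ≃ₐ[k] WeylA k) :=
  {σ | Nonempty (rmap σ I ≃ₗ[(WeylA k)ᵐᵒᵖ] I)}

section Spectral
open Matrix

variable {K : Type*} [Field K] {n : Type*} [Fintype n] [DecidableEq n]

theorem det_aeval_eq_prod_roots [IsAlgClosed K] (M : Matrix n n K) (p : K[X]) :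
    (aeval M p).det = (M.charpoly.roots.map fun r => p.eval r).prod := by
  have hχ := (IsAlgClosed.splits M.charpoly).eq_prod_roots_of_monic M.charpoly_monic
  have hcard : M.charpoly.roots.card = Fintype.card n := by
    rw [(IsAlgClosed.splits M.charpoly).natDegree_eq_card_roots.symm, M.charpoly_natDegree_eq_dim]
  have hlin : ∀ a : K, (aeval M (X - C a)).det =
      (M.charpoly.roots.map fun r => (X - C a).eval r).prod := by
    intro a
    have h := congrArg (eval a) hχ
    rw [Matrix.eval_charpoly, Polynomial.eval_multiset_prod, Multiset.map_map] at h
    have h2 : aeval M (X - C a) = -(Matrix.scalar n a - M) := by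
      ext i j
      simp [Matrix.algebraMap_eq_diagonal, Matrix.diagonal]
    rw [h2, Matrix.det_neg, h, ← hcard]
    simp only [Function.comp_def, eval_sub, eval_X, eval_C]
    simpa using (Multiset.prod_map_neg (M.charpoly.roots.map fun x => a - x)).symm
  have hp := (IsAlgClosed.splits p).eq_prod_roots
  have key : ∀ s : Multiset K, (aeval M (s.map fun a => X - C a).prod).det =
      (M.charpoly.roots.map fun r => ((s.map fun a => X - C a).prod).eval r).prod := by
    intro s
    induction s using Multiset.induction_on with
    | empty => simp
    | cons a s ih =>
      rw [Multiset.map_cons, Multiset.prod_cons, map_mul, Matrix.det_mul, ih, hlin,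
        ← Multiset.prod_map_mul]
      simp
  rw [hp, map_mul, Matrix.det_mul, key, aeval_C, Matrix.algebraMap_eq_diagonal,
    Matrix.det_diagonal]
  simp [Multiset.prod_map_mul, hcard]

theorem charpoly_aeval_eq_prod [IsAlgClosed K] (M : Matrix n n K) (p : K[X]) :
    (aeval M p).charpoly = (M.charpoly.roots.map fun r => X - C (p.eval r)).prod := by
  apply Polynomial.funext
  intro x
  have h := det_aeval_eq_prod_roots M (C x - p)
  rw [Matrix.eval_charpoly, Polynomial.eval_multiset_prod, Multiset.map_map]
  simpa [Matrix.algebraMap_eq_diagonal, Pi.algebraMap_def] using h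

theorem trace_aeval_eq_sum_roots [IsAlgClosed K] (M : Matrix n n K) (p : K[X]) :
    (aeval M p).trace = (M.charpoly.roots.map fun r => p.eval r).sum := by
  rw [Matrix.trace_eq_sum_roots_charpoly, charpoly_aeval_eq_prod]
  congr 1
  have := Polynomial.roots_multiset_prod_X_sub_C (M.charpoly.roots.map fun r => p.eval r)
  simpa using this

end Spectral

theorem subsingleton_of_mul_sub_mul_eq_one {K V : Type*} [Field K] [CharZero K] [AddCommGroup V]
    [Module K V] [FiniteDimensional K V] (x y : Module.End K V) (h : x * y - y * x = 1) :
    Subsingleton V := by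
  have ht := congrArg (LinearMap.trace K V) h
  rw [map_sub, LinearMap.trace_mul_comm, sub_self, LinearMap.trace_one] at ht
  exact Module.finrank_zero_iff.mp (by exact_mod_cast ht.symm)

section Derivations
open Matrix

theorem Matrix.map_derivation_mul {R K n : Type*} [CommRing R] [CommRing K] [Algebra R K]
    [Fintype n] (δ : Derivation R K K) (M N : Matrix n n K) :
    (M * N).map δ = M.map δ * N + M * N.map δ := by
  ext a b
  simp only [Matrix.map_apply, Matrix.mul_apply, Matrix.add_apply, map_sum, Derivation.leibniz,
    smul_eq_mul, Finset.sum_add_distrib]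
  rw [add_comm]
  congr 1
  exact Finset.sum_congr rfl fun _ _ => mul_comm _ _

theorem Matrix.trace_map_derivation_pow_mul {R K n : Type*} [CommRing R] [CommRing K] [Algebra R K]
    [Fintype n] [DecidableEq n] (δ : Derivation R K K) (M : Matrix n n K) (m a : ℕ) :
    ((M ^ (m + 1)).map δ * M ^ a).trace = (m + 1) * (M ^ (m + a) * M.map δ).trace := by
  induction m generalizing a with
  | zero => simp [Matrix.trace_mul_comm (M.map δ)]
  | succ m ih =>
    rw [pow_succ, Matrix.map_derivation_mul, add_mul, Matrix.trace_add, mul_assoc, ← pow_succ', ih,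
      Matrix.trace_mul_comm (M ^ (m + 1) * M.map δ), ← mul_assoc, ← pow_add]
    rw [show m + (a + 1) = a + (m + 1) by ring, show m + 1 + a = a + (m + 1) by ring]
    push_cast
    ring

theorem Derivation.map_trace_pow_succ {R K n : Type*} [CommRing R] [CommRing K] [Algebra R K]
    [Fintype n] [DecidableEq n] (δ : Derivation R K K) (M : Matrix n n K) (m : ℕ) :
    δ (M ^ (m + 1)).trace = (m + 1) * (M ^ m * M.map δ).trace := by
  have h := Matrix.trace_map_derivation_pow_mul δ M m 0
  rw [pow_zero, mul_one, add_zero] at h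
  rw [← h]
  simp [Matrix.trace]

theorem Derivation.exists_extension {R K L : Type*} [CommRing R] [CommRing K] [CommRing L]
    [Algebra R K] [Algebra K L] [Algebra R L] [IsScalarTower R K L] [Algebra.FormallyEtale K L]
    (δ : Derivation R K K) :
    ∃ δ' : Derivation R L L, ∀ x, δ' (algebraMap K L x) = algebraMap K L (δ x) := by
  let f : Ω[K⁄R] →ₗ[K] L := (Algebra.linearMap K L).comp δ.liftKaehlerDifferential
  let g : Ω[L⁄R] →ₗ[L] L := (f.liftBaseChange L).comp
    (KaehlerDifferential.tensorKaehlerEquivOfFormallyEtale R K L).symm.toLinearMap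
  refine ⟨g.compDer (KaehlerDifferential.D R L), fun x => ?_⟩
  simp [g, f, KaehlerDifferential.tensorKaehlerEquivOfFormallyEtale_symm_D_algebraMap]

end Derivations

section CalogeroMoser
open Matrix

/-- Calogero–Moser data: matrices `x`, `y`, a vector `i` and a covector `j` with
`[x, y] = 1 + i j`. -/
structure CMData (K : Type*) [CommRing K] (n : Type*) [Fintype n] [DecidableEq n] where
  x : Matrix n n K
  y : Matrix n n K
  i : n → K
  j : n → K
  comm : x * y - y * x = 1 + vecMulVec i j

namespace CMData

section Ring
variable {K : Type*} [CommRing K] {n : Type*} [Fintype n] [DecidableEq n] (D : CMData K n)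

theorem x_mul_y : D.x * D.y = D.y * D.x + (1 + vecMulVec D.i D.j) := by
  rw [← D.comm]; abel

theorem x_mulVec_y (v : n → K) :
    D.x *ᵥ (D.y *ᵥ v) = D.y *ᵥ (D.x *ᵥ v) + v + (D.j ⬝ᵥ v) • D.i := by
  rw [Matrix.mulVec_mulVec, D.x_mul_y, Matrix.add_mulVec, Matrix.add_mulVec, Matrix.one_mulVec,
    ← Matrix.mulVec_mulVec, Matrix.vecMulVec_mulVec, add_assoc]
  simp

/-- The dual data, obtained by transposing the matrices. -/
def dual : CMData K n where
  x := D.xᵀ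
  y := -D.yᵀ
  i := D.j
  j := D.i
  comm := by
    have h := congrArg Matrix.transpose D.comm
    simp only [Matrix.transpose_sub, Matrix.transpose_mul, Matrix.transpose_add,
      Matrix.transpose_one, Matrix.transpose_vecMulVec] at h
    rw [← h]
    simp only [Matrix.mul_neg, Matrix.neg_mul]
    abel

/-- The data obtained by adding to `x` a matrix commuting with `y`. -/
def addLeft (Z : Matrix n n K) (hZ : Commute Z D.y) : CMData K n where
  x := D.x + Z
  y := D.y
  i := D.i
  j := D.j
  comm := by rw [add_mul, mul_add, hZ.eq, add_sub_add_right_eq_sub, D.comm]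

/-- The data obtained by adding to `y` a matrix commuting with `x`. -/
def addRight (Z : Matrix n n K) (hZ : Commute Z D.x) : CMData K n where
  x := D.x
  y := D.y + Z
  i := D.i
  j := D.j
  comm := by rw [add_mul, mul_add, hZ.eq, add_sub_add_right_eq_sub, D.comm]

/-- Extension of scalars. -/
def baseChange {L : Type*} [CommRing L] (f : K →+* L) : CMData L n where
  x := D.x.map f
  y := D.y.map f
  i := f ∘ D.i
  j := f ∘ D.j
  comm := by
    have h := congrArg (fun M => M.map f) D.comm
    simp only [Matrix.map_sub f (map_sub f), Matrix.map_add f (map_add f), Matrix.map_mul,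
      Matrix.map_one f (map_zero f) (map_one f)] at h
    rw [h]
    congr 1
    ext a b
    simp [vecMulVec_apply]

theorem x_mul_y_pow_succ (b : ℕ) :
    D.x * D.y ^ (b + 1) = D.y ^ (b + 1) * D.x + (b + 1 : K) • D.y ^ b +
      ∑ p ∈ Finset.HasAntidiagonal.antidiagonal b, D.y ^ p.1 * vecMulVec D.i D.j * D.y ^ p.2 := by
  induction b with
  | zero => simp [D.x_mul_y]; abel
  | succ b ih =>
    rw [pow_succ, ← mul_assoc, ih, Finset.Nat.antidiagonal_succ', Finset.sum_cons, add_mul, add_mul,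
      mul_assoc, D.x_mul_y, Finset.sum_map, Finset.sum_mul]
    simp only [mul_add, mul_one, ← mul_assoc, ← pow_succ, Matrix.smul_mul, pow_zero]
    simp [mul_assoc, pow_succ, add_smul]
    abel

end Ring

section Field
variable {K : Type*} [Field K] [CharZero K] {n : Type*} [Fintype n] [DecidableEq n]
  (D : CMData K n)

theorem eq_bot_of_invariant (W : Submodule K (n → K)) (hX : ∀ w ∈ W, D.x *ᵥ w ∈ W)
    (hY : ∀ w ∈ W, D.y *ᵥ w ∈ W) (hj : ∀ w ∈ W, D.j ⬝ᵥ w = 0) : W = ⊥ := by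
  let x : Module.End K W := D.x.mulVecLin.restrict hX
  let y : Module.End K W := D.y.mulVecLin.restrict hY
  have h : x * y - y * x = 1 := by
    ext w : 1
    apply Subtype.ext
    have := D.x_mulVec_y (w : n → K)
    rw [hj w w.2, zero_smul, add_zero] at this
    change D.x *ᵥ (D.y *ᵥ (w : n → K)) - D.y *ᵥ (D.x *ᵥ (w : n → K)) = w
    rw [this, add_sub_cancel_left]
  exact Submodule.subsingleton_iff_eq_bot.mp (subsingleton_of_mul_sub_mul_eq_one x y h)

theorem eq_top_of_invariant (W : Submodule K (n → K)) (hX : ∀ w ∈ W, D.x *ᵥ w ∈ W)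
    (hY : ∀ w ∈ W, D.y *ᵥ w ∈ W) (hi : D.i ∈ W) : W = ⊤ := by
  let x : Module.End K ((n → K) ⧸ W) := W.mapQ W D.x.mulVecLin hX
  let y : Module.End K ((n → K) ⧸ W) := W.mapQ W D.y.mulVecLin hY
  have h : x * y - y * x = 1 := by
    refine LinearMap.ext fun w => ?_
    obtain ⟨w, rfl⟩ := W.mkQ_surjective w
    change W.mkQ (D.x *ᵥ (D.y *ᵥ w)) - W.mkQ (D.y *ᵥ (D.x *ᵥ w)) = W.mkQ w
    have hi' : W.mkQ D.i = 0 := by simpa using hi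
    rw [D.x_mulVec_y, map_add, map_add, map_smul, hi', smul_zero, add_zero, add_sub_cancel_left]
  exact Submodule.Quotient.subsingleton_iff.mp (subsingleton_of_mul_sub_mul_eq_one x y h)

theorem eigenvector_eq_zero (u : n → K) (l : K) (hu : D.x *ᵥ u = l • u)
    (hj : ∀ r, D.j ⬝ᵥ (D.y ^ r *ᵥ u) = 0) : u = 0 := by
  let W : Submodule K (n → K) := Submodule.span K (Set.range fun r => D.y ^ r *ᵥ u)
  have hW : W = ⊥ := by
    refine D.eq_bot_of_invariant W ?_ ?_ ?_
    · intro w hw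
      induction hw using Submodule.span_induction with
      | mem w h =>
        obtain ⟨r, rfl⟩ := h
        induction r with
        | zero =>
          simp only [pow_zero, Matrix.one_mulVec, hu]
          exact W.smul_mem _ (Submodule.subset_span ⟨0, by simp⟩)
        | succ r ih =>
          have hmem : ∀ r, D.y ^ r *ᵥ u ∈ W := fun r => Submodule.subset_span ⟨r, rfl⟩
          simp only [Matrix.mulVec_mulVec]
          rw [D.x_mul_y_pow_succ, Matrix.add_mulVec, Matrix.add_mulVec, Matrix.sum_mulVec,
            ← Matrix.mulVec_mulVec, hu, Matrix.mulVec_smul, Matrix.smul_mulVec]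
          refine W.add_mem (W.add_mem (W.smul_mem _ (hmem _)) (W.smul_mem _ (hmem _))) ?_
          refine W.sum_mem fun p _ => ?_
          rw [← Matrix.mulVec_mulVec, ← Matrix.mulVec_mulVec, Matrix.vecMulVec_mulVec, hj]
          simp
      | zero => simp
      | add a b _ _ h1 h2 => rw [Matrix.mulVec_add]; exact W.add_mem h1 h2
      | smul c a _ h1 => rw [Matrix.mulVec_smul]; exact W.smul_mem _ h1
    · intro w hw
      induction hw using Submodule.span_induction with
      | mem w h =>
        obtain ⟨r, rfl⟩ := h
        exact Submodule.subset_span ⟨r + 1, by simp [pow_succ']⟩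
      | zero => simp
      | add a b _ _ h1 h2 => rw [Matrix.mulVec_add]; exact W.add_mem h1 h2
      | smul c a _ h1 => rw [Matrix.mulVec_smul]; exact W.smul_mem _ h1
    · intro w hw
      induction hw using Submodule.span_induction with
      | mem w h =>
        obtain ⟨r, rfl⟩ := h
        exact hj r
      | zero => simp
      | add a b _ _ h1 h2 => simp [h1, h2]
      | smul c a _ h1 => simp [h1]
  have : u ∈ W := Submodule.subset_span ⟨0, by simp⟩
  rw [hW] at this
  simpa using this

end Field
end CMData
end CalogeroMoser

section CalogeroMoser
open Matrix
namespace CMData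

section Field
variable {K : Type*} [Field K] {n : Type*} [Fintype n] [DecidableEq n] (D : CMData K n)

/-- The linear map `f ↦ f(x) i`. -/
noncomputable def orbit : K[X] →ₗ[K] (n → K) :=
  (Matrix.mulVecBilin K K).flip D.i ∘ₗ (aeval D.x).toLinearMap

theorem orbit_apply (f : K[X]) : D.orbit f = aeval D.x f *ᵥ D.i := rfl

theorem orbit_mul (f g : K[X]) : D.orbit (f * g) = aeval D.x f *ᵥ D.orbit g := by
  simp [orbit_apply]

theorem aeval_mulVec_commutator_mem (f : K[X]) (v : n → K) :
    aeval D.x f *ᵥ (D.y *ᵥ v) - D.y *ᵥ (aeval D.x f *ᵥ v) - aeval D.x (derivative f) *ᵥ v ∈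
      LinearMap.range D.orbit := by
  induction f using Polynomial.induction_on generalizing v with
  | C a => simp [Algebra.algebraMap_eq_smul_one, Matrix.smul_mulVec, Matrix.mulVec_smul]
  | add p q hp hq =>
    convert! (LinearMap.range D.orbit).add_mem (hp v) (hq v) using 1
    simp only [map_add, Matrix.add_mulVec, Matrix.mulVec_add]
    abel
  | monomial m a ih =>
    rw [pow_succ, ← mul_assoc]
    generalize (C a * X ^ m : K[X]) = f at ih
    have h := (LinearMap.range D.orbit).add_mem (ih (D.x *ᵥ v))
      ((LinearMap.range D.orbit).smul_mem (D.j ⬝ᵥ v) ⟨f, rfl⟩)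
    convert! h using 1
    rw [derivative_mul, derivative_X, mul_one, map_mul, aeval_X, ← Matrix.mulVec_mulVec,
      D.x_mulVec_y]
    simp only [Matrix.mulVec_add, Matrix.mulVec_smul, map_add, map_mul, aeval_X, Matrix.add_mulVec,
      ← Matrix.mulVec_mulVec, orbit_apply]
    abel

theorem aeval_derivative_mulVec_mem {f : K[X]} (hf : aeval D.x f = 0) (v : n → K) :
    aeval D.x (derivative f) *ᵥ v ∈ LinearMap.range D.orbit := by
  have h := D.aeval_mulVec_commutator_mem f v
  simpa [hf] using (LinearMap.range D.orbit).neg_mem h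

theorem exists_orbit_eigenvector (l : K) :
    ∃ u : n → K, ∀ w ∈ LinearMap.range D.orbit, D.x *ᵥ w = l • w → ∃ c : K, w = c • u := by
  let I : Ideal K[X] :=
    { carrier := {f | D.orbit f = 0}
      add_mem' := fun {a b} ha hb => by
        simp only [Set.mem_ofPred_eq] at *
        rw [map_add, ha, hb, add_zero]
      zero_mem' := by simp
      smul_mem' := fun c f hf => by
        simp only [Set.mem_ofPred_eq, smul_eq_mul] at *
        rw [orbit_mul, hf, Matrix.mulVec_zero] }
  obtain ⟨q, hq⟩ := (IsPrincipalIdealRing.principal I).principal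
  have hI : ∀ f, D.orbit f = 0 ↔ q ∣ f := fun f => by
    rw [← Ideal.mem_span_singleton, ← Ideal.submodule_span_eq, ← hq]; rfl
  have hev : ∀ u : n → K, D.x *ᵥ u = l • u → ∀ p : K[X], aeval D.x p *ᵥ u = p.eval l • u := by
    intro u hu p
    induction p using Polynomial.induction_on with
    | C a => simp [Algebra.algebraMap_eq_smul_one, Matrix.smul_mulVec]
    | add p q hp hq => simp [Matrix.add_mulVec, hp, hq, add_smul]
    | monomial m a ih =>
      rw [pow_succ, ← mul_assoc, map_mul, ← Matrix.mulVec_mulVec, aeval_X, hu, Matrix.mulVec_smul,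
        ih, smul_smul, eval_mul_X, mul_comm]
  have hX : ∀ f, D.orbit ((X - C l) * f) = D.x *ᵥ D.orbit f - l • D.orbit f := by
    intro f
    simp [orbit_mul, Matrix.sub_mulVec, Algebra.algebraMap_eq_smul_one, Matrix.smul_mulVec]
  by_cases hl : (X - C l) ∣ q
  · obtain ⟨q', rfl⟩ := hl
    refine ⟨D.orbit q', ?_⟩
    rintro _ ⟨f, rfl⟩ hf
    have h1 := hX f
    rw [hf, sub_self, hI] at h1
    obtain ⟨w, rfl⟩ := (mul_dvd_mul_iff_left (X_sub_C_ne_zero l)).mp h1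
    refine ⟨w.eval l, ?_⟩
    rw [mul_comm, orbit_mul, hev]
    have h2 := hX q'
    rw [(hI _).mpr dvd_rfl] at h2
    exact (sub_eq_zero.mp h2.symm)
  · refine ⟨0, ?_⟩
    rintro _ ⟨f, rfl⟩ hf
    have h1 := hX f
    rw [hf, sub_self, hI] at h1
    obtain ⟨w, hw⟩ := h1
    rcases (prime_X_sub_C l).dvd_or_dvd (Dvd.intro _ hw) with h | h
    · exact absurd h hl
    · obtain ⟨w', rfl⟩ := h
      refine ⟨0, ?_⟩
      rw [smul_zero, hI]
      refine ⟨w', mul_left_cancel₀ (X_sub_C_ne_zero l) ?_⟩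
      rw [hw]; ring

theorem charpoly_eq_minpoly_of_orbit_eq_top (h : LinearMap.range D.orbit = ⊤) :
    D.x.charpoly = minpoly K D.x := by
  have hint : IsIntegral K D.x := Matrix.isIntegral D.x
  have hdvd : minpoly K D.x ∣ D.x.charpoly := minpoly.dvd K _ (Matrix.aeval_self_charpoly _)
  refine (Polynomial.eq_of_monic_of_dvd_of_natDegree_le (minpoly.monic hint)
    (Matrix.charpoly_monic _) hdvd ?_)
  rw [Matrix.charpoly_natDegree_eq_dim]
  have hs : Function.Surjective
      (D.orbit ∘ₗ (Polynomial.degreeLT K (minpoly K D.x).natDegree).subtype) := by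
    intro v
    obtain ⟨f, rfl⟩ := LinearMap.range_eq_top.mp h v
    refine ⟨⟨f %ₘ minpoly K D.x, ?_⟩, ?_⟩
    · rw [Polynomial.mem_degreeLT, ← Polynomial.degree_eq_natDegree (minpoly.ne_zero hint)]
      exact Polynomial.degree_modByMonic_lt _ (minpoly.monic hint)
    · change D.orbit (f %ₘ minpoly K D.x) = _
      rw [orbit_apply, Polynomial.modByMonic_eq_sub_mul_div]
      simp [orbit_apply]
  have hfin : Module.finrank K (Polynomial.degreeLT K (minpoly K D.x).natDegree) =
      (minpoly K D.x).natDegree := by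
    rw [(Polynomial.degreeLTEquiv K _).finrank_eq, Module.finrank_fin_fun]
  have : Module.Finite K (Polynomial.degreeLT K (minpoly K D.x).natDegree) :=
    Module.Finite.equiv (Polynomial.degreeLTEquiv K _).symm
  have := LinearMap.finrank_range_le
    (D.orbit ∘ₗ (Polynomial.degreeLT K (minpoly K D.x).natDegree).subtype)
  rwa [LinearMap.range_eq_top.mpr hs, finrank_top, Module.finrank_fintype_fun_eq_card,
    hfin] at this

end Field
end CMData
end CalogeroMoser

section CalogeroMoser
open Matrix
namespace CMData

variable {K : Type*} [Field K] {n : Type*} [Fintype n] [DecidableEq n] (D : CMData K n)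

theorem trace_commutator_eq_zero {G : Matrix n n K} {l : K} (h1 : G * D.x = l • G)
    (h2 : D.x * G = l • G) (hG : ∀ b, (G * D.y ^ b).trace = 0) (b : ℕ) :
    ∑ p ∈ Finset.HasAntidiagonal.antidiagonal b,
      (G * (D.y ^ p.1 * vecMulVec D.i D.j * D.y ^ p.2)).trace = 0 := by
  have h := congrArg (fun M => (G * M).trace) (D.x_mul_y_pow_succ b)
  simp only [mul_add, Matrix.trace_add, Matrix.mul_smul, Matrix.trace_smul, hG, smul_zero,
    add_zero, Finset.mul_sum, Matrix.trace_sum] at h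
  rw [← mul_assoc, h1, ← mul_assoc, Matrix.trace_mul_comm _ D.x, ← mul_assoc, h2] at h
  simpa [Matrix.smul_mul, hG] using h.symm

theorem eq_zero_of_eigen [CharZero K] {G : Matrix n n K} {l : K} (h1 : G * D.x = l • G)
    (h2 : D.x * G = l • G) (hG : ∀ b, (G * D.y ^ b).trace = 0) (u : n → K)
    (hu : ∀ v, ∃ c : K, G *ᵥ v = c • u) : G = 0 := by
  choose c hc using fun a => hu (Pi.single a 1)
  have hGu : G = vecMulVec u c := by
    ext a b
    have := congrFun (hc b) a
    simpa [vecMulVec_apply, mul_comm] using this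
  by_contra hne
  have hu0 : u ≠ 0 := fun h => hne (by rw [hGu, h]; ext; simp [vecMulVec_apply])
  have hc0 : c ≠ 0 := fun h => hne (by rw [hGu, h]; ext; simp [vecMulVec_apply])
  obtain ⟨a, ha⟩ := Function.ne_iff.mp hu0
  obtain ⟨b, hb⟩ := Function.ne_iff.mp hc0
  have hxu : D.x *ᵥ u = l • u := by
    have : c b • D.x *ᵥ u = c b • (l • u) := by
      have h := congrArg (fun M => M *ᵥ Pi.single b (1 : K)) h2
      simp only [← Matrix.mulVec_mulVec, Matrix.smul_mulVec, hc, Matrix.mulVec_smul] at h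
      rw [h, smul_comm]
    exact smul_right_injective _ hb this
  have hxc : c ᵥ* D.x = l • c := by
    have : u a • c ᵥ* D.x = u a • (l • c) := by
      ext d
      have h := congrFun (congrFun h1 a) d
      rw [hGu, Matrix.vecMulVec_mul] at h
      simp only [vecMulVec_apply, Matrix.smul_apply, smul_eq_mul] at h
      simp only [Pi.smul_apply, smul_eq_mul, h]
      ring
    exact smul_right_injective _ ha this
  have hps : (PowerSeries.mk fun s => c ⬝ᵥ (D.y ^ s *ᵥ D.i)) *
      (PowerSeries.mk fun r => D.j ⬝ᵥ (D.y ^ r *ᵥ u)) = 0 := by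
    ext m
    rw [PowerSeries.coeff_mul, map_zero, ← D.trace_commutator_eq_zero h1 h2 hG m]
    refine Finset.sum_congr rfl fun p _ => ?_
    rw [hGu, Matrix.vecMulVec_mul, Matrix.trace_vecMulVec, PowerSeries.coeff_mk,
      PowerSeries.coeff_mk, mul_assoc, ← Matrix.vecMul_vecMul, ← Matrix.vecMul_vecMul,
      Matrix.vecMul_vecMulVec]
    simp only [Matrix.dotProduct_mulVec, Matrix.smul_vecMul, dotProduct_smul, smul_eq_mul]
    congr 1
    rw [dotProduct_comm]
  rcases mul_eq_zero.mp hps with h | h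
  · refine hc0 (D.dual.eigenvector_eq_zero c l ?_ fun r => ?_)
    · simpa [dual, Matrix.mulVec_transpose] using hxc
    · have := congrArg (PowerSeries.coeff r) h
      rw [PowerSeries.coeff_mk, map_zero] at this
      have h2 : D.dual.y ^ r = (-1 : K) ^ r • (D.y ^ r)ᵀ := by
        rw [Matrix.transpose_pow, ← _root_.smul_pow, neg_one_smul]
        rfl
      rw [h2, Matrix.smul_mulVec, Matrix.mulVec_transpose, dotProduct_smul]
      change _ • (D.i ⬝ᵥ _) = 0
      rw [dotProduct_comm, ← Matrix.dotProduct_mulVec, this, smul_zero]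
  · refine hu0 (D.eigenvector_eq_zero u l hxu fun r => ?_)
    have := congrArg (PowerSeries.coeff r) h
    rwa [PowerSeries.coeff_mk, map_zero] at this

theorem charpoly_separable_of_trace [CharZero K] [IsAlgClosed K]
    (h : ∀ g : K[X], (∀ r, D.x.charpoly.IsRoot r → g.IsRoot r) →
      ∀ b, (aeval D.x g * D.y ^ b).trace = 0) : D.x.charpoly.Separable := by
  have hint : IsIntegral K D.x := Matrix.isIntegral D.x
  have hμ0 := minpoly.ne_zero hint
  have hroot : ∀ r, D.x.charpoly.IsRoot r → (minpoly K D.x).IsRoot r := by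
    intro r hr
    have h0 := charpoly_aeval_eq_prod D.x (minpoly K D.x)
    rw [minpoly.aeval, Matrix.charpoly_zero] at h0
    have h1 := congrArg (eval ((minpoly K D.x).eval r)) h0
    rw [eval_multiset_prod, Multiset.map_map, Multiset.prod_eq_zero] at h1
    · simpa using eq_zero_of_pow_eq_zero (by simpa using h1)
    · exact Multiset.mem_map.mpr ⟨r, (mem_roots (Matrix.charpoly_monic _).ne_zero).mpr hr, by simp⟩
  have hdvd : minpoly K D.x ∣ D.x.charpoly := minpoly.dvd K _ (Matrix.aeval_self_charpoly _)
  have hle : ∀ l, (minpoly K D.x).rootMultiplicity l ≤ 1 := by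
    intro l
    by_contra! hlt
    obtain ⟨q, hq, hql⟩ := Polynomial.exists_eq_pow_rootMultiplicity_mul_and_not_dvd
      (minpoly K D.x) hμ0 l
    obtain ⟨e, he⟩ := Nat.exists_eq_add_of_le hlt
    rw [he] at hq
    set g : K[X] := (X - C l) ^ (e + 1) * q with hg
    have hgμ : minpoly K D.x = (X - C l) * g := by rw [hq, hg]; ring
    have hxg : D.x * aeval D.x g = l • aeval D.x g := by
      have h0 := minpoly.aeval K D.x
      rw [hgμ, map_mul, map_sub, aeval_X, aeval_C, sub_mul, sub_eq_zero] at h0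
      rw [h0, Algebra.smul_def]
    have hgx : aeval D.x g * D.x = l • aeval D.x g := by
      rw [← hxg]
      have h0 := congrArg (aeval D.x) (mul_comm g X)
      rwa [map_mul _ g X, map_mul _ X g, aeval_X] at h0
    have hgroot : ∀ r, D.x.charpoly.IsRoot r → g.IsRoot r := by
      intro r hr
      have h1 := hroot r hr
      by_cases hrl : r = l
      · simp [hg, hrl]
      · rw [hgμ, IsRoot, eval_mul, eval_sub, eval_X, eval_C] at h1
        exact (mul_eq_zero.mp h1).resolve_left (sub_ne_zero.mpr hrl)
    have hder : q * derivative (minpoly K D.x) =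
        derivative q * minpoly K D.x + C (e + 2 : K) * q * g := by
      rw [hq, hg, derivative_mul, derivative_X_sub_C_pow]
      simp only [Nat.cast_add, map_add]
      rw [show 2 + e - 1 = e + 1 by omega]
      simp
      ring
    have hqg : aeval D.x (q * g) = q.eval l • aeval D.x g := by
      obtain ⟨q', hq'⟩ := Polynomial.X_sub_C_dvd_sub_C_eval (a := l) (p := q)
      rw [sub_eq_iff_eq_add] at hq'
      rw [hq', add_mul, mul_right_comm, ← hgμ, map_add, map_mul, minpoly.aeval, zero_mul, zero_add]
      simp [Algebra.smul_def]
    have hmem : ∀ v, aeval D.x g *ᵥ v ∈ LinearMap.range D.orbit := by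
      intro v
      have h1 := D.aeval_derivative_mulVec_mem (minpoly.aeval K D.x) v
      obtain ⟨f, hf⟩ := h1
      have h2 : aeval D.x (q * derivative (minpoly K D.x)) *ᵥ v = D.orbit (q * f) := by
        rw [orbit_mul, hf, map_mul, Matrix.mulVec_mulVec]
      have h3 : ((e + 2 : K) * q.eval l) • aeval D.x g *ᵥ v = D.orbit (q * f) := by
        rw [← h2, hder, map_add, map_mul (aeval D.x) (derivative q), minpoly.aeval, mul_zero,
          zero_add, mul_assoc,
          map_mul (aeval D.x) (C _), hqg, aeval_C, ← Algebra.smul_def,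
          Matrix.smul_mulVec, Matrix.smul_mulVec, smul_smul]
      have hne : (e + 2 : K) * q.eval l ≠ 0 := by
        refine mul_ne_zero (by exact_mod_cast (Nat.succ_ne_zero (e + 1))) fun h0 => hql ?_
        exact Polynomial.dvd_iff_isRoot.mpr h0
      rw [← inv_smul_smul₀ hne (aeval D.x g *ᵥ v), h3, ← map_smul]
      exact ⟨_, rfl⟩
    obtain ⟨u, hu⟩ := D.exists_orbit_eigenvector l
    have hG := D.eq_zero_of_eigen hgx hxg (h g hgroot) u fun v => hu _ (hmem v) (by
      rw [Matrix.mulVec_mulVec, hxg, Matrix.smul_mulVec])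
    have hdeg := minpoly.dvd K D.x hG
    rw [hgμ] at hdeg
    have hg0 : g ≠ 0 := right_ne_zero_of_mul (hgμ ▸ hμ0)
    have := Polynomial.natDegree_le_of_dvd hdeg hg0
    rw [natDegree_mul (X_sub_C_ne_zero l) hg0, natDegree_X_sub_C] at this
    omega
  have hsep : (minpoly K D.x).Separable := by
    rw [← Polynomial.nodup_roots_iff_of_splits hμ0 (IsAlgClosed.splits _)]
    classical
    exact Multiset.nodup_iff_count_le_one.mpr fun l => by rw [count_roots]; exact hle l
  rw [D.charpoly_eq_minpoly_of_orbit_eq_top]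
  · exact hsep
  · obtain ⟨a, b, hab⟩ := hsep
    rw [eq_top_iff]
    intro v _
    have h1 := D.aeval_derivative_mulVec_mem (minpoly.aeval K D.x) (aeval D.x b *ᵥ v)
    rw [Matrix.mulVec_mulVec, ← map_mul, mul_comm] at h1
    have h2 := congrArg (aeval D.x) hab
    rw [map_add, map_mul, minpoly.aeval, mul_zero, zero_add, map_one] at h2
    rwa [h2, Matrix.one_mulVec] at h1

end CMData
end CalogeroMoser

section CalogeroMoser
open Matrix

theorem Derivation.trace_aeval_mul_map {R L n : Type*} [Field L] [IsAlgClosed L]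
    [CharZero L] [CommRing R] [Algebra R L] [Fintype n] [DecidableEq n] (δ : Derivation R L L)
    (Z : Matrix n n L) (g : L[X]) :
    (aeval Z g * Z.map δ).trace = (Z.charpoly.roots.map fun r => g.eval r * δ r).sum := by
  induction g using Polynomial.induction_on' with
  | add p q hp hq => simp [add_mul, hp, hq]
  | monomial m a =>
    have h1 := δ.map_trace_pow_succ Z m
    have h2 := trace_aeval_eq_sum_roots Z (X ^ (m + 1))
    rw [map_pow, aeval_X] at h2
    rw [h2, map_multiset_sum, Multiset.map_map] at h1
    have h3 : ((m : L) + 1) * (Z.charpoly.roots.map fun r => r ^ m * δ r).sum =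
        (m + 1) * (Z ^ m * Z.map δ).trace := by
      rw [← h1, ← Multiset.sum_map_mul_left]
      congr 1
      refine Multiset.map_congr rfl fun r _ => ?_
      simp [Derivation.leibniz_pow]
    have hm : (m : L) + 1 ≠ 0 := by exact_mod_cast Nat.succ_ne_zero m
    have h4 := mul_left_cancel₀ hm h3
    rw [aeval_monomial, ← Algebra.smul_def, Matrix.smul_mul, Matrix.trace_smul, ← h4, smul_eq_mul,
      ← Multiset.sum_map_mul_left]
    congr 1
    refine Multiset.map_congr rfl fun r _ => ?_
    simp [mul_assoc]

namespace CMData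

variable {K : Type*} [Field K] {n : Type*} [Fintype n] [DecidableEq n] (D : CMData K n)

/-- The matrix `x + ∑ c_b y^b` with indeterminate coefficients `c_b`, as Calogero–Moser data
together with `y`. -/
noncomputable def generic (N : ℕ) : CMData (MvPolynomial (Fin N) K) n :=
  (D.baseChange MvPolynomial.C).addLeft
    (∑ b : Fin N, (MvPolynomial.X b : MvPolynomial (Fin N) K) •
      (D.baseChange MvPolynomial.C).y ^ (b : ℕ))
    (Commute.sum_left _ _ _ fun b _ =>
      ((Commute.refl (D.baseChange MvPolynomial.C).y).pow_left (b : ℕ)).smul_left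
        (MvPolynomial.X b))

theorem generic_x (N : ℕ) : (D.generic N).x = D.x.map MvPolynomial.C +
    ∑ b : Fin N, (MvPolynomial.X b : MvPolynomial (Fin N) K) • D.y.map MvPolynomial.C ^ (b : ℕ) :=
      rfl

theorem map_eval_generic_x {N : ℕ} (c : Fin N → K) :
    (MvPolynomial.eval c).mapMatrix (D.generic N).x = D.x + ∑ b, c b • D.y ^ (b : ℕ) := by
  have h (M : Matrix n n K) :
      (MvPolynomial.eval c).mapMatrix (M.map (MvPolynomial.C (σ := Fin N))) = M := by
    ext; simp
  rw [generic_x, map_add, map_sum, h]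
  congr 1
  refine Finset.sum_congr rfl fun b _ => ?_
  have h' := congrArg (· ^ (b : ℕ)) (h D.y)
  simp only [← map_pow] at h'
  rw [← h']
  ext; simp

theorem pderiv_generic_x {N : ℕ} (b : Fin N) :
    (D.generic N).x.map (MvPolynomial.pderiv b) = D.y.map MvPolynomial.C ^ (b : ℕ) := by
  have h (m : ℕ) : D.y.map (MvPolynomial.C (σ := Fin N)) ^ m = (D.y ^ m).map MvPolynomial.C :=
    (map_pow (MvPolynomial.C (σ := Fin N)).mapMatrix D.y m).symm
  rw [generic_x]
  ext p q
  simp only [h, Matrix.map_apply, Matrix.add_apply, Matrix.sum_apply, map_add, map_sum,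
    Matrix.smul_apply, smul_eq_mul, Derivation.leibniz, MvPolynomial.pderiv_C,
    MvPolynomial.pderiv_X, zero_add, mul_zero]
  simp [Pi.single_apply]

theorem trace_mul_pow_eq_zero {N : ℕ} (hN : Fintype.card n ≤ N) (G : Matrix n n K)
    (h : ∀ b < N, (G * D.y ^ b).trace = 0) (b : ℕ) : (G * D.y ^ b).trace = 0 := by
  rw [Matrix.pow_eq_aeval_mod_charpoly]
  rcases isEmpty_or_nonempty n with _ | _
  · simp
  have hdeg : (X ^ b %ₘ D.y.charpoly).natDegree < N := by
    refine lt_of_lt_of_le (Polynomial.natDegree_modByMonic_lt _ (Matrix.charpoly_monic _) ?_) ?_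
    · intro h1
      have := Matrix.charpoly_natDegree_eq_dim D.y
      rw [h1, natDegree_one] at this
      exact Fintype.card_ne_zero this.symm
    · rwa [Matrix.charpoly_natDegree_eq_dim]
  rw [aeval_eq_sum_range' hdeg, Finset.mul_sum, Matrix.trace_sum]
  refine Finset.sum_eq_zero fun i hi => ?_
  rw [Matrix.mul_smul, Matrix.trace_smul, h i (Finset.mem_range.mp hi), smul_zero]

theorem exists_forall_eval_ne_zero_separable [CharZero K] {N : ℕ} (hN : Fintype.card n ≤ N) :
    ∃ d : MvPolynomial (Fin N) K, d ≠ 0 ∧ ∀ c, MvPolynomial.eval c d ≠ 0 →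
      (D.x + ∑ b, c b • D.y ^ (b : ℕ)).charpoly.Separable := by
  let R := MvPolynomial (Fin N) K
  let F := FractionRing R
  let L := AlgebraicClosure F
  have : CharZero F := charZero_of_injective_algebraMap (IsFractionRing.injective R F)
  have : CharZero L := charZero_of_injective_algebraMap (algebraMap F L).injective
  have : Algebra.FormallyEtale R F := Algebra.FormallyEtale.of_isLocalization (nonZeroDivisors R)
  have : Algebra.FormallyEtale F L := Algebra.FormallyEtale.of_isSeparable F L
  have : Algebra.FormallyEtale R L := Algebra.FormallyEtale.comp R F L
  let E := (D.generic N).baseChange (algebraMap R L)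
  have hinj : Function.Injective (algebraMap R L) := by
    rw [IsScalarTower.algebraMap_eq R F L]
    exact (algebraMap F L).injective.comp (IsFractionRing.injective R F)
  have hsep : E.x.charpoly.Separable := by
    refine E.charpoly_separable_of_trace fun g hg => E.trace_mul_pow_eq_zero hN _ fun b hb => ?_
    obtain ⟨δ, hδ⟩ := (MvPolynomial.pderiv (R := K) (⟨b, hb⟩ : Fin N)).exists_extension (L := L)
    have h1 : E.x.map δ = E.y ^ b := by
      have h2 := congrArg (algebraMap R L).mapMatrix (D.pderiv_generic_x ⟨b, hb⟩)
      rw [map_pow] at h2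
      change _ = E.y ^ b at h2
      rw [← h2]
      ext p q
      exact hδ _
    rw [← h1, δ.trace_aeval_mul_map]
    refine Multiset.sum_eq_zero fun x hx => ?_
    obtain ⟨r, hr, rfl⟩ := Multiset.mem_map.mp hx
    rw [hg r (isRoot_of_mem_roots hr), zero_mul]
  have hmap : E.x.charpoly = (D.generic N).x.charpoly.map (algebraMap R L) :=
    ((D.generic N).x.charpoly_map (algebraMap R L))
  have hχ := Matrix.charpoly_monic (D.generic N).x
  have hder (S : Type _) [Field S] [CharZero S] (f : R →+* S) :
      (derivative ((D.generic N).x.charpoly.map f)).natDegree =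
        (derivative (D.generic N).x.charpoly).natDegree := by
    rw [natDegree_derivative, natDegree_derivative, hχ.natDegree_map]
  have hres (S : Type _) [Field S] [CharZero S] (f : R →+* S) :
      ((D.generic N).x.charpoly.map f).Separable ↔
        f ((D.generic N).x.charpoly.resultant (derivative (D.generic N).x.charpoly)) ≠ 0 := by
    rw [Polynomial.Separable, ← Polynomial.isUnit_resultant_iff_isCoprime (hχ.map f),
      isUnit_iff_ne_zero,
      hχ.natDegree_map, hder, Polynomial.derivative_map, Polynomial.resultant_map_map]
  refine ⟨(D.generic N).x.charpoly.resultant (derivative (D.generic N).x.charpoly), ?_, ?_⟩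
  · intro h0
    rw [hmap, hres, h0, map_zero] at hsep
    exact hsep rfl
  · intro c hc
    rw [← map_eval_generic_x, RingHom.mapMatrix_apply, Matrix.charpoly_map, hres]
    exact hc

end CMData
end CalogeroMoser

section Spectral
open Matrix

variable {K : Type*} [Field K] {n : Type*} [Fintype n] [DecidableEq n]

theorem trace_aeval_mul_eq_zero (M : Matrix n n K) {q : K[X]}
    (h : ∀ m, (aeval M (X ^ m * q)).trace = 0) (f : K[X]) : (aeval M (f * q)).trace = 0 := by
  induction f using Polynomial.induction_on' with
  | add a b ha hb => rw [add_mul, map_add, Matrix.trace_add, ha, hb, add_zero]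
  | monomial m a =>
    rw [← C_mul_X_pow_eq_monomial, mul_assoc, ← smul_eq_C_mul, map_smul, Matrix.trace_smul, h,
      smul_zero]

theorem aeval_map_map {L : Type*} [Field L] [Algebra K L] (M : Matrix n n K) (p : K[X]) :
    aeval (M.map (algebraMap K L)) (p.map (algebraMap K L)) =
      (aeval M p).map (algebraMap K L) := by
  induction p using Polynomial.induction_on' with
  | add a b ha hb =>
    simp only [Polynomial.map_add, map_add, ha, hb]
    exact (Matrix.map_add _ (map_add (algebraMap K L)) _ _).symm
  | monomial m a =>
    rw [map_monomial, aeval_monomial, aeval_monomial, ← Algebra.smul_def, ← Algebra.smul_def]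
    have h : (M.map (algebraMap K L)) ^ m = (M ^ m).map (algebraMap K L) :=
      (map_pow (algebraMap K L).mapMatrix M m).symm
    rw [h]
    ext; simp

theorem charpoly_dvd_of_trace_of_isAlgClosed [IsAlgClosed K] {M : Matrix n n K}
    (hM : M.charpoly.Separable) {q : K[X]} (h : ∀ m, (aeval M (X ^ m * q)).trace = 0) :
    M.charpoly ∣ q := by
  classical
  have hnd : M.charpoly.roots.Nodup := nodup_roots hM
  by_cases hq : q = 0
  · simp [hq]
  rw [(IsAlgClosed.splits M.charpoly).eq_prod_roots_of_monic M.charpoly_monic,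
    Multiset.prod_X_sub_C_dvd_iff_le_roots hq, Multiset.le_iff_subset hnd]
  intro l hl
  rw [mem_roots hq]
  obtain ⟨s, hs⟩ := Multiset.exists_cons_of_mem hl
  rw [hs, Multiset.nodup_cons] at hnd
  have h1 := trace_aeval_mul_eq_zero M h (s.map fun r => X - C r).prod
  have hz : ∀ r, ((s.map fun r => X - C r).prod).eval r = 0 ↔ r ∈ s := by
    intro r
    rw [eval_multiset_prod, Multiset.map_map, Multiset.prod_eq_zero_iff, Multiset.mem_map]
    simp [sub_eq_zero]
  rw [trace_aeval_eq_sum_roots, hs, Multiset.map_cons, Multiset.sum_cons, Multiset.sum_eq_zero,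
    add_zero, eval_mul] at h1
  · exact (mul_eq_zero.mp h1).resolve_left fun h => hnd.1 ((hz l).mp h)
  · intro x hx
    obtain ⟨r, hr, rfl⟩ := Multiset.mem_map.mp hx
    rw [eval_mul, (hz r).mpr hr, zero_mul]

theorem charpoly_dvd_of_trace {M : Matrix n n K}
    (hM : M.charpoly.Separable) {q : K[X]} (h : ∀ m, (aeval M (X ^ m * q)).trace = 0) :
    M.charpoly ∣ q := by
  let f := algebraMap K (AlgebraicClosure K)
  rw [← Polynomial.map_dvd_map' f, ← Matrix.charpoly_map]
  refine charpoly_dvd_of_trace_of_isAlgClosed ?_ fun m => ?_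
  · rw [Matrix.charpoly_map]; exact hM.map
  · have h1 := congrArg f (h m)
    rw [map_zero, AddMonoidHom.map_trace f] at h1
    rw [← h1]
    have h2 := aeval_map_map (L := AlgebraicClosure K) M (X ^ m * q)
    rw [Polynomial.map_mul, Polynomial.map_pow, Polynomial.map_X] at h2
    rw [h2]

theorem map_trace_pow_eq_sum_roots {L : Type*} [Field L] [IsAlgClosed L] (f : K →+* L)
    (M : Matrix n n K) (m : ℕ) :
    f (M ^ m).trace = ((M.charpoly.map f).roots.map fun r => r ^ m).sum := by
  have h := trace_aeval_eq_sum_roots (M.map f) (X ^ m)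
  rw [Matrix.charpoly_map] at h
  simp only [eval_pow, eval_X] at h
  rw [← h, AddMonoidHom.map_trace f, map_pow, aeval_X]
  congr 1
  exact map_pow f.mapMatrix M m

theorem trace_pow_eq_of_charpoly_eq {n' : Type*} [Fintype n'] [DecidableEq n'] {M : Matrix n n K}
    {M' : Matrix n' n' K} (h : M.charpoly = M'.charpoly) (m : ℕ) :
    (M ^ m).trace = (M' ^ m).trace := by
  apply (algebraMap K (AlgebraicClosure K)).injective
  rw [map_trace_pow_eq_sum_roots, map_trace_pow_eq_sum_roots, h]

theorem charpoly_eq_of_trace {n' : Type*} [Fintype n'] [DecidableEq n'] {M : Matrix n n K}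
    {M' : Matrix n' n' K} (hM : M.charpoly.Separable) (hM' : M'.charpoly.Separable)
    (h : ∀ p : K[X], aeval M p = 0 → (aeval M' p).trace = 0)
    (h' : ∀ p : K[X], aeval M' p = 0 → (aeval M p).trace = 0) : M.charpoly = M'.charpoly := by
  refine Polynomial.eq_of_monic_of_associated M.charpoly_monic M'.charpoly_monic
    (associated_of_dvd_dvd (charpoly_dvd_of_trace hM fun m => h' _ ?_)
      (charpoly_dvd_of_trace hM' fun m => h _ ?_)) <;>
  rw [map_mul, Matrix.aeval_self_charpoly, mul_zero]

end Spectral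

section CalogeroMoser
open Matrix
namespace CMData

variable {K : Type*} [Field K] [CharZero K] {n n' : Type*} [Fintype n] [DecidableEq n]
  [Fintype n'] [DecidableEq n'] (D : CMData K n) (D' : CMData K n')

omit [CharZero K] in
theorem eval_trace_generic_pow {N : ℕ} (c : Fin N → K) (m : ℕ) :
    MvPolynomial.eval c ((D.generic N).x ^ m).trace =
      ((D.x + ∑ b, c b • D.y ^ (b : ℕ)) ^ m).trace := by
  rw [← map_eval_generic_x, ← map_pow, AddMonoidHom.map_trace, RingHom.mapMatrix_apply]

omit [CharZero K] in
theorem eval_zero_trace_generic_mul (N m b : ℕ) :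
    MvPolynomial.eval 0 ((D.generic N).x ^ m * D.y.map MvPolynomial.C ^ b).trace =
      (D.x ^ m * D.y ^ b).trace := by
  have hy : (MvPolynomial.eval (0 : Fin N → K)).mapMatrix (D.y.map MvPolynomial.C) = D.y := by
    ext; simp
  rw [AddMonoidHom.map_trace, ← RingHom.mapMatrix_apply, map_mul, map_pow, map_pow,
    map_eval_generic_x, hy]
  simp

theorem trace_generic_eq {N : ℕ} (hN : Fintype.card n ≤ N) (hN' : Fintype.card n' ≤ N)
    (h : ∀ g p : K[X], aeval (D.x - aeval D.y g) p = 0 → (aeval (D'.x - aeval D'.y g) p).trace = 0)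
    (h' : ∀ g p : K[X], aeval (D'.x - aeval D'.y g) p = 0 → (aeval (D.x - aeval D.y g) p).trace = 0)
    (m : ℕ) : ((D.generic N).x ^ m).trace = ((D'.generic N).x ^ m).trace := by
  obtain ⟨d, hd, hsep⟩ := D.exists_forall_eval_ne_zero_separable hN
  obtain ⟨d', hd', hsep'⟩ := D'.exists_forall_eval_ne_zero_separable hN'
  rw [← sub_eq_zero]
  refine (mul_eq_zero.mp ?_).resolve_left (mul_ne_zero hd hd')
  apply MvPolynomial.funext
  intro c
  rw [map_mul, map_mul, map_sub, map_zero]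
  by_cases hc : MvPolynomial.eval c d = 0
  · simp [hc]
  by_cases hc' : MvPolynomial.eval c d' = 0
  · simp [hc']
  rw [eval_trace_generic_pow, eval_trace_generic_pow, sub_eq_zero.mpr, mul_zero]
  refine trace_pow_eq_of_charpoly_eq (charpoly_eq_of_trace (hsep c hc) (hsep' c hc') ?_ ?_) m
  · have h1 := h (-∑ b : Fin N, C (c b) * X ^ (b : ℕ))
    simpa [← Algebra.smul_def] using h1
  · have h1 := h' (-∑ b : Fin N, C (c b) * X ^ (b : ℕ))
    simpa [← Algebra.smul_def] using h1

theorem trace_pow_mul_pow_eq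
    (h : ∀ g p : K[X], aeval (D.x - aeval D.y g) p = 0 → (aeval (D'.x - aeval D'.y g) p).trace = 0)
    (h' : ∀ g p : K[X], aeval (D'.x - aeval D'.y g) p = 0 → (aeval (D.x - aeval D.y g) p).trace = 0)
    (m b : ℕ) : (D.x ^ m * D.y ^ b).trace = (D'.x ^ m * D'.y ^ b).trace := by
  let N := Fintype.card n + Fintype.card n' + (b + 1)
  let b' : Fin N := ⟨b, by omega⟩
  have h1 := D.trace_generic_eq D' (N := N) (by omega) (by omega) h h' (m + 1)
  replace h1 := congrArg (MvPolynomial.pderiv b') h1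
  rw [Derivation.map_trace_pow_succ, Derivation.map_trace_pow_succ, pderiv_generic_x,
    pderiv_generic_x] at h1
  have hm : (m + 1 : MvPolynomial (Fin N) K) ≠ 0 := by exact_mod_cast Nat.succ_ne_zero m
  replace h1 := congrArg (MvPolynomial.eval 0) (mul_left_cancel₀ hm h1)
  rwa [eval_zero_trace_generic_mul, eval_zero_trace_generic_mul] at h1

end CMData
end CalogeroMoser

section CalogeroMoser
open Matrix
namespace CMData

section Words
variable {K : Type*} [CommRing K] {n : Type*} [Fintype n] [DecidableEq n] (D : CMData K n)

/-- The value of a word in two letters at the matrices `x` and `y`. -/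
def word (l : List Bool) : Matrix n n K := (l.map fun c => cond c D.x D.y).prod

@[simp] theorem word_nil : D.word [] = 1 := rfl

@[simp] theorem word_cons (c : Bool) (l : List Bool) :
    D.word (c :: l) = cond c D.x D.y * D.word l := by
  simp [word]

theorem word_append (l l' : List Bool) : D.word (l ++ l') = D.word l * D.word l' := by
  simp [word]

theorem word_replicate (c : Bool) (m : ℕ) : D.word (List.replicate m c) = cond c D.x D.y ^ m := by
  simp [word]

/-- The matrix coefficient of a word between the vector `i` and the covector `j`. -/
def wordVal (l : List Bool) : K := D.j ⬝ᵥ (D.word l *ᵥ D.i)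

theorem wordVal_swap (l l' : List Bool) :
    D.wordVal (l ++ true :: false :: l') = D.wordVal (l ++ false :: true :: l') +
      D.wordVal (l ++ l') + D.wordVal l * D.wordVal l' := by
  simp only [wordVal, word_append, word_cons, cond_true, cond_false]
  rw [← mul_assoc D.x, D.x_mul_y]
  simp only [add_mul, mul_add, one_mul, Matrix.add_mulVec, dotProduct_add, ← mul_assoc]
  rw [add_assoc]
  congr 2
  simp only [← Matrix.mulVec_mulVec, Matrix.vecMulVec_mulVec]
  simp [Matrix.mulVec_smul, mul_comm]

theorem trace_mul_vecMulVec_mul (a p q : ℕ) :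
    (D.x ^ a * (D.y ^ p * vecMulVec D.i D.j * D.y ^ q)).trace =
      D.wordVal (List.replicate q false ++ (List.replicate a true ++ List.replicate p false)) := by
  rw [← mul_assoc, Matrix.trace_mul_comm, ← mul_assoc, ← mul_assoc, Matrix.mul_vecMulVec,
    Matrix.trace_vecMulVec, wordVal, dotProduct_comm]
  simp [word_append, word_replicate, mul_assoc]

theorem trace_mul_pow_add_sum_eq_zero (a c : ℕ) :
    (c + 1 : K) * (D.x ^ a * D.y ^ c).trace +
      ∑ p ∈ Finset.HasAntidiagonal.antidiagonal c, D.wordVal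
        (List.replicate p.2 false ++ (List.replicate a true ++ List.replicate p.1 false)) = 0 := by
  have h := congrArg (fun M => (D.x ^ a * M).trace) (D.x_mul_y_pow_succ c)
  simp only [mul_add, Matrix.trace_add, Matrix.mul_smul, Matrix.trace_smul, Finset.mul_sum,
    Matrix.trace_sum] at h
  simp only [trace_mul_vecMulVec_mul] at h
  rw [← mul_assoc, ← pow_succ, ← mul_assoc, Matrix.trace_mul_comm _ D.x, ← mul_assoc, ← pow_succ',
    add_assoc] at h
  simpa using h.symm

end Words

section Field
variable {K : Type*} [Field K] [CharZero K] {n n' : Type*} [Fintype n] [DecidableEq n]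
  [Fintype n'] [DecidableEq n'] (D : CMData K n) (D' : CMData K n')

omit [CharZero K] in
theorem wordVal_sub_eq_of_perm {L : ℕ}
    (h : ∀ l : List Bool, l.length < L → D.wordVal l = D'.wordVal l) {l l' : List Bool}
    (hl : l.Perm l') (p : List Bool) (hp : p.length + l.length = L) :
    D.wordVal (p ++ l) - D'.wordVal (p ++ l) = D.wordVal (p ++ l') - D'.wordVal (p ++ l') := by
  have hswap : ∀ p l : List Bool, p.length + (l.length + 2) = L →
      D.wordVal (p ++ true :: false :: l) - D'.wordVal (p ++ true :: false :: l) =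
        D.wordVal (p ++ false :: true :: l) - D'.wordVal (p ++ false :: true :: l) := by
    intro p l hL
    rw [wordVal_swap, wordVal_swap, h (p ++ l) (by simp; omega), h p (by omega), h l (by omega)]
    ring
  induction hl generalizing p with
  | nil => rfl
  | cons c _ ih => simpa using ih (p ++ [c]) (by simp at hp ⊢; omega)
  | swap c d l =>
    have hL : p.length + (l.length + 2) = L := by simpa [add_assoc] using hp
    cases c <;> cases d
    · rfl
    · exact hswap p l hL
    · exact (hswap p l hL).symm
    · rfl
  | trans h1 _ ih1 ih2 => exact (ih1 p hp).trans (ih2 p (h1.length_eq ▸ hp))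

theorem wordVal_eq (h : ∀ m b, (D.x ^ m * D.y ^ b).trace = (D'.x ^ m * D'.y ^ b).trace)
    (l : List Bool) : D.wordVal l = D'.wordVal l := by
  induction hL : l.length using Nat.strong_induction_on generalizing l with
  | _ L ih =>
  subst hL
  have hperm : ∀ l' : List Bool, l.Perm l' →
      D.wordVal l - D'.wordVal l = D.wordVal l' - D'.wordVal l' := fun l' hl' =>
    D.wordVal_sub_eq_of_perm D' (fun l' hl' => ih _ hl' l' rfl) hl' [] (by simp)
  let a := l.count true
  let c := l.count false
  have h0 := congrArg₂ (· - ·) (D.trace_mul_pow_add_sum_eq_zero a c)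
    (D'.trace_mul_pow_add_sum_eq_zero a c)
  simp only [h, sub_zero, add_sub_add_left_eq_sub] at h0
  rw [← Finset.sum_sub_distrib, Finset.sum_congr rfl fun p hp => (hperm _ ?_).symm,
    Finset.sum_const, Finset.Nat.card_antidiagonal, nsmul_eq_mul] at h0
  · exact sub_eq_zero.mp ((mul_eq_zero.mp h0).resolve_left (by exact_mod_cast Nat.succ_ne_zero c))
  · have hp' := Finset.HasAntidiagonal.mem_antidiagonal.mp hp
    rw [List.perm_iff_count]
    intro b
    cases b
    · simp [List.count_replicate]; omega
    · simp [List.count_replicate]; rfl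

/-- The vector obtained from a linear combination of words by applying it to `i`. -/
noncomputable def wordMap : (List Bool →₀ K) →ₗ[K] (n → K) :=
  Finsupp.linearCombination K fun l => D.word l *ᵥ D.i

omit [CharZero K] in
theorem wordMap_single (l : List Bool) (a : K) :
    D.wordMap (Finsupp.single l a) = a • (D.word l *ᵥ D.i) := by
  simp [wordMap]

omit [CharZero K] in
theorem wordMap_mapDomain (c : Bool) (f : List Bool →₀ K) :
    D.wordMap (f.mapDomain (List.cons c)) = cond c D.x D.y *ᵥ D.wordMap f := by
  induction f using Finsupp.induction_linear with
  | zero => simp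
  | add f g hf hg => rw [Finsupp.mapDomain_add, map_add, map_add, Matrix.mulVec_add, hf, hg]
  | single l a =>
    rw [Finsupp.mapDomain_single, wordMap_single, wordMap_single, word_cons, Matrix.mulVec_smul,
      Matrix.mulVec_mulVec]

theorem wordMap_surjective : Function.Surjective D.wordMap := by
  rw [← LinearMap.range_eq_top]
  apply D.eq_top_of_invariant
  · rintro _ ⟨f, rfl⟩
    exact ⟨_, D.wordMap_mapDomain true f⟩
  · rintro _ ⟨f, rfl⟩
    exact ⟨_, D.wordMap_mapDomain false f⟩
  · exact ⟨Finsupp.single [] 1, by simp [wordMap_single]⟩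

theorem eq_zero_of_dotProduct_word {v : n → K} (hv : ∀ l, D.j ⬝ᵥ (D.word l *ᵥ v) = 0) : v = 0 := by
  let W : Submodule K (n → K) :=
    { carrier := {v | ∀ l, D.j ⬝ᵥ (D.word l *ᵥ v) = 0}
      add_mem' := fun ha hb l => by rw [Matrix.mulVec_add, dotProduct_add, ha l, hb l, add_zero]
      zero_mem' := fun l => by simp
      smul_mem' := fun c _ ha l => by rw [Matrix.mulVec_smul, dotProduct_smul, ha l, smul_zero] }
  have hW : ∀ c : Bool, ∀ w ∈ W, cond c D.x D.y *ᵥ w ∈ W := fun c w hw l => by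
    simpa [word_append] using hw (l ++ [c])
  have hbot := D.eq_bot_of_invariant W (hW true) (hW false) fun w hw => by simpa using hw []
  exact (Submodule.mem_bot K).mp (hbot ▸ (show v ∈ W from hv))

omit [CharZero K] in
theorem dotProduct_word_wordMap (f : List Bool →₀ K) (l : List Bool) :
    D.j ⬝ᵥ (D.word l *ᵥ D.wordMap f) = f.sum fun l' a => a * D.wordVal (l ++ l') := by
  induction f using Finsupp.induction_linear with
  | zero => simp
  | add f g hf hg =>
    rw [map_add, Matrix.mulVec_add, dotProduct_add, hf, hg,
      Finsupp.sum_add_index' (by simp) (fun _ _ _ => add_mul _ _ _)]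
  | single l a =>
    rw [wordMap_single, Finsupp.sum_single_index (by simp), Matrix.mulVec_smul, dotProduct_smul,
      wordVal, word_append, Matrix.mulVec_mulVec, smul_eq_mul]

theorem wordMap_eq_zero_iff (f : List Bool →₀ K) :
    D.wordMap f = 0 ↔ ∀ l, (f.sum fun l' a => a * D.wordVal (l ++ l')) = 0 := by
  simp_rw [← dotProduct_word_wordMap]
  exact ⟨fun h l => by simp [h], D.eq_zero_of_dotProduct_word⟩

/-- An isomorphism between two sets of Calogero–Moser data. -/
structure Iso where
  e : (n → K) ≃ₗ[K] (n' → K)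
  map_x (v : n → K) : e (D.x *ᵥ v) = D'.x *ᵥ e v
  map_y (v : n → K) : e (D.y *ᵥ v) = D'.y *ᵥ e v
  map_i : e D.i = D'.i
  dot_j (v : n → K) : D'.j ⬝ᵥ e v = D.j ⬝ᵥ v

theorem nonempty_iso_of_wordVal_eq (h : ∀ l, D.wordVal l = D'.wordVal l) :
    Nonempty (D.Iso D') := by
  have hker : LinearMap.ker D.wordMap = LinearMap.ker D'.wordMap := by
    ext f
    simp only [LinearMap.mem_ker, wordMap_eq_zero_iff, h]
  let e := ((D.wordMap.quotKerEquivOfSurjective D.wordMap_surjective).symm.trans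
    (Submodule.quotEquivOfEq _ _ hker)).trans
    (D'.wordMap.quotKerEquivOfSurjective D'.wordMap_surjective)
  have he : ∀ f, e (D.wordMap f) = D'.wordMap f := by
    intro f
    have h1 : (D.wordMap.quotKerEquivOfSurjective D.wordMap_surjective).symm (D.wordMap f) =
        Submodule.Quotient.mk f := by
      rw [LinearEquiv.symm_apply_eq]
      rfl
    simp only [e, LinearEquiv.trans_apply, h1]
    rfl
  have hc : ∀ c : Bool, ∀ v, e (cond c D.x D.y *ᵥ v) = cond c D'.x D'.y *ᵥ e v := by
    intro c v
    obtain ⟨f, rfl⟩ := D.wordMap_surjective v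
    rw [← wordMap_mapDomain, he, he, wordMap_mapDomain]
  refine ⟨⟨e, hc true, hc false, ?_, fun v => ?_⟩⟩
  · have := he (Finsupp.single [] 1)
    simpa [wordMap_single] using this
  · obtain ⟨f, rfl⟩ := D.wordMap_surjective v
    have h1 := D.dotProduct_word_wordMap f []
    have h2 := D'.dotProduct_word_wordMap f []
    rw [word_nil, Matrix.one_mulVec] at h1 h2
    rw [he, h1, h2]
    simp only [h]

theorem nonempty_iso
    (h : ∀ g p : K[X], aeval (D.x - aeval D.y g) p = 0 → (aeval (D'.x - aeval D'.y g) p).trace = 0)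
    (h' : ∀ g p : K[X], aeval (D'.x - aeval D'.y g) p = 0 →
      (aeval (D.x - aeval D.y g) p).trace = 0) : Nonempty (D.Iso D') :=
  D.nonempty_iso_of_wordVal_eq D' (D.wordVal_eq D' (D.trace_pow_mul_pow_eq D' h h'))

end Field

end CMData
end CalogeroMoser

section Weyl

section Eval
variable {k B : Type*} [Field k] [Semiring B] [Algebra k B]

/-- The normally ordered substitution `∑ fₙ yⁿ ↦ ∑ fₙ(T) Dⁿ`. -/
noncomputable def normalEval (T D : B) : k[X][X] →ₗ[k] B :=
  Polynomial.lsum fun n => LinearMap.mulRight k (D ^ n) ∘ₗ (aeval T : k[X] →ₐ[k] B).toLinearMap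

theorem normalEval_monomial (T D : B) (n : ℕ) (f : k[X]) :
    normalEval T D (monomial n f) = aeval T f * D ^ n := by
  simp [normalEval, lsum_apply, sum_monomial_index]

theorem normalEval_C (T D : B) (f : k[X]) : normalEval T D (C f) = aeval T f := by
  rw [← monomial_zero_left, normalEval_monomial, pow_zero, mul_one]

theorem normalEval_one (T D : B) : normalEval T D (1 : k[X][X]) = 1 := by
  rw [← C_1, normalEval_C, map_one]

theorem normalEval_mul_X (T D : B) (s : k[X][X]) :
    normalEval T D (s * X) = normalEval T D s * D := by
  induction s using Polynomial.induction_on' with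
  | add a b ha hb => rw [add_mul, map_add, map_add, ha, hb, add_mul]
  | monomial n f =>
    rw [monomial_mul_X, normalEval_monomial, normalEval_monomial, pow_succ, mul_assoc]

theorem normalEval_C_mul (T D : B) (f : k[X]) (s : k[X][X]) :
    normalEval T D (C f * s) = aeval T f * normalEval T D s := by
  induction s using Polynomial.induction_on' with
  | add a b ha hb => rw [mul_add, map_add, map_add, ha, hb, mul_add]
  | monomial n g =>
    rw [C_mul_monomial, normalEval_monomial, normalEval_monomial, map_mul, mul_assoc]

theorem commute_aeval_self (x : B) (h : k[X]) : Commute x (aeval x h) := by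
  simpa using (Commute.all X h).map (aeval (R := k) x)

omit [Field k] [Algebra k B] in
theorem pow_mul_of_mul_eq_mul_add_one {T D : B} (h : D * T = T * D + 1) (n : ℕ) :
    D ^ n * T = T * D ^ n + n * D ^ (n - 1) := by
  induction n with
  | zero => simp
  | succ n ih =>
    rw [pow_succ, mul_assoc, h, mul_add, ← mul_assoc, ih]
    rcases n with _ | n
    · simp
    · simp only [Nat.add_sub_cancel, pow_succ]
      rw [mul_one, add_mul, Nat.cast_succ (n + 1), add_one_mul, mul_assoc, mul_assoc, add_assoc,
        mul_assoc (_ : B) (D ^ n) D]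

theorem normalEval_mul (T D : B) (h : D * T = T * D + 1) (s : k[X][X]) :
    normalEval T D s * T = normalEval T D (C X * s + derivative s) := by
  induction s using Polynomial.induction_on' with
  | add a b ha hb =>
    rw [mul_add, derivative_add, map_add, add_mul, ha, hb, ← map_add]
    congr 1; ring
  | monomial n f =>
    rw [C_mul_monomial, derivative_monomial, map_add, normalEval_monomial, normalEval_monomial,
      normalEval_monomial, mul_assoc, pow_mul_of_mul_eq_mul_add_one h, mul_add, map_mul, map_mul,
      aeval_X, map_natCast, ← mul_assoc, mul_assoc (aeval T f) n]
    congr 2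
    exact (commute_aeval_self T f).eq.symm

end Eval

/-- A presentation of a `k`-algebra as the first Weyl algebra: two generators `t`, `d` with
`d t - t d = 1` whose normally ordered monomials form a basis. -/
structure WeylPresentation (k A : Type*) [Field k] [Ring A] [Algebra k A] where
  t : A
  d : A
  d_mul_t : d * t - t * d = 1
  bijective : Function.Bijective (normalEval (k := k) t d)

namespace WeylPresentation
variable {k A : Type*} [Field k] [Ring A] [Algebra k A] (W : WeylPresentation k A)

include W in
theorem induction {P : A → Prop} (algebraMap : ∀ c, P (algebraMap k A c)) (t : P W.t) (d : P W.d)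
    (add : ∀ a b, P a → P b → P (a + b)) (mul : ∀ a b, P a → P b → P (a * b)) (a : A) : P a := by
  obtain ⟨s, rfl⟩ := W.bijective.2 a
  have one : P 1 := by simpa using algebraMap 1
  have pow : ∀ a n, P a → P (a ^ n) := fun a n ha => by
    induction n with
    | zero => simpa using one
    | succ n ih => rw [pow_succ]; exact mul _ _ ih ha
  induction s using Polynomial.induction_on' with
  | add a b ha hb => rw [map_add]; exact add _ _ ha hb
  | monomial n f =>
    rw [normalEval_monomial]
    refine mul _ _ ?_ (pow _ _ d)
    induction f using Polynomial.induction_on' with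
    | add a b ha hb => rw [map_add]; exact add _ _ ha hb
    | monomial n f =>
      rw [aeval_monomial]
      exact mul _ _ (algebraMap _) (pow _ _ t)

/-- The normally ordered symbol of an element of the Weyl algebra. -/
noncomputable def sym : A ≃ₗ[k] k[X][X] :=
  (LinearEquiv.ofBijective (normalEval W.t W.d) W.bijective).symm

theorem normalEval_sym (a : A) : normalEval W.t W.d (W.sym a) = a :=
  W.sym.symm_apply_apply a

theorem sym_normalEval (s : k[X][X]) : W.sym (normalEval W.t W.d s) = s :=
  W.sym.apply_symm_apply s

theorem sym_mul_d (a : A) : W.sym (a * W.d) = X * W.sym a := by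
  conv_lhs => rw [← W.normalEval_sym a]
  rw [← normalEval_mul_X, W.sym_normalEval, mul_comm]

theorem sym_mul_t (a : A) : W.sym (a * W.t) = C X * W.sym a + derivative (W.sym a) := by
  conv_lhs => rw [← W.normalEval_sym a]
  rw [normalEval_mul _ _ (sub_eq_iff_eq_add'.mp W.d_mul_t), W.sym_normalEval]

theorem sym_aeval_mul (f : k[X]) (a : A) : W.sym (aeval W.t f * a) = C f * W.sym a := by
  conv_lhs => rw [← W.normalEval_sym a]
  rw [← normalEval_C_mul, W.sym_normalEval]

theorem sym_t_mul (a : A) : W.sym (W.t * a) = C X * W.sym a := by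
  rw [← W.sym_aeval_mul, aeval_X]

theorem sym_one : W.sym (1 : A) = 1 := by
  rw [← normalEval_one (k := k) W.t W.d, W.sym_normalEval]

theorem sym_aeval_t (f : k[X]) : W.sym (aeval W.t f) = C f := by
  rw [← normalEval_C W.t W.d, W.sym_normalEval]

section Lift
variable {B : Type*} [Ring B] [Algebra k B]

/-- The universal property of the Weyl algebra. -/
noncomputable def lift (T D : B) (h : D * T - T * D = 1) : A →ₐ[k] B :=
  AlgHom.ofLinearMap (normalEval T D ∘ₗ W.sym.toLinearMap)
    (by simp [W.sym_one, normalEval_one]) (by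
      intro a b
      simp only [LinearMap.comp_apply, LinearEquiv.coe_coe]
      induction b using W.induction generalizing a with
      | algebraMap c =>
        rw [← Algebra.commutes, ← Algebra.smul_def, Algebra.algebraMap_eq_smul_one, map_smul,
          map_smul, map_smul, map_smul, W.sym_one, normalEval_one, mul_smul_comm, mul_one]
      | t =>
        have ht : normalEval T D (W.sym W.t) = T := by
          rw [← aeval_X (R := k) W.t, W.sym_aeval_t, normalEval_C, aeval_X]
        rw [W.sym_mul_t, ← normalEval_mul T D (sub_eq_iff_eq_add'.mp h), ht]
      | d =>
        have hd : normalEval T D (W.sym W.d) = D := by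
          rw [← one_mul W.d, W.sym_mul_d, W.sym_one, mul_comm, normalEval_mul_X, normalEval_one,
            one_mul]
        rw [W.sym_mul_d, mul_comm, normalEval_mul_X, hd]
      | add b c hb hc => rw [mul_add, map_add, map_add, map_add, map_add, hb, hc, mul_add]
      | mul b c hb hc => rw [← mul_assoc, hc, hb, hc b, mul_assoc])

theorem lift_t (T D : B) (h : D * T - T * D = 1) : W.lift T D h W.t = T := by
  change normalEval T D (W.sym W.t) = T
  rw [← aeval_X (R := k) W.t, W.sym_aeval_t, normalEval_C, aeval_X]

theorem lift_d (T D : B) (h : D * T - T * D = 1) : W.lift T D h W.d = D := by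
  change normalEval T D (W.sym W.d) = D
  rw [← one_mul W.d, W.sym_mul_d, W.sym_one, mul_comm, normalEval_mul_X, normalEval_one, one_mul]

theorem algHom_ext {f g : A →ₐ[k] B} (ht : f W.t = g W.t) (hd : f W.d = g W.d) :
    f = g := by
  ext a
  induction a using W.induction with
  | algebraMap c => simp
  | t => exact ht
  | d => exact hd
  | add a b ha hb => rw [map_add, map_add, ha, hb]
  | mul a b ha hb => rw [map_mul, map_mul, ha, hb]

end Lift

theorem shiftT_rel (h : k[X]) : W.d * (W.t + aeval W.d h) - (W.t + aeval W.d h) * W.d = 1 := by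
  rw [mul_add, add_mul, (commute_aeval_self W.d h).eq, add_sub_add_right_eq_sub, W.d_mul_t]

/-- The automorphism `t ↦ t + h(∂)`, `∂ ↦ ∂`. -/
noncomputable def shiftT (h : k[X]) : A ≃ₐ[k] A :=
  AlgEquiv.ofAlgHom (W.lift _ _ (W.shiftT_rel h)) (W.lift _ _ (W.shiftT_rel (-h)))
    (W.algHom_ext (by simp [W.lift_t, W.lift_d, ← aeval_algHom_apply])
      (by simp [W.lift_d]))
    (W.algHom_ext (by simp [W.lift_t, W.lift_d, ← aeval_algHom_apply])
      (by simp [W.lift_d]))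

theorem shiftT_t (h : k[X]) : W.shiftT h W.t = W.t + aeval W.d h := W.lift_t _ _ (W.shiftT_rel h)

theorem shiftT_d (h : k[X]) : W.shiftT h W.d = W.d := W.lift_d _ _ (W.shiftT_rel h)

theorem shiftD_rel (p : k[X]) : (W.d + aeval W.t p) * W.t - W.t * (W.d + aeval W.t p) = 1 := by
  rw [mul_add, add_mul, (commute_aeval_self W.t p).eq, add_sub_add_right_eq_sub, W.d_mul_t]

/-- The automorphism `t ↦ t`, `∂ ↦ ∂ + p(t)`. -/
noncomputable def shiftD (p : k[X]) : A ≃ₐ[k] A :=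
  AlgEquiv.ofAlgHom (W.lift _ _ (W.shiftD_rel p)) (W.lift _ _ (W.shiftD_rel (-p)))
    (W.algHom_ext (by simp [W.lift_t]) (by simp [W.lift_t, W.lift_d, ← aeval_algHom_apply]))
    (W.algHom_ext (by simp [W.lift_t]) (by simp [W.lift_t, W.lift_d, ← aeval_algHom_apply]))

theorem shiftD_t (p : k[X]) : W.shiftD p W.t = W.t := W.lift_t _ _ (W.shiftD_rel p)

theorem shiftD_d (p : k[X]) : W.shiftD p W.d = W.d + aeval W.t p := W.lift_d _ _ (W.shiftD_rel p)

end WeylPresentation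
end Weyl

namespace WeylA
variable (k : Type) [Field k]

/-- The generator `t` of the Weyl algebra. -/
noncomputable def t : WeylA k := ⟨Tmul k, Algebra.subset_adjoin (by simp)⟩

/-- The generator `∂` of the Weyl algebra. -/
noncomputable def d : WeylA k := ⟨Dop k, Algebra.subset_adjoin (by simp)⟩

theorem d_mul_t : d k * t k = t k * d k + 1 := by
  have h : Dop k * Tmul k = Tmul k * Dop k + 1 := by
    refine LinearMap.ext fun p => ?_
    rw [LinearMap.add_apply, Module.End.mul_apply, Module.End.mul_apply, Module.End.one_apply]
    refine (derivative_mul (f := X) (g := p)).trans ?_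
    rw [derivative_X, one_mul, add_comm]
    rfl
  exact Subtype.ext h

variable {k}

theorem normalEval_apply_apply (s : k[X][X]) (p : k[X]) :
    (normalEval (t k) (d k) s : Module.End k k[X]) p = s.sum fun n f => f * derivative^[n] p := by
  have ht : ∀ f : k[X], ((aeval (t k) f : WeylA k) : Module.End k k[X]) =
      LinearMap.mulLeft k f := by
    intro f
    have h : ((aeval (t k) f : WeylA k) : Module.End k k[X]) = aeval (Tmul k) f :=
      (aeval_algHom_apply (WeylA k).val (t k) f).symm
    rw [h, Tmul, aeval_algHom_apply, aeval_X_left_apply]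
    rfl
  have hd : ∀ n, ((d k ^ n : WeylA k) : Module.End k k[X]) p = derivative^[n] p := fun n => by
    rw [SubmonoidClass.coe_pow, Module.End.pow_apply]
    rfl
  induction s using Polynomial.induction_on' with
  | add a b ha hb =>
    rw [map_add, sum_add_index _ _ _ (by simp) (fun _ _ _ => add_mul _ _ _), ← ha, ← hb]
    rfl
  | monomial n f =>
    rw [normalEval_monomial, sum_monomial_index _ _ (by simp), ← hd n]
    change ((aeval (t k) f : WeylA k) : Module.End k k[X]) _ = _
    rw [ht]
    rfl

variable [CharZero k]

theorem normalEval_injective : Function.Injective (normalEval (k := k) (t k) (d k)) := by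
  refine (injective_iff_map_eq_zero _).mpr fun s hs => ?_
  by_contra hne
  have h := normalEval_apply_apply s (X ^ s.natTrailingDegree)
  rw [hs, sum_def, Finset.sum_eq_single s.natTrailingDegree] at h
  · rw [iterate_derivative_X_pow_eq_natCast_mul] at h
    simp only [Nat.sub_self, pow_zero, mul_one, Nat.descFactorial_self] at h
    have h0 : (0 : k[X]) = s.coeff s.natTrailingDegree * (s.natTrailingDegree.factorial : k[X]) := h
    rcases mul_eq_zero.mp h0.symm with h1 | h1
    · exact hne (by simpa using h1)
    · exact Nat.factorial_ne_zero _ (by exact_mod_cast h1)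
  · intro b hb hb'
    rw [iterate_derivative_eq_zero, mul_zero]
    rw [natDegree_X_pow]
    exact lt_of_le_of_ne (natTrailingDegree_le_of_mem_supp b hb) (Ne.symm hb')
  · intro h1
    exact absurd (natTrailingDegree_mem_support_of_nonzero hne) h1

omit [CharZero k] in
theorem normalEval_surjective : Function.Surjective (normalEval (k := k) (t k) (d k)) := by
  suffices ∀ a (ha : a ∈ Algebra.adjoin k {Tmul k, Dop k}) (s : k[X][X]), ∃ s',
      normalEval (t k) (d k) s' = normalEval (t k) (d k) s * (⟨a, ha⟩ : WeylA k) by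
    intro a
    obtain ⟨s, hs⟩ := this a a.2 1
    exact ⟨s, by rw [hs, normalEval_one, one_mul]⟩
  intro a ha
  induction ha using Algebra.adjoin_induction with
  | mem a ha =>
    intro s
    rcases ha with rfl | rfl
    · exact ⟨_, (normalEval_mul _ _ (d_mul_t k) s).symm⟩
    · exact ⟨_, normalEval_mul_X _ _ s⟩
  | algebraMap c =>
    intro s
    refine ⟨c • s, ?_⟩
    rw [map_smul, Algebra.smul_def, Algebra.commutes]
    rfl
  | add a b _ _ iha ihb =>
    intro s
    obtain ⟨u, hu⟩ := iha s
    obtain ⟨v, hv⟩ := ihb s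
    refine ⟨u + v, ?_⟩
    rw [map_add, hu, hv]
    exact (mul_add _ _ _).symm
  | mul a b _ _ iha ihb =>
    intro s
    obtain ⟨u, hu⟩ := iha s
    obtain ⟨v, hv⟩ := ihb u
    refine ⟨v, ?_⟩
    rw [hv, hu]
    exact mul_assoc _ _ _

end WeylA

section VectorDivision
open Matrix

variable {R n : Type*} [CommRing R]

/-- The constant polynomial vector attached to a vector. -/
noncomputable def constVec : (n → R) →ₗ[R] (n → R[X]) :=
  LinearMap.pi fun l => (monomial 0) ∘ₗ LinearMap.proj l

@[simp] theorem constVec_apply (r : n → R) (l : n) : constVec r l = C (r l) := rfl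

variable [Fintype n]

/-- Multiplication of polynomial vectors by `X - M`. -/
noncomputable def subMul (M : Matrix n n R) : (n → R[X]) →ₗ[R[X]] (n → R[X]) :=
  LinearMap.lsmul R[X] _ X - (M.map C).mulVecLin

theorem subMul_apply (M : Matrix n n R) (u : n → R[X]) :
    subMul M u = (X : R[X]) • u - M.map C *ᵥ u := rfl

theorem coeff_map_C_mulVec (M : Matrix n n R) (u : n → R[X]) (l : n) (b : ℕ) :
    ((M.map C *ᵥ u) l).coeff b = (M *ᵥ fun p => (u p).coeff b) l := by
  simp [Matrix.mulVec, dotProduct]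

theorem coeff_succ_subMul (M : Matrix n n R) (u : n → R[X]) (b : ℕ) :
    (fun l => (subMul M u l).coeff (b + 1)) =
      (fun l => (u l).coeff b) - M *ᵥ fun l => (u l).coeff (b + 1) := by
  ext l
  rw [subMul_apply, Pi.sub_apply, coeff_sub, coeff_map_C_mulVec, Pi.smul_apply, smul_eq_mul,
    coeff_X_mul, Pi.sub_apply]

theorem coeff_eq_zero_of_subMul {M : Matrix n n R} {u : n → R[X]} {b : ℕ}
    (h : ∀ c > b, ∀ l, (subMul M u l).coeff c = 0) {c : ℕ} (hc : b ≤ c) (l : n) :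
    (u l).coeff c = 0 := by
  obtain ⟨N, hN⟩ : ∃ N, ∀ c ≥ N, ∀ l, (u l).coeff c = 0 := by
    refine ⟨Finset.univ.sup (fun l => (u l).natDegree) + 1, fun c hc l => ?_⟩
    exact coeff_eq_zero_of_natDegree_lt
      ((Finset.le_sup (f := fun l => (u l).natDegree) (Finset.mem_univ l)).trans_lt hc)
  have key : ∀ e, ∀ c ≥ b, N ≤ c + e → ∀ l, (u l).coeff c = 0 := by
    intro e
    induction e with
    | zero => exact fun c _ hN' => hN c hN'
    | succ e ih =>
      intro c hc hN' l
      have h1 := congrFun (coeff_succ_subMul M u c) l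
      simp only [h (c + 1) (by omega) l, Pi.sub_apply] at h1
      rw [show (fun l => (u l).coeff (c + 1)) = 0 from
        funext fun l => ih (c + 1) (by omega) (by omega) l] at h1
      simpa using h1.symm
  exact key N c hc (by omega) l

theorem map_C_mulVec_constVec (M : Matrix n n R) (r : n → R) :
    M.map C *ᵥ constVec r = constVec (M *ᵥ r) := by
  ext1 l
  simp [Matrix.mulVec, dotProduct]

/-- Division of polynomial vectors by `X - M`: every polynomial vector is uniquely of the form
`(X - M) u + r` with `r` constant. -/
noncomputable def divEquiv (M : Matrix n n R) : ((n → R[X]) × (n → R)) ≃ₗ[R] (n → R[X]) :=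
  LinearEquiv.ofBijective (((subMul M).restrictScalars R).coprod constVec) <| by
    constructor
    · refine (injective_iff_map_eq_zero _).mpr fun ⟨u, r⟩ h => ?_
      have h0 : subMul M u + constVec r = 0 := h
      have hu : u = 0 := by
        ext l c
        refine coeff_eq_zero_of_subMul (M := M) (b := 0) (fun c hc l => ?_) (Nat.zero_le _) l
        have := congrArg (fun p => p.coeff c) (congrFun h0 l)
        simpa [coeff_C, (show c ≠ 0 by omega)] using this
      rw [hu, map_zero, zero_add] at h0
      rw [hu, Prod.mk_eq_zero]
      exact ⟨rfl, funext fun l => C_injective (by simpa using congrFun h0 l)⟩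
    · suffices ∀ d, ∀ w : n → R[X], (∀ l, (w l).natDegree < d) →
          ∃ u r, subMul M u + constVec r = w by
        intro w
        obtain ⟨u, r, h⟩ := this (Finset.univ.sup (fun l => (w l).natDegree) + 1) w fun l =>
          Nat.lt_succ_of_le (Finset.le_sup (f := fun l => (w l).natDegree) (Finset.mem_univ l))
        exact ⟨(u, r), h⟩
      intro d
      induction d with
      | zero =>
        refine fun w hw => ⟨0, 0, funext fun l => absurd (hw l) (Nat.not_lt_zero _)⟩
      | succ d ih =>
        intro w hw
        rcases Nat.eq_zero_or_pos d with rfl | hd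
        · refine ⟨0, fun l => (w l).coeff 0, funext fun l => ?_⟩
          rw [map_zero, zero_add, constVec_apply]
          exact (eq_C_of_natDegree_eq_zero (Nat.lt_one_iff.mp (hw l))).symm
        obtain ⟨u, r, h⟩ := ih (fun l => (w l).divX) fun l => by
          rw [natDegree_divX_eq_natDegree_tsub_one]
          have := hw l
          omega
        refine ⟨(X : R[X]) • u + constVec r, (fun l => (w l).coeff 0) + M *ᵥ r, ?_⟩
        have h1 : (X : R[X]) • (subMul M u + constVec r) +
            constVec (fun l => (w l).coeff 0) = w := by
          rw [h]
          ext1 l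
          simp [X_mul_divX_add]
        refine .trans ?_ h1
        rw [map_add, map_smul, subMul_apply M (constVec r), map_C_mulVec_constVec, map_add,
          smul_add]
        abel

/-- The quotient of a polynomial vector by `X - M`. -/
noncomputable def vecDiv (M : Matrix n n R) : (n → R[X]) →ₗ[R] (n → R[X]) :=
  LinearMap.fst R _ _ ∘ₗ (divEquiv M).symm.toLinearMap

/-- The remainder of a polynomial vector modulo `X - M`. -/
noncomputable def vecRem (M : Matrix n n R) : (n → R[X]) →ₗ[R] (n → R) :=
  LinearMap.snd R _ _ ∘ₗ (divEquiv M).symm.toLinearMap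

variable (M : Matrix n n R)

theorem subMul_vecDiv_add (w : n → R[X]) : subMul M (vecDiv M w) + constVec (vecRem M w) = w :=
  (divEquiv M).apply_symm_apply w

theorem vecDiv_vecRem_of_eq {w u : n → R[X]} {r : n → R} (h : subMul M u + constVec r = w) :
    vecDiv M w = u ∧ vecRem M w = r := by
  have h1 : (divEquiv M).symm w = (u, r) := by
    rw [LinearEquiv.symm_apply_eq]
    exact h.symm
  exact ⟨congrArg Prod.fst h1, congrArg Prod.snd h1⟩

theorem vecRem_subMul (u : n → R[X]) : vecRem M (subMul M u) = 0 :=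
  (vecDiv_vecRem_of_eq M (u := u) (r := 0) (by simp)).2

theorem vecDiv_subMul (u : n → R[X]) : vecDiv M (subMul M u) = u :=
  (vecDiv_vecRem_of_eq M (u := u) (r := 0) (by simp)).1

theorem vecRem_constVec (r : n → R) : vecRem M (constVec r) = r :=
  (vecDiv_vecRem_of_eq M (u := 0) (r := r) (by simp)).2

theorem vecDiv_constVec (r : n → R) : vecDiv M (constVec r) = 0 :=
  (vecDiv_vecRem_of_eq M (u := 0) (r := r) (by simp)).1

theorem subMul_injective : Function.Injective (subMul M) :=
  Function.LeftInverse.injective (vecDiv_subMul M)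

theorem vecDiv_vecRem_X_smul (w : n → R[X]) :
    vecDiv M ((X : R[X]) • w) = (X : R[X]) • vecDiv M w + constVec (vecRem M w) ∧
      vecRem M ((X : R[X]) • w) = M *ᵥ vecRem M w := by
  apply vecDiv_vecRem_of_eq
  conv_rhs => rw [← subMul_vecDiv_add M w]
  rw [map_add, map_smul, subMul_apply M (constVec _), map_C_mulVec_constVec, smul_add]
  abel

theorem vecDiv_X_smul (w : n → R[X]) :
    vecDiv M ((X : R[X]) • w) = (X : R[X]) • vecDiv M w + constVec (vecRem M w) :=
  (vecDiv_vecRem_X_smul M w).1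

theorem vecRem_X_smul (w : n → R[X]) : vecRem M ((X : R[X]) • w) = M *ᵥ vecRem M w :=
  (vecDiv_vecRem_X_smul M w).2

theorem coeff_vecDiv_eq_zero {w : n → R[X]} {b : ℕ} (h : ∀ c > b, ∀ l, (w l).coeff c = 0) {c : ℕ}
    (hc : b ≤ c) (l : n) : (vecDiv M w l).coeff c = 0 := by
  refine coeff_eq_zero_of_subMul (M := M) (fun c hc l => ?_) hc l
  rw [eq_sub_of_add_eq (subMul_vecDiv_add M w), Pi.sub_apply, coeff_sub, h c hc, constVec_apply,
    coeff_C_of_ne_zero (by omega), sub_zero]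

end VectorDivision

section Actions
open Matrix MulOpposite

variable {k A n : Type*} [Field k] [Ring A] [Algebra k A] [Fintype n] [DecidableEq n]

/-- Matrices act on column vectors over `A`, commuting with right multiplication. -/
noncomputable def matAct : Matrix n n k →ₐ[k] Module.End Aᵐᵒᵖ (n → A) :=
  AlgHom.ofLinearMap
    { toFun := fun M =>
        { toFun := fun u l => ∑ p, M l p • u p
          map_add' := fun u v => by ext l; simp [Finset.sum_add_distrib]
          map_smul' := fun a u => by ext l; simp [Finset.sum_mul] }
      map_add' := fun M N => by ext u l; simp [add_smul, Finset.sum_add_distrib]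
      map_smul' := fun c M => by ext u l; simp [mul_smul, Finset.smul_sum] }
    (by ext u l; simp [Matrix.one_apply])
    (by
      intro M N
      refine LinearMap.ext fun u => funext fun l => ?_
      simp only [LinearMap.coe_mk, AddHom.coe_mk, Module.End.mul_apply, Matrix.mul_apply,
        Finset.sum_smul, Finset.smul_sum, mul_smul]
      exact Finset.sum_comm)

theorem matAct_apply (M : Matrix n n k) (u : n → A) (l : n) :
    matAct M u l = ∑ p, M l p • u p := rfl

variable (n) in
/-- Left multiplication on column vectors over `A`. -/
noncomputable def leftAct : A →ₐ[k] Module.End Aᵐᵒᵖ (n → A) :=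
  AlgHom.ofLinearMap
    { toFun := fun a =>
        { toFun := fun u l => a * u l
          map_add' := fun u v => by ext l; simp [mul_add]
          map_smul' := fun b u => by ext l; simp [mul_assoc] }
      map_add' := fun a b => by ext u l; simp [add_mul]
      map_smul' := fun c a => by ext u l; simp }
    (by ext u l; simp)
    (by intro a b; ext u l; simp [mul_assoc])

theorem leftAct_apply (a : A) (u : n → A) (l : n) : leftAct (k := k) n a u l = a * u l := rfl

theorem commute_matAct_leftAct (M : Matrix n n k) (a : A) :
    Commute (matAct M) (leftAct (k := k) n a) := by
  refine LinearMap.ext fun u => funext fun l => ?_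
  simp [matAct_apply, leftAct_apply, Module.End.mul_apply, Finset.mul_sum]

/-- The vector `i c` for `i` a vector of scalars. -/
noncomputable def vecAct (i : n → k) : A →ₗ[Aᵐᵒᵖ] (n → A) where
  toFun c l := i l • c
  map_add' a b := by ext l; simp
  map_smul' a b := by ext l; simp

omit [Fintype n] [DecidableEq n] in
theorem vecAct_apply (i : n → k) (c : A) (l : n) : vecAct i c l = i l • c := rfl

/-- The pairing with a covector of scalars. -/
noncomputable def covecAct (j : n → k) : (n → A) →ₗ[Aᵐᵒᵖ] A where
  toFun u := ∑ l, j l • u l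
  map_add' a b := by simp [Finset.sum_add_distrib]
  map_smul' a b := by simp [Finset.sum_mul]

omit [DecidableEq n] in
theorem covecAct_apply (j : n → k) (u : n → A) : covecAct j u = ∑ l, j l • u l := rfl

theorem matAct_vecMulVec (i j : n → k) (u : n → A) :
    matAct (vecMulVec i j) u = vecAct i (covecAct j u) := by
  ext l
  simp [matAct_apply, vecAct_apply, covecAct_apply, vecMulVec_apply, Finset.smul_sum, mul_smul]

theorem exists_aeval_sub_aeval {B : Type*} [Ring B] [Algebra k B] {a b : B} (h : Commute a b)
    (p : k[X]) : ∃ q, aeval a p - aeval b p = (a - b) * q ∧ ∀ z, Commute z a → Commute z b →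
      Commute z q := by
  induction p using Polynomial.induction_on' with
  | add p p' hp hp' =>
    obtain ⟨q, hq, hz⟩ := hp
    obtain ⟨q', hq', hz'⟩ := hp'
    refine ⟨q + q', ?_, fun z h1 h2 => (hz z h1 h2).add_right (hz' z h1 h2)⟩
    rw [map_add, map_add, mul_add, ← hq, ← hq']
    abel
  | monomial m c =>
    refine ⟨c • ∑ i ∈ Finset.range m, a ^ i * b ^ (m - 1 - i), ?_, fun z h1 h2 => ?_⟩
    · rw [mul_smul_comm, h.mul_geom_sum₂, aeval_monomial, aeval_monomial, smul_sub,
        Algebra.smul_def, Algebra.smul_def]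
    · exact (Commute.sum_right _ _ _ fun i _ =>
        (h1.pow_right _).mul_right (h2.pow_right _)).smul_right c

end Actions

namespace WeylPresentation
open Matrix MulOpposite

section MapRight
variable {k A : Type*} [Field k] [Semiring A] [Algebra k A]

/-- The image of a right ideal under an automorphism. -/
def mapRight (σ : A ≃ₐ[k] A) (I : Submodule Aᵐᵒᵖ A) : Submodule Aᵐᵒᵖ A where
  carrier := σ '' I
  add_mem' := by
    rintro _ _ ⟨x, hx, rfl⟩ ⟨y, hy, rfl⟩
    exact ⟨x + y, I.add_mem hx hy, map_add σ x y⟩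
  zero_mem' := ⟨0, I.zero_mem, map_zero σ⟩
  smul_mem' := by
    rintro a _ ⟨x, hx, rfl⟩
    refine ⟨x * σ.symm a.unop, I.smul_mem (op (σ.symm a.unop)) hx, ?_⟩
    simp [MulOpposite.smul_eq_mul_unop, map_mul]

theorem mem_mapRight {σ : A ≃ₐ[k] A} {I : Submodule Aᵐᵒᵖ A} {a : A} :
    a ∈ mapRight σ I ↔ ∃ b ∈ I, σ b = a := Iff.rfl

end MapRight

variable {k A n n' : Type*} [Field k] [Ring A] [Algebra k A] (W : WeylPresentation k A)
  [Fintype n] [DecidableEq n] [Fintype n'] [DecidableEq n']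

section Complex
variable (D : CMData k n)

/-- The endomorphism `X - t` of the space of column vectors. -/
noncomputable def opX : Module.End Aᵐᵒᵖ (n → A) := matAct D.x - leftAct (k := k) n W.t

/-- The endomorphism `Y - ∂` of the space of column vectors. -/
noncomputable def opY : Module.End Aᵐᵒᵖ (n → A) := matAct D.y - leftAct (k := k) n W.d

theorem opX_opY (w : n → A) :
    W.opX D (W.opY D w) = W.opY D (W.opX D w) + vecAct D.i (covecAct D.j w) := by
  have h1 : W.opX D * W.opY D - W.opY D * W.opX D = matAct (vecMulVec D.i D.j) := by
    have h2 := congrArg (matAct (A := A)) D.comm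
    have h3 := congrArg (leftAct (k := k) n) W.d_mul_t
    simp only [map_sub, map_mul, map_add, map_one] at h2 h3
    rw [← sub_eq_of_eq_add' h2, ← h3, opX, opY]
    simp only [mul_sub, sub_mul, (commute_matAct_leftAct D.x W.d).eq,
      (commute_matAct_leftAct D.y W.t).eq]
    abel
  have h2 := LinearMap.congr_fun h1 w
  rw [matAct_vecMulVec] at h2
  exact (sub_eq_iff_eq_add'.mp h2)

/-- The cycles of the complex attached to Calogero–Moser data. -/
noncomputable def cycles : Submodule Aᵐᵒᵖ ((n → A) × (n → A) × A) where
  carrier := {x | W.opX D x.2.1 = W.opY D x.1 + vecAct D.i x.2.2}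
  add_mem' := by
    rintro x y (hx : _ = _) (hy : _ = _)
    change W.opX D (x.2.1 + y.2.1) = W.opY D (x.1 + y.1) + vecAct D.i (x.2.2 + y.2.2)
    rw [map_add, map_add, map_add, hx, hy]
    abel
  zero_mem' := by
    change W.opX D 0 = W.opY D 0 + vecAct D.i 0
    simp
  smul_mem' := by
    rintro a x (hx : _ = _)
    change W.opX D (a • x.2.1) = W.opY D (a • x.1) + vecAct D.i (a • x.2.2)
    rw [map_smul, map_smul, map_smul, hx, smul_add]

theorem mem_cycles {x : (n → A) × (n → A) × A} :
    x ∈ W.cycles D ↔ W.opX D x.2.1 = W.opY D x.1 + vecAct D.i x.2.2 := Iff.rfl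

/-- The differential of the complex attached to Calogero–Moser data. -/
noncomputable def bdry : (n → A) →ₗ[Aᵐᵒᵖ] (n → A) × (n → A) × A :=
  (W.opX D).prod ((W.opY D).prod (covecAct D.j))

theorem bdry_apply (w : n → A) : W.bdry D w = (W.opX D w, W.opY D w, covecAct D.j w) := rfl

/-- A right ideal `I` is represented by Calogero–Moser data if it is isomorphic to the homology
of the attached complex. -/
def Rep (I : Submodule Aᵐᵒᵖ A) : Prop :=
  ∃ f : W.cycles D →ₗ[Aᵐᵒᵖ] A, LinearMap.range f = I ∧ ∀ x, f x = 0 ↔ ∃ w, W.bdry D w = x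

theorem Rep.nonempty_equiv {W : WeylPresentation k A} {D : CMData k n} {I J : Submodule Aᵐᵒᵖ A}
    (hI : W.Rep D I)
    (hJ : W.Rep D J) : Nonempty (I ≃ₗ[Aᵐᵒᵖ] J) := by
  obtain ⟨f, rfl, hf⟩ := hI
  obtain ⟨g, rfl, hg⟩ := hJ
  have hker : LinearMap.ker f = LinearMap.ker g := by
    ext x
    rw [LinearMap.mem_ker, LinearMap.mem_ker, hf, hg]
  exact ⟨(f.quotKerEquivRange.symm.trans (Submodule.quotEquivOfEq _ _ hker)).trans
    g.quotKerEquivRange⟩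

theorem Rep.of_equiv {W : WeylPresentation k A} {D : CMData k n} {I J : Submodule Aᵐᵒᵖ A}
    (hI : W.Rep D I)
    (e : I ≃ₗ[Aᵐᵒᵖ] J) : W.Rep D J := by
  obtain ⟨f, rfl, hf⟩ := hI
  refine ⟨J.subtype ∘ₗ e.toLinearMap ∘ₗ f.rangeRestrict, ?_, fun x => ?_⟩
  · rw [LinearMap.range_comp, LinearMap.range_comp, LinearMap.range_rangeRestrict,
      Submodule.map_top,
      LinearEquiv.range, Submodule.map_top, Submodule.range_subtype]
  · rw [← hf]
    simp [Subtype.ext_iff]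

end Complex

variable {W : WeylPresentation k A} {D : CMData k n} {D' : CMData k n'} {I : Submodule Aᵐᵒᵖ A}

theorem Rep.of_addEquiv (hI : W.Rep D I) (σ : A ≃ₐ[k] A)
    (F : ((n → A) × (n → A) × A) ≃+ ((n' → A) × (n' → A) × A)) (ψ : (n → A) ≃+ (n' → A))
    (hF : ∀ (a : A) x, F (op a • x) = op (σ a) • F x)
    (hc : ∀ x, F x ∈ W.cycles D' ↔ x ∈ W.cycles D)
    (hb : ∀ w, F (W.bdry D w) = W.bdry D' (ψ w)) : W.Rep D' (mapRight σ I) := by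
  obtain ⟨f, rfl, hf⟩ := hI
  have hF' : ∀ (a : A) x, F.symm (op a • x) = op (σ.symm a) • F.symm x := fun a x => by
    rw [AddEquiv.symm_apply_eq, hF, σ.apply_symm_apply, F.apply_symm_apply]
  have hc' : ∀ x : W.cycles D', F.symm x ∈ W.cycles D := fun x => by
    rw [← hc, F.apply_symm_apply]
    exact x.2
  refine ⟨⟨⟨fun x => σ (f ⟨F.symm x, hc' x⟩), fun x y => ?_⟩, fun a x => ?_⟩, ?_, fun x => ?_⟩
  · rw [← map_add, ← map_add]
    congr 2
    exact Subtype.ext (map_add F.symm _ _)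
  · obtain ⟨a, rfl⟩ := op_surjective a
    have h : (⟨F.symm (op a • x : W.cycles D'), hc' _⟩ : W.cycles D) =
        op (σ.symm a) • ⟨F.symm x, hc' x⟩ := Subtype.ext (hF' a x)
    change σ (f _) = _
    rw [h, map_smul]
    simp
  · ext a
    rw [mem_mapRight]
    constructor
    · rintro ⟨x, rfl⟩
      exact ⟨f ⟨F.symm x, hc' x⟩, ⟨_, rfl⟩, rfl⟩
    · rintro ⟨_, ⟨x, rfl⟩, rfl⟩
      refine ⟨⟨F x, (hc x).mpr x.2⟩, ?_⟩
      change σ (f _) = _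
      congr 2
      exact Subtype.ext (F.symm_apply_apply x)
  · change σ (f _) = 0 ↔ _
    rw [map_eq_zero_iff σ σ.injective, hf]
    constructor
    · rintro ⟨w, hw⟩
      exact ⟨ψ w, by rw [← hb, hw, F.apply_symm_apply]⟩
    · rintro ⟨w, hw⟩
      exact ⟨ψ.symm w, by rw [AddEquiv.eq_symm_apply, hb, ψ.apply_symm_apply, hw]⟩

theorem Rep.of_intertwine (hI : W.Rep D I) (σ : A ≃ₐ[k] A) (ψ : (n → A) ≃+ (n' → A))
    (q : Module.End Aᵐᵒᵖ (n' → A)) (hψ : ∀ (a : A) u, ψ (op a • u) = op (σ a) • ψ u)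
    (hX : ∀ u, ψ (W.opX D u) = W.opX D' (ψ u) + W.opY D' (q (ψ u)))
    (hY : ∀ u, ψ (W.opY D u) = W.opY D' (ψ u)) (hq : ∀ u, q (W.opY D' u) = W.opY D' (q u))
    (hi : ∀ c, ψ (vecAct D.i c) = vecAct D'.i (σ c))
    (hj : ∀ u, covecAct D'.j (ψ u) = σ (covecAct D.j u)) : W.Rep D' (mapRight σ I) := by
  let F : ((n → A) × (n → A) × A) ≃+ ((n' → A) × (n' → A) × A) :=
    { toFun := fun x => (ψ x.1 - q (ψ x.2.1), ψ x.2.1, σ x.2.2)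
      invFun := fun x => (ψ.symm (x.1 + q x.2.1), ψ.symm x.2.1, σ.symm x.2.2)
      left_inv := fun x => by simp
      right_inv := fun x => by simp
      map_add' := fun x y => by
        simp only [Prod.fst_add, Prod.snd_add, map_add, Prod.mk_add_mk]
        congr 1
        abel }
  refine hI.of_addEquiv σ F ψ (fun a x => ?_) (fun x => ?_) fun w => ?_
  · change (ψ (op a • x.1) - q (ψ (op a • x.2.1)), ψ (op a • x.2.1), σ (x.2.2 * a)) =
      (op (σ a) • (ψ x.1 - q (ψ x.2.1)), op (σ a) • ψ x.2.1, σ x.2.2 * σ a)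
    rw [hψ, hψ, map_smul, smul_sub, map_mul]
  · rw [mem_cycles, mem_cycles]
    change W.opX D' (ψ x.2.1) = W.opY D' (ψ x.1 - q (ψ x.2.1)) + vecAct D'.i (σ x.2.2) ↔ _
    rw [← ψ.injective.eq_iff, map_add, hX, hY, hi, map_sub, sub_add_eq_add_sub, eq_sub_iff_add_eq]
  · change (ψ (W.opX D w) - q (ψ (W.opY D w)), ψ (W.opY D w), σ (covecAct D.j w)) =
      (W.opX D' (ψ w), W.opY D' (ψ w), covecAct D'.j (ψ w))
    rw [hX, hY, hj, hq, add_sub_cancel_right]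

theorem Rep.of_intertwine' (hI : W.Rep D I) (σ : A ≃ₐ[k] A) (ψ : (n → A) ≃+ (n' → A))
    (q : Module.End Aᵐᵒᵖ (n' → A)) (hψ : ∀ (a : A) u, ψ (op a • u) = op (σ a) • ψ u)
    (hX : ∀ u, ψ (W.opX D u) = W.opX D' (ψ u))
    (hY : ∀ u, ψ (W.opY D u) = W.opY D' (ψ u) + W.opX D' (q (ψ u)))
    (hq : ∀ u, q (W.opX D' u) = W.opX D' (q u))
    (hi : ∀ c, ψ (vecAct D.i c) = vecAct D'.i (σ c))
    (hj : ∀ u, covecAct D'.j (ψ u) = σ (covecAct D.j u)) : W.Rep D' (mapRight σ I) := by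
  let F : ((n → A) × (n → A) × A) ≃+ ((n' → A) × (n' → A) × A) :=
    { toFun := fun x => (ψ x.1, ψ x.2.1 - q (ψ x.1), σ x.2.2)
      invFun := fun x => (ψ.symm x.1, ψ.symm (x.2.1 + q x.1), σ.symm x.2.2)
      left_inv := fun x => by simp
      right_inv := fun x => by simp
      map_add' := fun x y => by
        simp only [Prod.fst_add, Prod.snd_add, map_add, Prod.mk_add_mk]
        congr 2
        abel }
  refine hI.of_addEquiv σ F ψ (fun a x => ?_) (fun x => ?_) fun w => ?_
  · change (ψ (op a • x.1), ψ (op a • x.2.1) - q (ψ (op a • x.1)), σ (x.2.2 * a)) =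
      (op (σ a) • ψ x.1, op (σ a) • (ψ x.2.1 - q (ψ x.1)), σ x.2.2 * σ a)
    rw [hψ, hψ, map_smul, smul_sub, map_mul]
  · rw [mem_cycles, mem_cycles]
    change W.opX D' (ψ x.2.1 - q (ψ x.1)) = W.opY D' (ψ x.1) + vecAct D'.i (σ x.2.2) ↔ _
    rw [← ψ.injective.eq_iff, map_add, hX, hY, hi, map_sub, sub_eq_iff_eq_add, add_right_comm]
  · change (ψ (W.opX D w), ψ (W.opY D w) - q (ψ (W.opX D w)), σ (covecAct D.j w)) =
      (W.opX D' (ψ w), W.opY D' (ψ w), covecAct D'.j (ψ w))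
    rw [hX, hY, hj, hq, add_sub_cancel_right]

section MapVec

/-- Entrywise application of an automorphism to column vectors. -/
noncomputable def mapVec (n : Type*) (σ : A ≃ₐ[k] A) : (n → A) ≃+ (n → A) :=
  AddEquiv.piCongrRight fun _ => (σ : A ≃+ A)

omit [Fintype n] [DecidableEq n] in
theorem mapVec_apply (σ : A ≃ₐ[k] A) (u : n → A) (l : n) : mapVec n σ u l = σ (u l) := rfl

omit [Fintype n] [DecidableEq n] in
theorem mapVec_op_smul (σ : A ≃ₐ[k] A) (a : A) (u : n → A) :
    mapVec n σ (op a • u) = op (σ a) • mapVec n σ u := by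
  ext l
  simp [mapVec_apply]

theorem mapVec_matAct (σ : A ≃ₐ[k] A) (M : Matrix n n k) (u : n → A) :
    mapVec n σ (matAct M u) = matAct M (mapVec n σ u) := by
  ext l
  simp [mapVec_apply, matAct_apply]

theorem mapVec_leftAct (σ : A ≃ₐ[k] A) (a : A) (u : n → A) :
    mapVec n σ (leftAct (k := k) n a u) = leftAct (k := k) n (σ a) (mapVec n σ u) := by
  ext l
  simp [mapVec_apply, leftAct_apply]

omit [Fintype n] [DecidableEq n] in
theorem mapVec_vecAct (σ : A ≃ₐ[k] A) (i : n → k) (c : A) :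
    mapVec n σ (vecAct i c) = vecAct i (σ c) := by
  ext l
  simp [mapVec_apply, vecAct_apply]

omit [DecidableEq n] in
theorem covecAct_mapVec (σ : A ≃ₐ[k] A) (j : n → k) (u : n → A) :
    covecAct j (mapVec n σ u) = σ (covecAct j u) := by
  simp [mapVec_apply, covecAct_apply]

end MapVec

theorem Rep.shiftT (hI : W.Rep D I) (h : k[X]) :
    W.Rep (D.addLeft (-aeval D.y h) (commute_aeval_self D.y h).neg_right.symm)
      (mapRight (W.shiftT h) I) := by
  obtain ⟨q, hq, hz⟩ := exists_aeval_sub_aeval (commute_matAct_leftAct (A := A) D.y W.d) h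
  refine hI.of_intertwine (W.shiftT h) (mapVec n _) q (mapVec_op_smul _) (fun u => ?_) (fun u => ?_)
    (fun u => ?_) (mapVec_vecAct _ _) (covecAct_mapVec _ _)
  · have h1 := LinearMap.congr_fun hq (mapVec n (W.shiftT h) u)
    rw [Module.End.mul_apply] at h1
    change _ = _ + W.opY D _
    rw [opY, ← h1, opX, opX, LinearMap.sub_apply, map_sub, mapVec_matAct, mapVec_leftAct, shiftT_t,
      CMData.addLeft, map_add, map_add, map_neg, aeval_algHom_apply, aeval_algHom_apply]
    simp only [LinearMap.sub_apply, LinearMap.add_apply, LinearMap.neg_apply]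
    abel
  · change _ = W.opY D _
    rw [opY, LinearMap.sub_apply, map_sub, mapVec_matAct, mapVec_leftAct, shiftT_d,
      LinearMap.sub_apply]
  · exact LinearMap.congr_fun ((hz _ (Commute.refl _) (commute_matAct_leftAct _ _)).sub_left
      (hz _ (commute_matAct_leftAct _ _).symm (Commute.refl _))).eq.symm u

theorem Rep.shiftD (hI : W.Rep D I) (p : k[X]) :
    W.Rep (D.addRight (-aeval D.x p) (commute_aeval_self D.x p).neg_right.symm)
      (mapRight (W.shiftD p) I) := by
  obtain ⟨q, hq, hz⟩ := exists_aeval_sub_aeval (commute_matAct_leftAct (A := A) D.x W.t) p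
  refine hI.of_intertwine' (W.shiftD p) (mapVec n _) q (mapVec_op_smul _) (fun u => ?_)
    (fun u => ?_) (fun u => ?_) (mapVec_vecAct _ _) (covecAct_mapVec _ _)
  · change _ = W.opX D _
    rw [opX, LinearMap.sub_apply, map_sub, mapVec_matAct, mapVec_leftAct, shiftD_t,
      LinearMap.sub_apply]
  · have h1 := LinearMap.congr_fun hq (mapVec n (W.shiftD p) u)
    rw [Module.End.mul_apply] at h1
    change _ = _ + W.opX D _
    rw [opX, ← h1, opY, opY, LinearMap.sub_apply, map_sub, mapVec_matAct, mapVec_leftAct, shiftD_d,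
      CMData.addRight, map_add, map_add, map_neg, aeval_algHom_apply, aeval_algHom_apply]
    simp only [LinearMap.sub_apply, LinearMap.add_apply, LinearMap.neg_apply]
    abel
  · exact LinearMap.congr_fun ((hz _ (Commute.refl _) (commute_matAct_leftAct _ _)).sub_left
      (hz _ (commute_matAct_leftAct _ _).symm (Commute.refl _))).eq.symm u

end WeylPresentation

namespace CMData
open Matrix

variable {k n : Type*} [Field k] [Fintype n] [DecidableEq n] (D : CMData k n)

/-- The polynomial vector `∑ fₙ(X) i yⁿ` attached to `∑ fₙ(t) yⁿ`. -/
noncomputable def vec : k[X][X] →ₗ[k] (n → k[X]) :=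
  (vecRem (D.x.map C)).restrictScalars k ∘ₗ LinearMap.pi fun l =>
    LinearMap.mulLeft k (C (C (D.i l))) ∘ₗ (Bivariate.swap (R := k)).toLinearMap

theorem vec_apply (c : k[X][X]) :
    D.vec c = vecRem (D.x.map C) fun l => C (C (D.i l)) * Bivariate.swap c := rfl

theorem vec_X_mul (c : k[X][X]) : D.vec (X * c) = (X : k[X]) • D.vec c := by
  have h : (fun l => C (C (D.i l)) * Bivariate.swap (X * c)) =
      (X : k[X]) • fun l => C (C (D.i l)) * Bivariate.swap c := by
    ext1 l
    rw [map_mul, Bivariate.swap_Y, Pi.smul_apply, smul_eq_C_mul]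
    ring
  rw [vec_apply, h, (vecRem (D.x.map C)).map_smul, vec_apply]

theorem vec_C_X_mul (c : k[X][X]) : D.vec (C X * c) = D.x.map C *ᵥ D.vec c := by
  have h : (fun l => C (C (D.i l)) * Bivariate.swap (C X * c)) =
      (X : k[X][X]) • fun l => C (C (D.i l)) * Bivariate.swap c := by
    ext1 l
    rw [map_mul, Bivariate.swap_X, Pi.smul_apply, smul_eq_mul]
    ring
  rw [vec_apply, h, vecRem_X_smul, vec_apply]

theorem vec_one : D.vec 1 = constVec D.i := by
  rw [vec_apply, map_one]
  simp only [mul_one]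
  exact vecRem_constVec _ _

theorem vec_X_pow_mul (b : ℕ) (c : k[X][X]) : D.vec (X ^ b * c) = (X ^ b : k[X]) • D.vec c := by
  induction b with
  | zero => simp
  | succ b ih => rw [pow_succ', pow_succ', mul_assoc, vec_X_mul, ih, smul_smul]

theorem vec_C (f : k[X]) : D.vec (C f) = constVec (aeval D.x f *ᵥ D.i) := by
  induction f using Polynomial.induction_on' with
  | add f g hf hg => rw [map_add, map_add, hf, hg, map_add, add_mulVec, map_add]
  | monomial m a =>
    induction m with
    | zero =>
      have h : (C (monomial 0 a) : k[X][X]) = a • 1 := by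
        rw [monomial_zero_left, Algebra.smul_def, mul_one]
        rfl
      rw [h, map_smul, vec_one, aeval_monomial, pow_zero, mul_one, ← map_smul,
        Algebra.algebraMap_eq_smul_one, smul_mulVec, one_mulVec]
    | succ m ih =>
      rw [← X_mul_monomial, map_mul, vec_C_X_mul, ih, map_C_mulVec_constVec, map_mul, aeval_X,
        mulVec_mulVec]

theorem coeff_vec (c : k[X][X]) (b : ℕ) (l : n) :
    (D.vec c l).coeff b = (aeval D.x (c.coeff b) *ᵥ D.i) l := by
  induction c using Polynomial.induction_on' with
  | add c c' h h' =>
    rw [map_add, Pi.add_apply, coeff_add, h, h', coeff_add, map_add, add_mulVec, Pi.add_apply]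
  | monomial m f =>
    rw [← C_mul_X_pow_eq_monomial, mul_comm, vec_X_pow_mul, vec_C, Pi.smul_apply, smul_eq_mul,
      constVec_apply, coeff_X_pow_mul', coeff_X_pow_mul']
    split_ifs with h
    · rw [coeff_C, coeff_C]
      split_ifs with h'
      · rfl
      · simp
    · simp

/-- The map `∑ fₙ(t) yⁿ ↦ ∑ Yⁿ fₙ(X) i`. -/
noncomputable def ev : k[X][X] →ₗ[k] (n → k) := vecRem D.y ∘ₗ D.vec

/-- The polynomial `j (y - Y)⁻¹ ∑ fₙ(X) i yⁿ`, up to the terms of negative degree. -/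
noncomputable def corr : k[X][X] →ₗ[k] k[X] :=
  LinearMap.lsum k (fun _ : n => k[X]) k (fun l => LinearMap.mulLeft k (C (D.j l))) ∘ₗ
    vecDiv D.y ∘ₗ D.vec

theorem ev_apply (c : k[X][X]) : D.ev c = vecRem D.y (D.vec c) := rfl

theorem corr_apply (c : k[X][X]) : D.corr c = ∑ l, C (D.j l) * vecDiv D.y (D.vec c) l := by
  simp [corr, LinearMap.lsum_apply]

theorem ev_X_mul (c : k[X][X]) : D.ev (X * c) = D.y *ᵥ D.ev c := by
  rw [ev_apply, vec_X_mul, vecRem_X_smul, ev_apply]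

theorem corr_X_mul (c : k[X][X]) : D.corr (X * c) = X * D.corr c + C (D.j ⬝ᵥ D.ev c) := by
  rw [corr_apply, corr_apply, vec_X_mul, vecDiv_X_smul, dotProduct, map_sum, Finset.mul_sum,
    ← Finset.sum_add_distrib]
  refine Finset.sum_congr rfl fun l _ => ?_
  rw [Pi.add_apply, Pi.smul_apply, constVec_apply, smul_eq_mul, C_mul, ev_apply]
  ring

theorem ev_C (f : k[X]) : D.ev (C f) = aeval D.x f *ᵥ D.i := by
  rw [ev_apply, vec_C, vecRem_constVec]

theorem corr_C (f : k[X]) : D.corr (C f) = 0 := by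
  rw [corr_apply, vec_C, vecDiv_constVec]
  simp

theorem coeff_corr_eq_zero {c : k[X][X]} {b : ℕ} (h : ∀ a > b, c.coeff a = 0) {a : ℕ} (ha : b ≤ a) :
    (D.corr c).coeff a = 0 := by
  rw [corr_apply, finsetSum_coeff]
  refine Finset.sum_eq_zero fun l _ => ?_
  rw [coeff_C_mul, coeff_vecDiv_eq_zero D.y (fun a ha l => ?_) ha, mul_zero]
  rw [coeff_vec, h a ha, map_zero, zero_mulVec, Pi.zero_apply]

theorem range_ev_eq_top [CharZero k] : LinearMap.range D.ev = ⊤ := by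
  refine D.eq_top_of_invariant _ ?_ ?_ ⟨C 1, by rw [ev_C, map_one, one_mulVec]⟩
  · rintro _ ⟨c, rfl⟩
    refine Polynomial.induction_on' (motive := fun c => D.x *ᵥ D.ev c ∈ LinearMap.range D.ev)
      c ?_ ?_
    · intro p q hp hq
      rw [map_add, mulVec_add]
      exact add_mem hp hq
    · intro m f
      induction m with
      | zero =>
        exact ⟨C (X * f), by rw [ev_C, monomial_zero_left, ev_C, map_mul, aeval_X, mulVec_mulVec]⟩
      | succ m ih =>
        obtain ⟨e, he⟩ := ih
        rw [← X_mul_monomial, ev_X_mul, D.x_mulVec_y, ← he, ← ev_X_mul]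
        exact add_mem (add_mem ⟨_, rfl⟩ ⟨_, rfl⟩)
          (Submodule.smul_mem _ _ ⟨C 1, by rw [ev_C, map_one, one_mulVec]⟩)
  · rintro _ ⟨c, rfl⟩
    exact ⟨X * c, D.ev_X_mul c⟩

end CMData

namespace WeylPresentation
open Matrix MulOpposite

variable {k A n : Type*} [Field k] [Ring A] [Algebra k A] (W : WeylPresentation k A)
  [Fintype n] [DecidableEq n]

theorem sym_aeval_d (g : k[X]) : W.sym (aeval W.d g) = g.map C := by
  induction g using Polynomial.induction_on' with
  | add f g hf hg => rw [map_add, map_add, hf, hg, Polynomial.map_add]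
  | monomial m a =>
    induction m with
    | zero =>
      rw [aeval_monomial, pow_zero, mul_one, Polynomial.map_monomial, ← aeval_C (R := k) W.t,
        sym_aeval_t, monomial_zero_left]
    | succ m ih => rw [← monomial_mul_X, map_mul, aeval_X, sym_mul_d, ih, Polynomial.map_mul, map_X,
        mul_comm]

theorem aeval_d_mul_t (g : k[X]) :
    aeval W.d g * W.t = W.t * aeval W.d g + aeval W.d (derivative g) := by
  apply W.sym.injective
  rw [map_add, sym_mul_t, sym_t_mul, sym_aeval_d, sym_aeval_d, derivative_map]

/-- Two `k`-linear conditions suffice for linearity over the Weyl algebra. -/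
theorem map_op_smul_of {M N : Type*} [AddCommGroup M] [Module k M] [Module Aᵐᵒᵖ M]
    [IsScalarTower k Aᵐᵒᵖ M] [AddCommGroup N] [Module k N] [Module Aᵐᵒᵖ N] [IsScalarTower k Aᵐᵒᵖ N]
    (f : M →ₗ[k] N) (ht : ∀ m, f (op W.t • m) = op W.t • f m)
    (hd : ∀ m, f (op W.d • m) = op W.d • f m) (a : A) : ∀ m, f (op a • m) = op a • f m := by
  induction a using W.induction with
  | algebraMap c =>
    intro m
    rw [← MulOpposite.algebraMap_apply, algebraMap_smul, algebraMap_smul, map_smul]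
  | t => exact ht
  | d => exact hd
  | add a b ha hb => intro m; rw [op_add, add_smul, add_smul, map_add, ha, hb]
  | mul a b ha hb => intro m; rw [op_mul, mul_smul, mul_smul, hb, ha]

/-- The coefficientwise symbol of a column vector, as a polynomial in `t` over `k[y]`. -/
noncomputable def symVec : (n → A) ≃ₗ[k] (n → k[X][X]) :=
  LinearEquiv.piCongrRight fun _ => W.sym.trans (Bivariate.swap (R := k)).toLinearEquiv

omit [Fintype n] [DecidableEq n] in
theorem symVec_apply (u : n → A) (l : n) : W.symVec u l = Bivariate.swap (W.sym (u l)) := rfl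

/-- Column vectors over `k[∂]`. -/
noncomputable def vecD : (n → k[X]) →ₗ[k] (n → A) :=
  LinearMap.pi fun l => (aeval W.d : k[X] →ₐ[k] A).toLinearMap ∘ₗ LinearMap.proj l

omit [Fintype n] [DecidableEq n] in
theorem vecD_apply (r : n → k[X]) (l : n) : W.vecD r l = aeval W.d (r l) := rfl

omit [Fintype n] [DecidableEq n] in
theorem symVec_vecD (r : n → k[X]) : W.symVec (W.vecD r) = constVec r := by
  ext1 l
  rw [symVec_apply, vecD_apply, sym_aeval_d, Bivariate.swap_map_C, constVec_apply]

theorem matAct_vecD (M : Matrix n n k) (r : n → k[X]) :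
    matAct M (W.vecD r) = W.vecD (M.map C *ᵥ r) := by
  ext1 l
  simp [matAct_apply, vecD_apply, Matrix.mulVec, dotProduct, Algebra.smul_def]

omit [Fintype n] [DecidableEq n] in
theorem op_d_smul_vecD (r : n → k[X]) : op W.d • W.vecD r = W.vecD ((X : k[X]) • r) := by
  ext1 l
  simp only [Pi.smul_apply, vecD_apply, op_smul_eq_mul, smul_eq_mul, mul_comm X, map_mul, aeval_X]

variable (D : CMData k n)

theorem symVec_opX (u : n → A) : W.symVec (W.opX D u) = -subMul (D.x.map C) (W.symVec u) := by
  ext1 l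
  rw [symVec_apply, opX, LinearMap.sub_apply, Pi.sub_apply, matAct_apply, leftAct_apply, map_sub,
    map_sub, sym_t_mul, map_mul, Bivariate.swap_X, map_sum, map_sum, subMul_apply, Pi.neg_apply,
    Pi.sub_apply, neg_sub, Pi.smul_apply, smul_eq_mul, symVec_apply, Matrix.mulVec, dotProduct]
  congr 1
  refine Finset.sum_congr rfl fun p _ => ?_
  rw [map_smul, map_smul, symVec_apply, Matrix.map_apply, Matrix.map_apply, Algebra.smul_def]
  rfl

theorem opX_injective : Function.Injective (W.opX D) := fun u v h => by
  have h1 := congrArg W.symVec h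
  rw [symVec_opX, symVec_opX, neg_inj] at h1
  exact W.symVec.injective (subMul_injective _ h1)

theorem opY_vecD (r : n → k[X]) : W.opY D (W.vecD r) = -W.vecD (subMul D.y r) := by
  have h : leftAct (k := k) n W.d (W.vecD r) = W.vecD ((X : k[X]) • r) := by
    ext1 l
    rw [leftAct_apply, vecD_apply, vecD_apply, Pi.smul_apply, smul_eq_mul, map_mul, aeval_X]
  rw [opY, LinearMap.sub_apply, matAct_vecD, h, subMul_apply, map_sub, neg_sub]

/-- The remainder of a column vector on division by `X - t`. -/
noncomputable def remX : (n → A) →ₗ[k] (n → k[X]) :=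
  (vecRem (D.x.map C)).restrictScalars k ∘ₗ W.symVec.toLinearMap

/-- The quotient of a column vector on division by `X - t`. -/
noncomputable def quotX : (n → A) →ₗ[k] (n → A) :=
  -(W.symVec.symm.toLinearMap ∘ₗ (vecDiv (D.x.map C)).restrictScalars k ∘ₗ W.symVec.toLinearMap)

theorem remX_apply (u : n → A) : W.remX D u = vecRem (D.x.map C) (W.symVec u) := rfl

theorem symVec_quotX (u : n → A) :
    W.symVec (W.quotX D u) = -vecDiv (D.x.map C) (W.symVec u) := by
  simp [quotX]

theorem vecD_remX_add (u : n → A) : W.vecD (W.remX D u) + W.opX D (W.quotX D u) = u := by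
  apply W.symVec.injective
  rw [map_add, symVec_vecD, symVec_opX, symVec_quotX, map_neg, neg_neg, add_comm, remX_apply,
    subMul_vecDiv_add]

theorem remX_quotX_of_eq {u w : n → A} {r : n → k[X]} (h : W.vecD r + W.opX D w = u) :
    W.remX D u = r ∧ W.quotX D u = w := by
  have h1 : subMul (D.x.map C) (-W.symVec w) + constVec r = W.symVec u := by
    rw [← h, map_add, symVec_vecD, symVec_opX, map_neg, add_comm]
  obtain ⟨h2, h3⟩ := vecDiv_vecRem_of_eq _ h1
  refine ⟨h3, W.symVec.injective ?_⟩
  rw [symVec_quotX, h2, neg_neg]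

theorem remX_opX (w : n → A) : W.remX D (W.opX D w) = 0 :=
  (W.remX_quotX_of_eq D (r := 0) (by rw [map_zero, zero_add])).1

theorem quotX_opX (w : n → A) : W.quotX D (W.opX D w) = w :=
  (W.remX_quotX_of_eq D (r := 0) (by rw [map_zero, zero_add])).2

theorem remX_vecD (r : n → k[X]) : W.remX D (W.vecD r) = r :=
  (W.remX_quotX_of_eq D (r := r) (w := 0) (by rw [map_zero, add_zero])).1

theorem quotX_vecD (r : n → k[X]) : W.quotX D (W.vecD r) = 0 :=
  (W.remX_quotX_of_eq D (r := r) (w := 0) (by rw [map_zero, add_zero])).2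

theorem quotX_op_d_smul (u : n → A) : W.quotX D (op W.d • u) = op W.d • W.quotX D u := by
  refine (W.remX_quotX_of_eq D (r := (X : k[X]) • W.remX D u) ?_).2
  rw [(W.opX D).map_smul, ← op_d_smul_vecD, ← smul_add, vecD_remX_add]

theorem quotX_op_t_smul (u : n → A) :
    W.quotX D (op W.t • u) = op W.t • W.quotX D u - W.vecD (W.remX D u) := by
  refine (W.remX_quotX_of_eq D (r := D.x.map C *ᵥ W.remX D u +
    fun l => derivative (W.remX D u l)) ?_).2
  have h : op W.t • W.vecD (W.remX D u) = leftAct (k := k) n W.t (W.vecD (W.remX D u)) +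
      W.vecD fun l => derivative (W.remX D u l) := by
    ext1 l
    rw [Pi.smul_apply, Pi.add_apply, leftAct_apply, vecD_apply, vecD_apply, op_smul_eq_mul,
      aeval_d_mul_t]
  conv_rhs => rw [← W.vecD_remX_add D u]
  rw [smul_add, h, map_sub, map_smul, map_add, ← matAct_vecD]
  have h1 : W.opX D (W.vecD (W.remX D u)) = matAct D.x (W.vecD (W.remX D u)) -
    leftAct (k := k) n W.t (W.vecD (W.remX D u)) := rfl
  rw [h1]
  abel

theorem remX_vecAct (c : A) : W.remX D (vecAct D.i c) = D.vec (W.sym c) := by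
  rw [remX_apply, CMData.vec_apply]
  congr 1
  ext1 l
  rw [symVec_apply, vecAct_apply, map_smul, map_smul, Algebra.smul_def]
  rfl

/-- The reduced symbol of an element of the middle term of the complex. -/
noncomputable def reduced : ((n → A) × (n → A) × A) →ₗ[k] k[X][X] where
  toFun x := W.sym (x.2.2 - covecAct D.j (W.quotX D x.1))
  map_add' x y := by
    rw [Prod.fst_add, Prod.snd_add, Prod.snd_add, map_add (W.quotX D), map_add (covecAct D.j),
      ← map_add W.sym, add_sub_add_comm]
  map_smul' c x := by
    have h (u : n → A) : covecAct D.j (c • u) = c • covecAct D.j u := by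
      simp [covecAct_apply, Finset.smul_sum, smul_comm c]
    rw [Prod.smul_fst, Prod.smul_snd, Prod.smul_snd, map_smul, h, ← smul_sub, map_smul,
      RingHom.id_apply]

theorem reduced_apply (x : (n → A) × (n → A) × A) :
    W.reduced D x = W.sym (x.2.2 - covecAct D.j (W.quotX D x.1)) := rfl

variable {D} in
theorem opX_sub_opY_quotX {x : (n → A) × (n → A) × A} (hx : x ∈ W.cycles D) :
    W.opX D (x.2.1 - W.opY D (W.quotX D x.1)) =
      vecAct D.i (x.2.2 - covecAct D.j (W.quotX D x.1)) - W.vecD (subMul D.y (W.remX D x.1)) := by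
  rw [mem_cycles] at hx
  rw [map_sub, hx, opX_opY]
  nth_rewrite 1 [← W.vecD_remX_add D x.1]
  rw [map_add, opY_vecD, map_sub]
  abel

variable {D} in
theorem vec_reduced {x : (n → A) × (n → A) × A} (hx : x ∈ W.cycles D) :
    D.vec (W.reduced D x) = subMul D.y (W.remX D x.1) := by
  have h := congrArg (W.remX D) (W.opX_sub_opY_quotX hx)
  rwa [remX_opX, map_sub, remX_vecAct, remX_vecD, eq_comm, sub_eq_zero] at h

variable {D} in
theorem ev_reduced {x : (n → A) × (n → A) × A} (hx : x ∈ W.cycles D) :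
    D.ev (W.reduced D x) = 0 := by
  rw [CMData.ev_apply, W.vec_reduced hx, vecRem_subMul]

variable {D} in
theorem reduced_eq_zero_iff {x : (n → A) × (n → A) × A} (hx : x ∈ W.cycles D) :
    W.reduced D x = 0 ↔ ∃ w, W.bdry D w = x := by
  constructor
  · intro h
    have h0 := W.vec_reduced hx
    rw [h, map_zero, eq_comm, (subMul_injective D.y).eq_iff' (map_zero _)] at h0
    have h1 := W.opX_sub_opY_quotX hx
    have h2 : x.2.2 - covecAct D.j (W.quotX D x.1) = 0 := W.sym.map_eq_zero_iff.mp h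
    have h3 := W.vecD_remX_add D x.1
    rw [h2, h0, map_zero, map_zero, map_zero, sub_zero,
      (W.opX_injective D).eq_iff' (map_zero _)] at h1
    rw [h0, map_zero, zero_add] at h3
    exact ⟨W.quotX D x.1, Prod.ext h3 (Prod.ext (sub_eq_zero.mp h1).symm (sub_eq_zero.mp h2).symm)⟩
  · rintro ⟨w, rfl⟩
    rw [reduced_apply, bdry_apply, quotX_opX, sub_self, map_zero]

theorem exists_reduced_eq {c : k[X][X]} (hc : D.ev c = 0) :
    ∃ x ∈ W.cycles D, W.reduced D x = c := by
  have h1 : subMul D.y (vecDiv D.y (D.vec c)) = D.vec c := by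
    conv_rhs => rw [← subMul_vecDiv_add D.y (D.vec c), ← CMData.ev_apply, hc, map_zero, add_zero]
  let u := W.vecD (vecDiv D.y (D.vec c))
  let e := W.opY D u + vecAct D.i (W.sym.symm c)
  have he : W.remX D e = 0 := by
    rw [map_add, remX_vecAct, LinearEquiv.apply_symm_apply, opY_vecD, map_neg, remX_vecD, h1,
      neg_add_cancel]
  refine ⟨(u, W.quotX D e, W.sym.symm c), ?_, ?_⟩
  · rw [mem_cycles]
    have := W.vecD_remX_add D e
    rwa [he, map_zero, zero_add] at this
  · rw [reduced_apply, quotX_vecD, map_zero, sub_zero, LinearEquiv.apply_symm_apply]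

theorem reduced_op_d_smul (x : (n → A) × (n → A) × A) :
    W.reduced D (op W.d • x) = X * W.reduced D x := by
  rw [reduced_apply, reduced_apply, ← sym_mul_d, Prod.smul_fst, Prod.smul_snd, Prod.smul_snd,
    quotX_op_d_smul, map_smul, ← smul_sub, op_smul_eq_mul]

variable {D} in
theorem reduced_op_t_smul {x : (n → A) × (n → A) × A} (hx : x ∈ W.cycles D) :
    W.reduced D (op W.t • x) = C X * W.reduced D x + derivative (W.reduced D x) +
      (D.corr (W.reduced D x)).map C := by
  have h : covecAct D.j (W.vecD (W.remX D x.1)) = aeval W.d (D.corr (W.reduced D x)) := by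
    rw [CMData.corr_apply, W.vec_reduced hx, vecDiv_subMul, covecAct_apply, map_sum]
    refine Finset.sum_congr rfl fun l _ => ?_
    rw [map_mul, aeval_C, ← Algebra.smul_def, vecD_apply]
  rw [← W.sym_aeval_d, ← h]
  rw [reduced_apply W D x, reduced_apply]
  rw [← sym_mul_t, ← map_add]
  congr 1
  rw [Prod.smul_fst, Prod.smul_snd, Prod.smul_snd, quotX_op_t_smul, map_sub, map_smul,
    op_smul_eq_mul, op_smul_eq_mul, sub_mul]
  abel

/-- An embedding of a right module over the Weyl algebra in `k[t][y]`, with the action of `t`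
twisted by Calogero–Moser data and with image the kernel of evaluation. -/
structure IsModel {M : Type*} [AddCommGroup M] [Module k M] [Module Aᵐᵒᵖ M]
    (ρ : M →ₗ[k] k[X][X]) : Prop where
  injective : Function.Injective ρ
  mem_range : ∀ c, (∃ m, ρ m = c) ↔ D.ev c = 0
  op_d : ∀ m, ρ (op W.d • m) = X * ρ m
  op_t : ∀ m, ρ (op W.t • m) = C X * ρ m + derivative (ρ m) + (D.corr (ρ m)).map C

variable {W D} {I : Submodule Aᵐᵒᵖ A}

theorem Rep.exists_isModel (h : W.Rep D I) : ∃ ρ : I →ₗ[k] k[X][X], W.IsModel D ρ := by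
  obtain ⟨f, rfl, hf⟩ := h
  let F : W.cycles D →ₗ[k] LinearMap.range f := f.rangeRestrict.restrictScalars k
  have hF : Function.Surjective F := f.surjective_rangeRestrict
  let Φ : W.cycles D →ₗ[k] k[X][X] := W.reduced D ∘ₗ (W.cycles D).subtype.restrictScalars k
  have hker : LinearMap.ker F = LinearMap.ker Φ := by
    ext x
    rw [LinearMap.mem_ker, LinearMap.mem_ker]
    change f.rangeRestrict x = 0 ↔ W.reduced D x = 0
    rw [W.reduced_eq_zero_iff x.2, ← hf, Subtype.ext_iff]
    rfl
  let ρ := (LinearMap.ker F).liftQ Φ hker.le ∘ₗ (F.quotKerEquivOfSurjective hF).symm.toLinearMap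
  have hρ (x) : ρ (F x) = Φ x := by
    have : (F.quotKerEquivOfSurjective hF).symm (F x) = Submodule.Quotient.mk x := by
      rw [LinearEquiv.symm_apply_eq]
      rfl
    change (LinearMap.ker F).liftQ Φ hker.le ((F.quotKerEquivOfSurjective hF).symm (F x)) = _
    rw [this]
    rfl
  have hop (a : Aᵐᵒᵖ) (x) : a • F x = F (a • x) := (f.rangeRestrict.map_smul a x).symm
  refine ⟨ρ, (injective_iff_map_eq_zero _).mpr fun m hm => ?_, fun c => ⟨?_, fun hc => ?_⟩,
    fun m => ?_, fun m => ?_⟩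
  · obtain ⟨x, rfl⟩ := hF m
    rw [hρ, ← LinearMap.mem_ker, ← hker] at hm
    exact hm
  · rintro ⟨m, rfl⟩
    obtain ⟨x, rfl⟩ := hF m
    rw [hρ]
    exact W.ev_reduced x.2
  · obtain ⟨x, hx, rfl⟩ := W.exists_reduced_eq D hc
    exact ⟨F ⟨x, hx⟩, hρ _⟩
  · obtain ⟨x, rfl⟩ := hF m
    rw [hop, hρ, hρ]
    exact W.reduced_op_d_smul D x
  · obtain ⟨x, rfl⟩ := hF m
    rw [hop, hρ, hρ]
    exact W.reduced_op_t_smul x.2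

theorem IsModel.rep {ρ : I →ₗ[k] k[X][X]} (h : W.IsModel D ρ) : W.Rep D I := by
  let e : I ≃ₗ[k] LinearMap.range ρ := LinearEquiv.ofInjective ρ h.injective
  let Φ : W.cycles D →ₗ[k] LinearMap.range ρ :=
    (W.reduced D ∘ₗ (W.cycles D).subtype.restrictScalars k).codRestrict _
      fun x => (h.mem_range _).mpr (W.ev_reduced x.2)
  let F : W.cycles D →ₗ[k] I := e.symm.toLinearMap ∘ₗ Φ
  have hF (x) : ρ (F x) = W.reduced D x := congrArg Subtype.val (e.apply_symm_apply (Φ x))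
  have hop := W.map_op_smul_of F
    (fun x => h.injective <| by
      rw [h.op_t, hF, hF]
      exact W.reduced_op_t_smul x.2)
    (fun x => h.injective <| by
      rw [h.op_d, hF, hF]
      exact W.reduced_op_d_smul D x)
  let f : W.cycles D →ₗ[Aᵐᵒᵖ] I := ⟨⟨F, F.map_add⟩, fun a x => hop a.unop x⟩
  refine ⟨I.subtype ∘ₗ f, ?_, fun x => ?_⟩
  · rw [LinearMap.range_comp]
    have : LinearMap.range f = ⊤ := LinearMap.range_eq_top.mpr fun m => by
      obtain ⟨x, hx, hxm⟩ := W.exists_reduced_eq D ((h.mem_range _).mp ⟨m, rfl⟩)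
      exact ⟨⟨x, hx⟩, h.injective ((hF _).trans hxm)⟩
    rw [this, Submodule.map_top, Submodule.range_subtype]
  · rw [← W.reduced_eq_zero_iff x.2, ← hF, map_eq_zero_iff ρ h.injective, LinearMap.comp_apply,
      Submodule.subtype_apply, Submodule.coe_eq_zero]
    rfl

end WeylPresentation

namespace WeylPresentation
open Matrix MulOpposite

variable {k A M : Type*} [Field k] [Ring A] [Algebra k A] (W : WeylPresentation k A)
  [AddCommGroup M] [Module k M] [Module Aᵐᵒᵖ M] [IsScalarTower k Aᵐᵒᵖ M]

/-- A map from a right module over the Weyl algebra to `k[t][y]` under which the generators act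
as `y` and, up to terms of lower degree in `y`, as `t`. -/
structure IsFiltered (ρ : M →ₗ[k] k[X][X]) : Prop where
  op_d : ∀ m, ρ (op W.d • m) = X * ρ m
  coeff_op_t : ∀ m n, (∀ a > n, (ρ m).coeff a = 0) →
    ∀ a ≥ n, (ρ (op W.t • m)).coeff a = X * (ρ m).coeff a

variable {W}

theorem isFiltered_sym : W.IsFiltered W.sym.toLinearMap where
  op_d := W.sym_mul_d
  coeff_op_t m n h a ha := by
    change (W.sym (m * W.t)).coeff a = X * (W.sym m).coeff a
    replace h : (W.sym m).coeff (a + 1) = 0 := h (a + 1) (by omega)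
    rw [sym_mul_t, coeff_add, coeff_C_mul, coeff_derivative, h, zero_mul, add_zero]

namespace IsFiltered

variable {ρ : M →ₗ[k] k[X][X]} (h : W.IsFiltered ρ)
include h

omit [IsScalarTower k Aᵐᵒᵖ M] in
theorem op_d_pow (b : ℕ) (m : M) : ρ (op (W.d ^ b) • m) = X ^ b * ρ m := by
  induction b with
  | zero => simp
  | succ b ih => rw [pow_succ, op_mul, mul_smul, h.op_d, ih, pow_succ']; ring

theorem coeff_op_aeval (f : k[X]) {m : M} {n : ℕ} (hm : ∀ a > n, (ρ m).coeff a = 0) {a : ℕ}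
    (ha : n ≤ a) : (ρ (op (aeval W.t f) • m)).coeff a = f * (ρ m).coeff a := by
  induction f using Polynomial.induction_on' generalizing a with
  | add f g hf hg => rw [map_add, op_add, add_smul, map_add, coeff_add, hf ha, hg ha, add_mul]
  | monomial b c =>
    induction b generalizing a with
    | zero =>
      rw [monomial_zero_left, aeval_C, ← MulOpposite.algebraMap_apply, algebraMap_smul, map_smul,
        coeff_smul, smul_eq_C_mul]
    | succ b ih =>
      rw [← monomial_mul_X, map_mul, aeval_X, op_mul, mul_smul,
        h.coeff_op_t _ n (fun a ha => by rw [ih ha.le, hm a ha, mul_zero]) a ha, ih ha]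
      ring

theorem coeff_op_smul {m : M} {b : A} {n l : ℕ} (hm : ∀ a > n, (ρ m).coeff a = 0)
    (hb : ∀ a > l, (W.sym b).coeff a = 0) {a : ℕ} (ha : n + l ≤ a) :
    (ρ (op b • m)).coeff a = (ρ m).coeff (a - l) * (W.sym b).coeff l := by
  have hb' : b = ∑ i ∈ Finset.range (l + 1), aeval W.t ((W.sym b).coeff i) * W.d ^ i := by
    conv_lhs => rw [← W.normalEval_sym b, (W.sym b).as_sum_range' (l + 1)
      (Nat.lt_succ_of_le (natDegree_le_iff_coeff_eq_zero.mpr hb)), map_sum]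
    exact Finset.sum_congr rfl fun i _ => normalEval_monomial _ _ _ _
  have hterm (i : ℕ) (hi : i ≤ l) :
      (ρ (op (aeval W.t ((W.sym b).coeff i) * W.d ^ i) • m)).coeff a =
        (W.sym b).coeff i * (ρ m).coeff (a - i) := by
    rw [op_mul, mul_smul, h.op_d_pow, coeff_X_pow_mul', if_pos (by omega),
      h.coeff_op_aeval _ hm (by omega)]
  conv_lhs => rw [hb', ← opAddEquiv_apply, map_sum, Finset.sum_smul, map_sum, finsetSum_coeff]
  rw [Finset.sum_range_succ, Finset.sum_eq_zero, zero_add, opAddEquiv_apply, hterm l le_rfl,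
    mul_comm]
  intro i hi
  rw [Finset.mem_range] at hi
  rw [opAddEquiv_apply, hterm i hi.le, hm _ (by omega), mul_zero]

theorem coeff_op_smul_eq_zero {m : M} {b : A} {n l : ℕ} (hm : ∀ a > n, (ρ m).coeff a = 0)
    (hb : ∀ a > l, (W.sym b).coeff a = 0) {a : ℕ} (ha : n + l < a) :
    (ρ (op b • m)).coeff a = 0 := by
  rw [h.coeff_op_smul hm hb ha.le, hm _ (by omega), zero_mul]

theorem coeff_natDegree_op_smul (m : M) (b : A) :
    (ρ (op b • m)).coeff ((ρ m).natDegree + (W.sym b).natDegree) =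
      (ρ m).leadingCoeff * (W.sym b).leadingCoeff := by
  rw [h.coeff_op_smul (fun a => coeff_eq_zero_of_natDegree_lt)
    (fun a => coeff_eq_zero_of_natDegree_lt) le_rfl, Nat.add_sub_cancel]
  rfl

theorem op_smul_ne_zero {m : M} {b : A} (hm : ρ m ≠ 0) (hb : b ≠ 0) : ρ (op b • m) ≠ 0 := by
  intro h0
  have h1 := h.coeff_natDegree_op_smul m b
  rw [h0, coeff_zero, eq_comm, mul_eq_zero, leadingCoeff_eq_zero, leadingCoeff_eq_zero,
    LinearEquiv.map_eq_zero_iff] at h1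
  tauto

theorem natDegree_op_smul {m : M} {b : A} (hm : ρ m ≠ 0) (hb : b ≠ 0) :
    (ρ (op b • m)).natDegree = (ρ m).natDegree + (W.sym b).natDegree := by
  refine natDegree_eq_of_le_of_coeff_ne_zero (natDegree_le_iff_coeff_eq_zero.mpr fun a ha => ?_) ?_
  · exact h.coeff_op_smul_eq_zero (fun a => coeff_eq_zero_of_natDegree_lt)
      (fun a => coeff_eq_zero_of_natDegree_lt) ha
  · rw [h.coeff_natDegree_op_smul]
    exact mul_ne_zero (leadingCoeff_ne_zero.mpr hm)
      (leadingCoeff_ne_zero.mpr (W.sym.map_ne_zero_iff.mpr hb))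

theorem leadingCoeff_op_smul {m : M} {b : A} (hm : ρ m ≠ 0) (hb : b ≠ 0) :
    (ρ (op b • m)).leadingCoeff = (ρ m).leadingCoeff * (W.sym b).leadingCoeff := by
  rw [← h.coeff_natDegree_op_smul, ← h.natDegree_op_smul hm hb]
  rfl

end IsFiltered

theorem natDegree_sym_mul {a b : A} (ha : a ≠ 0) (hb : b ≠ 0) :
    (W.sym (a * b)).natDegree = (W.sym a).natDegree + (W.sym b).natDegree :=
  isFiltered_sym.natDegree_op_smul (m := a) (W.sym.map_ne_zero_iff.mpr ha) hb

variable (W) in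
include W in
theorem noZeroDivisors : NoZeroDivisors A where
  eq_zero_or_eq_zero_of_mul_eq_zero {a b} hab := by
    by_contra! h
    refine isFiltered_sym.op_smul_ne_zero (W := W) (m := a) (W.sym.map_ne_zero_iff.mpr h.1) h.2 ?_
    change W.sym (a * b) = 0
    rw [hab, map_zero]

theorem aeval_t_ne_zero {f : k[X]} (hf : f ≠ 0) : aeval W.t f ≠ 0 := by
  rw [← W.sym.map_ne_zero_iff, sym_aeval_t]
  exact C_ne_zero.mpr hf

theorem sym_aeval_mul_d_pow (f : k[X]) (b : ℕ) :
    W.sym (aeval W.t f * W.d ^ b) = monomial b f := by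
  rw [← normalEval_monomial, sym_normalEval]

end WeylPresentation

namespace WeylPresentation
open Matrix MulOpposite

variable {k A M n n' : Type*} [Field k] [Ring A] [Algebra k A] {W : WeylPresentation k A}
  [AddCommGroup M] [Module k M] [Module Aᵐᵒᵖ M] [IsScalarTower k Aᵐᵒᵖ M]
  [Fintype n] [DecidableEq n] [Fintype n'] [DecidableEq n'] {D : CMData k n} {D' : CMData k n'}
  {ρ ρ' : M →ₗ[k] k[X][X]}

namespace IsModel

section
variable (h : W.IsModel D ρ)
include h

omit [IsScalarTower k Aᵐᵒᵖ M] in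
theorem isFiltered : W.IsFiltered ρ where
  op_d := h.op_d
  coeff_op_t m n hm a ha := by
    rw [h.op_t, coeff_add, coeff_add, coeff_C_mul, coeff_derivative, hm (a + 1) (by omega),
      coeff_map, D.coeff_corr_eq_zero hm ha, zero_mul, map_zero, add_zero, add_zero]

theorem apply_op_smul {c : M} {ν : k[X]} (hc : ρ c = C ν) (b : A) :
    ρ (op b • c) = C ν * W.sym b := by
  have hν : aeval D.x ν *ᵥ D.i = 0 := by
    rw [← D.ev_C, ← hc]
    exact (h.mem_range _).mp ⟨c, rfl⟩
  have hcorr (s : k[X][X]) : D.corr (C ν * s) = 0 := by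
    have : D.vec (C ν * s) = 0 := by
      ext l b
      rw [D.coeff_vec, coeff_C_mul, mul_comm, map_mul, ← mulVec_mulVec, hν, mulVec_zero]
      simp
    rw [D.corr_apply, this, map_zero]
    simp
  suffices H : ∀ b₀, ρ (op b₀ • c) = C ν * W.sym b₀ →
      ρ (op (b₀ * b) • c) = C ν * W.sym (b₀ * b) by
    simpa using H 1 (by rw [op_one, one_smul, hc, sym_one, mul_one])
  induction b using W.induction with
  | algebraMap s =>
    intro b₀ h₀
    rw [op_mul, mul_smul, ← MulOpposite.algebraMap_apply, algebraMap_smul, map_smul, h₀,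
      ← Algebra.commutes, ← Algebra.smul_def, map_smul, mul_smul_comm]
  | t =>
    intro b₀ h₀
    rw [op_mul, mul_smul, h.op_t, h₀, hcorr, sym_mul_t, Polynomial.map_zero, derivative_C_mul]
    ring
  | d =>
    intro b₀ h₀
    rw [op_mul, mul_smul, h.op_d, h₀, sym_mul_d]
    ring
  | add a b ha hb =>
    intro b₀ h₀
    rw [mul_add, op_add, add_smul, map_add, ha _ h₀, hb _ h₀, map_add, mul_add]
  | mul a b ha hb =>
    intro b₀ h₀
    rw [← mul_assoc]
    exact hb _ (ha _ h₀)

omit [IsScalarTower k Aᵐᵒᵖ M] in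
theorem exists_eq_C_charpoly : ∃ c, ρ c = C D.x.charpoly := by
  rw [h.mem_range, D.ev_C, aeval_self_charpoly, zero_mulVec]

omit [IsScalarTower k Aᵐᵒᵖ M] in
theorem exists_leadingCoeff_eq_one : ∃ m, (ρ m).leadingCoeff = 1 := by
  have hmonic : (D.y.charpoly.map (C : k →+* k[X])).Monic := D.y.charpoly_monic.map _
  have key (p : k[X]) : D.ev (p.map C) = aeval D.y p *ᵥ D.i := by
    induction p using Polynomial.induction_on' with
    | add p q hp hq => rw [Polynomial.map_add, map_add, map_add, hp, hq, add_mulVec]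
    | monomial b c =>
      induction b with
      | zero =>
        rw [monomial_zero_left, map_C, D.ev_C, aeval_C, aeval_C]
      | succ b ih =>
        rw [← X_mul_monomial, Polynomial.map_mul, map_X, D.ev_X_mul, ih, mulVec_mulVec, map_mul,
          aeval_X]
  obtain ⟨m, hm⟩ := (h.mem_range _).mpr
    (show D.ev (D.y.charpoly.map C) = 0 by rw [key, aeval_self_charpoly, zero_mulVec])
  exact ⟨m, hm ▸ hmonic⟩

theorem exists_op_smul_eq {c : M} {χ : k[X]} (hχ : χ ≠ 0) (hc : ρ c = C χ) (m : M) :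
    ∃ (f : k[X]) (b : A), f ≠ 0 ∧ op (aeval W.t f) • m = op b • c := by
  suffices H : ∀ n m, (∀ a ≥ n, (ρ m).coeff a = 0) →
      ∃ (f : k[X]) (b : A), f ≠ 0 ∧ op (aeval W.t f) • m = op b • c from
    H ((ρ m).natDegree + 1) m fun a ha => coeff_eq_zero_of_natDegree_lt ha
  intro n
  induction n with
  | zero =>
    intro m hm
    have : ρ m = 0 := Polynomial.ext fun a => hm a a.zero_le
    rw [map_eq_zero_iff ρ h.injective] at this
    exact ⟨1, 0, one_ne_zero, by rw [this, smul_zero, op_zero, zero_smul]⟩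
  | succ n ih =>
    intro m hm
    set μ := (ρ m).coeff n
    obtain ⟨f, b, hf, hb⟩ :=
      ih (op (aeval W.t χ) • m - op (aeval W.t μ * W.d ^ n) • c) fun a ha => by
      rw [map_sub, coeff_sub, h.isFiltered.coeff_op_aeval χ (n := n) hm ha, h.apply_op_smul hc,
        sym_aeval_mul_d_pow, coeff_C_mul, coeff_monomial]
      split_ifs with hn
      · rw [← hn, sub_self]
      · rw [hm a (by omega), sub_self]
    refine ⟨χ * f, b + aeval W.t μ * W.d ^ n * aeval W.t f, mul_ne_zero hχ hf, ?_⟩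
    rw [map_mul, op_mul, mul_smul, op_add, add_smul, ← hb, op_mul _ (aeval W.t f), mul_smul,
      smul_sub, sub_add_cancel]

end

/-- Two models of the same module have proportional leading coefficients. -/
theorem exists_leadingCoeff_relation (h : W.IsModel D ρ) (h' : W.IsModel D' ρ') {c : M}
    (hc : ρ c = C D.x.charpoly) {m : M} (hm : m ≠ 0) :
    (ρ' m).natDegree = (ρ m).natDegree + (ρ' c).natDegree ∧
      D.x.charpoly * (ρ' m).leadingCoeff = (ρ' c).leadingCoeff * (ρ m).leadingCoeff := by
  have hχ : D.x.charpoly ≠ 0 := D.x.charpoly_monic.ne_zero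
  obtain ⟨f, b, hf, hb⟩ := h.exists_op_smul_eq hχ hc m
  have hf' := aeval_t_ne_zero (W := W) hf
  have hρm : ρ m ≠ 0 := (map_ne_zero_iff ρ h.injective).mpr hm
  have hρm' : ρ' m ≠ 0 := (map_ne_zero_iff ρ' h'.injective).mpr hm
  have hρc : ρ c ≠ 0 := hc ▸ C_ne_zero.mpr hχ
  have hρc' : ρ' c ≠ 0 := by
    rw [map_ne_zero_iff ρ' h'.injective]
    rintro rfl
    exact hρc (map_zero ρ)
  have hb0 : b ≠ 0 := by
    rintro rfl
    refine h.isFiltered.op_smul_ne_zero hρm hf' ?_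
    rw [hb, op_zero, zero_smul, map_zero]
  have h1 := h.isFiltered.natDegree_op_smul hρm hf'
  have h2 := h.isFiltered.leadingCoeff_op_smul hρm hf'
  have h1' := h'.isFiltered.natDegree_op_smul hρm' hf'
  have h2' := h'.isFiltered.leadingCoeff_op_smul hρm' hf'
  rw [hb, h.isFiltered.natDegree_op_smul hρc hb0, hc, natDegree_C, sym_aeval_t, natDegree_C] at h1
  rw [hb, h.isFiltered.leadingCoeff_op_smul hρc hb0, hc, leadingCoeff_C, sym_aeval_t,
    leadingCoeff_C] at h2
  rw [hb, h'.isFiltered.natDegree_op_smul hρc' hb0, sym_aeval_t, natDegree_C] at h1'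
  rw [hb, h'.isFiltered.leadingCoeff_op_smul hρc' hb0, sym_aeval_t, leadingCoeff_C] at h2'
  refine ⟨by omega, mul_right_cancel₀ hf ?_⟩
  rw [mul_assoc, ← h2', mul_assoc, ← h2]
  ring

omit [IsScalarTower k Aᵐᵒᵖ M] in
theorem coeff_op_t_pow_mem (h : W.IsModel D ρ) (h' : W.IsModel D' ρ') (c : k) (m : M) {n : ℕ}
    (hm : ∀ a > n, ((ρ' - c • ρ) m).coeff a = 0) (N : ℕ) {a : ℕ} (ha : n ≤ a) :
    ((ρ' - c • ρ) (op (W.t ^ N) • m)).coeff a - X ^ N * ((ρ' - c • ρ) m).coeff a ∈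
      degreeLT k N := by
  set δ := ρ' - c • ρ
  induction N generalizing a with
  | zero => simp
  | succ N ih =>
    set m' := op (W.t ^ N) • m
    have hδ : δ (op (W.t ^ (N + 1)) • m) = C X * δ m' + derivative (δ m') +
        (D'.corr (ρ' m') - c • D.corr (ρ m')).map C := by
      rw [pow_succ, op_mul, mul_smul]
      change ρ' (op W.t • m') - c • ρ (op W.t • m') = C X * (ρ' m' - c • ρ m') +
        derivative (ρ' m' - c • ρ m') + _
      rw [h.op_t, h'.op_t, Polynomial.map_sub, Polynomial.smul_eq_C_mul (p := D.corr (ρ m')),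
        Polynomial.map_mul, map_C, derivative_sub, derivative_smul]
      have (z : k[X][X]) : c • z = C (C c) * z := Algebra.smul_def c z
      simp only [this]
      ring
    have h1 := ih (a := a + 1) (by omega)
    rw [hm (a + 1) (by omega), mul_zero, sub_zero] at h1
    have h2 := ih ha
    rw [mem_degreeLT] at h1 h2 ⊢
    rw [hδ, coeff_add, coeff_add, coeff_C_mul, coeff_derivative, coeff_map, pow_succ']
    have h3 : X * (δ m').coeff a + (δ m').coeff (a + 1) * ((a : k[X]) + 1) +
        C ((D'.corr (ρ' m') - c • D.corr (ρ m')).coeff a) - X * X ^ N * (δ m).coeff a =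
        X * ((δ m').coeff a - X ^ N * (δ m).coeff a) + C ((a : k) + 1) * (δ m').coeff (a + 1) +
        C ((D'.corr (ρ' m') - c • D.corr (ρ m')).coeff a) := by
      rw [C_add, C_1, map_natCast]
      ring
    rw [h3]
    refine (degree_add_le _ _).trans_lt (max_lt ((degree_add_le _ _).trans_lt (max_lt ?_ ?_)) ?_)
    · rw [degree_mul, degree_X, add_comm, Nat.cast_add, Nat.cast_one]
      exact WithBot.add_lt_add_right (by simp) h2
    · rw [← smul_eq_C_mul]
      exact ((degree_smul_le _ _).trans_lt h1).trans (by exact_mod_cast N.lt_succ_self)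
    · exact degree_C_le.trans_lt (by exact_mod_cast N.succ_pos)

variable [CharZero k]

theorem eq_smul (h : W.IsModel D ρ) (h' : W.IsModel D' ρ') : ∃ c : k, c ≠ 0 ∧ ρ' = c • ρ := by
  have hχ : D.x.charpoly ≠ 0 := D.x.charpoly_monic.ne_zero
  obtain ⟨c, hc⟩ := h.exists_eq_C_charpoly
  obtain ⟨c', hc'⟩ := h'.exists_eq_C_charpoly
  have ne {m : M} {τ : M →ₗ[k] k[X][X]} (hm : τ m ≠ 0) : m ≠ 0 := by
    rintro rfl
    exact hm (map_zero τ)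
  have hc0 : c ≠ 0 := ne (hc ▸ C_ne_zero.mpr hχ)
  have hc0' : c' ≠ 0 := ne (hc' ▸ C_ne_zero.mpr D'.x.charpoly_monic.ne_zero)
  have hdeg : (ρ' c).natDegree = 0 := by
    have := (h.exists_leadingCoeff_relation h' hc hc0').1
    rw [hc', natDegree_C] at this
    omega
  set ν := (ρ' c).leadingCoeff with hν
  have hρc : ρ' c = C ν := by
    rw [hν, leadingCoeff, hdeg]
    exact eq_C_of_natDegree_eq_zero hdeg
  obtain ⟨m, hm⟩ := h.exists_leadingCoeff_eq_one
  obtain ⟨m', hm'⟩ := h'.exists_leadingCoeff_eq_one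
  have hm0 : m ≠ 0 := ne (leadingCoeff_ne_zero.mp (hm ▸ one_ne_zero))
  have hm0' : m' ≠ 0 := ne (leadingCoeff_ne_zero.mp (hm' ▸ one_ne_zero))
  have h1 := (h.exists_leadingCoeff_relation h' hc hm0).2
  have h2 := (h.exists_leadingCoeff_relation h' hc hm0').2
  rw [hm, mul_one] at h1
  rw [hm', mul_one] at h2
  obtain ⟨u, hu⟩ := associated_of_dvd_dvd (Dvd.intro _ h1) (Dvd.intro _ h2.symm)
  obtain ⟨s, hs, hsu⟩ := Polynomial.isUnit_iff.mp u.isUnit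
  rw [← hsu] at hu
  have hsm (z : k[X][X]) : s • z = C (C s) * z := Algebra.smul_def s z
  refine ⟨s, hs.ne_zero, LinearMap.ext fun m => ?_⟩
  obtain ⟨f, b, hf, hb⟩ := h.exists_op_smul_eq hχ hc m
  rw [← sub_eq_zero]
  change (ρ' - s • ρ) m = 0
  by_contra hne
  have hδ : (ρ' - s • ρ) (op (aeval W.t f) • m) = 0 := by
    rw [hb, LinearMap.sub_apply, LinearMap.smul_apply, h.apply_op_smul hc, h'.apply_op_smul hρc,
      hsm, hν, ← hu, C_mul]
    ring
  set ε := (ρ' - s • ρ) m with hε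
  have hlow : ∀ a > ε.natDegree, ε.coeff a = 0 := fun a => coeff_eq_zero_of_natDegree_lt
  have hmem : ((ρ' - s • ρ) (op (aeval W.t f) • m)).coeff ε.natDegree - f * ε.leadingCoeff ∈
      degreeLT k f.natDegree := by
    have hf' := f.as_sum_range_C_mul_X_pow
    have hleft : (ρ' - s • ρ) (op (aeval W.t f) • m) = ∑ i ∈ Finset.range (f.natDegree + 1),
        f.coeff i • (ρ' - s • ρ) (op (W.t ^ i) • m) := by
      conv_lhs => rw [hf', map_sum, ← opAddEquiv_apply, map_sum, Finset.sum_smul, map_sum]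
      refine Finset.sum_congr rfl fun i _ => ?_
      rw [opAddEquiv_apply, map_mul, aeval_C, ← Algebra.smul_def, map_pow, aeval_X, op_smul,
        smul_assoc, map_smul]
    have hright : f * ε.leadingCoeff = ∑ i ∈ Finset.range (f.natDegree + 1),
        f.coeff i • (X ^ i * ε.leadingCoeff) := by
      conv_lhs => rw [hf', Finset.sum_mul]
      exact Finset.sum_congr rfl fun i _ => by rw [smul_eq_C_mul, mul_assoc]
    rw [hleft, hright, finsetSum_coeff, ← Finset.sum_sub_distrib]
    refine Submodule.sum_mem _ fun i hi => ?_
    rw [coeff_smul, ← smul_sub]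
    refine Submodule.smul_mem _ _ (degreeLT_mono (Nat.lt_succ_iff.mp (Finset.mem_range.mp hi)) ?_)
    exact h.coeff_op_t_pow_mem h' s m hlow i le_rfl
  rw [hδ, coeff_zero, zero_sub, Submodule.neg_mem_iff, mem_degreeLT, degree_mul,
    degree_eq_natDegree hf, degree_eq_natDegree (leadingCoeff_ne_zero.mpr hne)] at hmem
  exact absurd hmem (by norm_cast; omega)

end IsModel

/-- The trace of the second matrix only depends on the isomorphism class of the represented
ideal. -/
theorem Rep.trace_eq [CharZero k] {I : Submodule Aᵐᵒᵖ A} (h : W.Rep D I) (h' : W.Rep D' I) :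
    D.y.trace = D'.y.trace := by
  obtain ⟨ρ, hρ⟩ := h.exists_isModel
  obtain ⟨ρ', hρ'⟩ := h'.exists_isModel
  obtain ⟨s, hs, rfl⟩ := hρ.eq_smul hρ'
  have hker : LinearMap.ker D.ev = LinearMap.ker D'.ev := by
    ext c
    rw [LinearMap.mem_ker, LinearMap.mem_ker, ← hρ.mem_range, ← hρ'.mem_range]
    constructor
    · rintro ⟨m, rfl⟩
      exact ⟨s⁻¹ • m, by rw [map_smul, LinearMap.smul_apply, inv_smul_smul₀ hs]⟩
    · rintro ⟨m, rfl⟩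
      exact ⟨s • m, by rw [map_smul, LinearMap.smul_apply]⟩
  have hsurj := LinearMap.range_eq_top.mp D.range_ev_eq_top
  have hsurj' := LinearMap.range_eq_top.mp D'.range_ev_eq_top
  let e : (n → k) ≃ₗ[k] (n' → k) := (D.ev.quotKerEquivOfSurjective hsurj).symm.trans
    ((Submodule.quotEquivOfEq _ _ hker).trans (D'.ev.quotKerEquivOfSurjective hsurj'))
  have he (c) : e (D.ev c) = D'.ev c := by
    have : (D.ev.quotKerEquivOfSurjective hsurj).symm (D.ev c) = Submodule.Quotient.mk c := by
      rw [LinearEquiv.symm_apply_eq]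
      rfl
    change D'.ev.quotKerEquivOfSurjective hsurj' (Submodule.quotEquivOfEq _ _ hker
      ((D.ev.quotKerEquivOfSurjective hsurj).symm (D.ev c))) = _
    rw [this]
    rfl
  rw [← Matrix.trace_toLin'_eq, ← Matrix.trace_toLin'_eq, ← LinearMap.trace_conj' _ e]
  congr 1
  refine LinearMap.ext fun v => ?_
  obtain ⟨c, rfl⟩ := hsurj' v
  rw [LinearEquiv.conj_apply_apply, ← he, e.symm_apply_apply, toLin'_apply, ← D.ev_X_mul, he,
    D'.ev_X_mul, toLin'_apply, he]

end WeylPresentation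

section DivMonic

variable {k : Type*} [Field k] {p : k[X]}

/-- The quotient upon division by a monic polynomial, as a linear map. -/
noncomputable def divMonic (hp : p.Monic) : k[X] →ₗ[k] k[X] where
  toFun f := f /ₘ p
  map_add' f g := (div_modByMonic_unique (f /ₘ p + g /ₘ p) (f %ₘ p + g %ₘ p) hp
    ⟨by linear_combination modByMonic_add_div f p + modByMonic_add_div g p,
      (degree_add_le _ _).trans_lt
        (max_lt (degree_modByMonic_lt f hp) (degree_modByMonic_lt g hp))⟩).1
  map_smul' c f := (div_modByMonic_unique (c • (f /ₘ p)) (c • (f %ₘ p)) hp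
    ⟨by rw [mul_smul_comm, ← smul_add, modByMonic_add_div],
      (degree_smul_le _ _).trans_lt (degree_modByMonic_lt f hp)⟩).1

/-- The constant by which division by a monic polynomial fails to commute with multiplication by
the variable. -/
noncomputable def residue (_hp : p.Monic) : k[X] →ₗ[k] k :=
  lcoeff k p.natDegree ∘ₗ LinearMap.mulLeft k X ∘ₗ modByMonicHom p

variable (hp : p.Monic)

theorem divMonic_apply (f : k[X]) : divMonic hp f = f /ₘ p := rfl

theorem residue_apply (f : k[X]) : residue hp f = (X * (f %ₘ p)).coeff p.natDegree := rfl

theorem divMonic_mul (f : k[X]) : divMonic hp (p * f) = f := mul_divByMonic_cancel_left f hp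

theorem residue_mul (f : k[X]) : residue hp (p * f) = 0 := by
  rw [residue_apply, (modByMonic_eq_zero_iff_dvd hp).mpr (dvd_mul_right p f), mul_zero, coeff_zero]

theorem divMonic_eq_zero {f : k[X]} (hf : ∀ a ≥ p.natDegree, f.coeff a = 0) :
    divMonic hp f = 0 := by
  rw [divMonic_apply, divByMonic_eq_zero_iff hp, degree_eq_natDegree hp.ne_zero]
  exact (degree_lt_iff_coeff_zero _ _).mpr hf

theorem divMonic_X_mul (f : k[X]) :
    divMonic hp (X * f) = X * divMonic hp f + C (residue hp f) := by
  refine (div_modByMonic_unique _ (X * (f %ₘ p) - C (residue hp f) * p) hp ⟨?_, ?_⟩).1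
  · rw [divMonic_apply]
    linear_combination X * modByMonic_add_div f p
  · have h := degree_modByMonic_lt f hp
    rw [degree_eq_natDegree hp.ne_zero] at h ⊢
    refine (degree_lt_iff_coeff_zero _ _).mpr fun a ha => ?_
    rw [coeff_sub, coeff_C_mul]
    obtain rfl | ha := ha.eq_or_lt
    · rw [← residue_apply hp, hp.coeff_natDegree, mul_one, sub_self]
    · obtain ⟨a, rfl⟩ := Nat.exists_eq_succ_of_ne_zero (by omega : a ≠ 0)
      rw [Nat.succ_eq_add_one, coeff_X_mul, (degree_lt_iff_coeff_zero _ _).mp h a (by omega),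
        coeff_eq_zero_of_natDegree_lt ha, mul_zero, sub_zero]

end DivMonic

theorem LinearMap.map_aeval_apply {k M N : Type*} [Field k] [AddCommGroup M] [Module k M]
    [AddCommGroup N] [Module k N] {x : Module.End k M} {y : Module.End k N} (φ : M →ₗ[k] N)
    (h : ∀ m, φ (x m) = y (φ m)) (g : k[X]) (m : M) : φ (aeval x g m) = aeval y g (φ m) := by
  induction g using Polynomial.induction_on' with
  | add f g hf hg => simp only [map_add, LinearMap.add_apply, hf, hg]
  | monomial b c =>
    simp only [aeval_monomial, Module.algebraMap_end_eq_smul_id, Module.End.mul_apply,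
      LinearMap.smul_apply, LinearMap.id_apply, map_smul]
    congr 1
    induction b with
    | zero => rfl
    | succ b ih => rw [pow_succ', pow_succ', Module.End.mul_apply, Module.End.mul_apply, h, ih]

namespace WeylPresentation
open Matrix MulOpposite

variable {k A M : Type*} [Field k] [Ring A] [Algebra k A] {W : WeylPresentation k A}
  [AddCommGroup M] [Module k M] [Module Aᵐᵒᵖ M] [IsScalarTower k Aᵐᵒᵖ M]
  {ρ : M →ₗ[k] k[X][X]}

/-- The correction term extends from the image of `ρ` to `k[t][y]`, commuting with multiplication by
`y` up to a linear functional `j`. -/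
theorem exists_extend_corr {ξ₀ : M →ₗ[k] k[X]} (hρ : Function.Injective ρ)
    (op_d : ∀ m, ρ (op W.d • m) = X * ρ m) (corr_d : ∀ m, ξ₀ (op W.d • m) = X * ξ₀ m)
    (hdeg : ∀ m n, (∀ a > n, (ρ m).coeff a = 0) → ∀ a ≥ n, (ξ₀ m).coeff a = 0)
    [Module.Finite k (k[X][X] ⧸ LinearMap.range ρ)] :
    ∃ (ξ : k[X][X] →ₗ[k] k[X]) (j : k[X][X] →ₗ[k] k), (∀ m, ξ (ρ m) = ξ₀ m) ∧
      (∀ m, j (ρ m) = 0) ∧ (∀ c, ξ (X * c) = X * ξ c + C (j c)) ∧ ∀ f, ξ (C f) = 0 := by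
  let xM : Module.End k M := Algebra.lsmul k k M (op W.d)
  let yS : Module.End k k[X][X] := Algebra.lmul k _ X
  have hyS (g : k[X]) (c : k[X][X]) : aeval yS g c = aeval (X : k[X][X]) g * c := by
    rw [aeval_algHom_apply]; rfl
  let Y : Module.End k (k[X][X] ⧸ LinearMap.range ρ) :=
    Submodule.mapQ _ _ yS (by rintro _ ⟨m, rfl⟩; exact ⟨_, op_d m⟩)
  let p := Y.charpoly
  have hp : p.Monic := Y.charpoly_monic
  have hmem (c : k[X][X]) : aeval yS p c ∈ LinearMap.range ρ := by
    have h := LinearMap.map_aeval_apply (x := yS) (y := Y) (Submodule.mkQ _) (fun _ => rfl) p c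
    rw [Y.aeval_self_charpoly] at h
    exact (Submodule.Quotient.mk_eq_zero _).mp h
  let e := LinearEquiv.ofInjective ρ hρ
  let τ : k[X][X] →ₗ[k] M := e.symm.toLinearMap ∘ₗ (aeval yS p).codRestrict _ hmem
  have hτ (c) : ρ (τ c) = aeval yS p c := congrArg Subtype.val (e.apply_symm_apply ⟨_, hmem c⟩)
  have hτρ (m) : τ (ρ m) = aeval xM p m := by
    apply hρ
    rw [hτ, LinearMap.map_aeval_apply (y := yS) ρ op_d]
  have hτX (c) : τ (X * c) = op W.d • τ c := by
    apply hρ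
    rw [op_d, hτ, hτ, hyS, hyS]
    ring
  have hξρ (m) : ξ₀ (τ (ρ m)) = p * ξ₀ m := by
    rw [hτρ, LinearMap.map_aeval_apply (y := Algebra.lmul k k[X] X) ξ₀ corr_d, aeval_algHom_apply,
      aeval_X_left_apply]
    rfl
  refine ⟨divMonic hp ∘ₗ ξ₀ ∘ₗ τ, residue hp ∘ₗ ξ₀ ∘ₗ τ, fun m => ?_, fun m => ?_, fun c => ?_,
    fun f => ?_⟩
  · simp only [LinearMap.comp_apply, hξρ, divMonic_mul]
  · simp only [LinearMap.comp_apply, hξρ, residue_mul]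
  · simp only [LinearMap.comp_apply, hτX, corr_d, divMonic_X_mul]
  · refine divMonic_eq_zero hp (hdeg _ _ fun a ha => ?_)
    rw [hτ, hyS, aeval_X_left_eq_map, coeff_mul_C, coeff_map,
      coeff_eq_zero_of_natDegree_lt ha, map_zero, zero_mul]

/-- A module embedded in `k[t][y]` with finite codimension, on which the generators act as `y` and,
up to a correction term, as `t + d/dy`, comes from Calogero–Moser data. -/
theorem exists_isModel {ξ₀ : M →ₗ[k] k[X]} (hρ : Function.Injective ρ)
    (op_d : ∀ m, ρ (op W.d • m) = X * ρ m) (corr_d : ∀ m, ξ₀ (op W.d • m) = X * ξ₀ m)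
    (op_t : ∀ m, ρ (op W.t • m) = C X * ρ m + derivative (ρ m) + (ξ₀ m).map C)
    (hdeg : ∀ m n, (∀ a > n, (ρ m).coeff a = 0) → ∀ a ≥ n, (ξ₀ m).coeff a = 0)
    [Module.Finite k (k[X][X] ⧸ LinearMap.range ρ)] :
    ∃ (d : ℕ) (D : CMData k (Fin d)), W.IsModel D ρ := by
  obtain ⟨ξ, j, hξρ, hjρ, hξX, hξC⟩ := exists_extend_corr hρ op_d corr_d hdeg
  let U := k[X][X] ⧸ LinearMap.range ρ
  let π : k[X][X] →ₗ[k] U := Submodule.mkQ _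
  let xS : Module.End k k[X][X] := LinearMap.mulLeft k (C X) +
    (derivative (R := k[X])).restrictScalars k + (mapAlgHom (CAlgHom (R := k))).toLinearMap ∘ₗ ξ
  have hxS (c) : xS c = C X * c + derivative c + (ξ c).map C := rfl
  let xU : Module.End k U :=
    Submodule.mapQ _ _ xS (by rintro _ ⟨m, rfl⟩; exact ⟨_, by rw [op_t, hxS, hξρ]⟩)
  let yU : Module.End k U :=
    Submodule.mapQ _ _ (LinearMap.mulLeft k X) (by rintro _ ⟨m, rfl⟩; exact ⟨_, op_d m⟩)
  let jU : U →ₗ[k] k := Submodule.liftQ _ j (by rintro _ ⟨m, rfl⟩; exact hjρ m)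
  have hx (c) : xU (π c) = π (xS c) := rfl
  have hy (c) : yU (π c) = π (X * c) := rfl
  have hj (c) : jU (π c) = j c := rfl
  have hcomm : xU * yU - yU * xU = 1 + jU.smulRight (π 1) := by
    refine LinearMap.ext fun u => ?_
    obtain ⟨c, rfl⟩ := Submodule.mkQ_surjective _ u
    change xU (yU (π c)) - yU (xU (π c)) = π c + jU (π c) • π 1
    rw [hy, hx, hx, hy, hj, ← map_smul, ← map_sub, ← map_add]
    congr 1
    rw [hxS, hxS, hξX, derivative_mul, derivative_X, Polynomial.map_add, Polynomial.map_mul, map_X,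
      map_C, Algebra.smul_def (j c)]
    change _ = c + C (C (j c)) * 1
    ring
  let b := Module.finBasis k U
  let φ := LinearMap.toMatrixAlgEquiv b
  have hφ (T : Module.End k U) (u : U) : φ T *ᵥ b.equivFun u = b.equivFun (T u) :=
    LinearMap.toMatrix_mulVec_repr b b T u
  let D : CMData k (Fin (Module.finrank k U)) :=
    { x := φ xU
      y := φ yU
      i := b.equivFun (π 1)
      j := fun l => jU (b l)
      comm := by
        rw [← map_mul, ← map_mul, ← map_sub, hcomm, map_add, map_one]
        congr 1
        ext l l'
        rw [LinearMap.toMatrixAlgEquiv_apply, vecMulVec_apply, LinearMap.smulRight_apply, map_smul,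
          Finsupp.smul_apply, smul_eq_mul, mul_comm]
        rfl }
  have hDj (u : U) : D.j ⬝ᵥ b.equivFun u = jU u := by
    conv_rhs => rw [← b.sum_equivFun u, map_sum]
    exact Finset.sum_congr rfl fun l _ => by rw [map_smul, smul_eq_mul, mul_comm]
  have hπC (f : k[X]) : π (C f) = aeval xU f (π 1) := by
    rw [← LinearMap.map_aeval_apply (x := xS) π (fun _ => rfl)]
    congr 1
    induction f using Polynomial.induction_on' with
    | add f g hf hg => rw [map_add, map_add, hf, hg, LinearMap.add_apply]
    | monomial m a =>
      induction m with
      | zero => rw [monomial_zero_left, aeval_C, Module.algebraMap_end_apply, Algebra.smul_def,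
          mul_one]; rfl
      | succ m ih => rw [← X_mul_monomial, map_mul, map_mul, aeval_X, Module.End.mul_apply, ← ih,
          hxS, hξC, derivative_C, Polynomial.map_zero, add_zero, add_zero]
  have hev (c) : D.ev c = b.equivFun (π c) := by
    induction c using Polynomial.induction_on' with
    | add f g hf hg => rw [map_add, map_add, map_add, hf, hg]
    | monomial m f =>
      induction m with
      | zero =>
        rw [monomial_zero_left, D.ev_C, hπC]
        change aeval (φ xU) f *ᵥ b.equivFun (π 1) = _
        rw [← AlgEquiv.coe_toAlgHom, aeval_algHom_apply, AlgEquiv.coe_toAlgHom, hφ]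
      | succ m ih =>
        rw [← X_mul_monomial, D.ev_X_mul, ih, ← hy]
        exact hφ _ _
  have hcorr (c) : D.corr c = ξ c := by
    induction c using Polynomial.induction_on' with
    | add f g hf hg => rw [map_add, map_add, hf, hg]
    | monomial m f =>
      induction m with
      | zero => rw [monomial_zero_left, D.corr_C, hξC]
      | succ m ih => rw [← X_mul_monomial, D.corr_X_mul, ih, hξX, hev, hDj, hj]
  refine ⟨_, D, hρ, fun c => ?_, op_d, fun m => ?_⟩
  · rw [hev, LinearEquiv.map_eq_zero_iff]
    exact (Submodule.Quotient.mk_eq_zero (LinearMap.range ρ)).symm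
  · rw [op_t, hcorr, hξρ]

end WeylPresentation

section Coeffwise

variable {k R : Type*} [Field k] [Ring R] [Algebra k R]

/-- Application of a linear map to each coefficient in `k[t]` of a polynomial over `k[t]`. -/
noncomputable def coeffwise (T : k[X] →ₗ[k] R) : k[X][X] →ₗ[k] R[X] :=
  lsum fun n => (monomial n).restrictScalars k ∘ₗ T

@[simp]
theorem coeff_coeffwise (T : k[X] →ₗ[k] R) (c : k[X][X]) (n : ℕ) :
    (coeffwise T c).coeff n = T (c.coeff n) := by
  induction c using Polynomial.induction_on' with
  | add f g hf hg => rw [map_add, coeff_add, coeff_add, map_add, hf, hg]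
  | monomial m f =>
    have h : coeffwise T (monomial m f) = monomial m (T f) := by
      exact sum_monomial_index f (fun n f => monomial n (T f)) (by rw [map_zero, map_zero])
    rw [h, coeff_monomial, coeff_monomial]
    split_ifs <;> simp

theorem coeffwise_X_mul (T : k[X] →ₗ[k] R) (c : k[X][X]) :
    coeffwise T (X * c) = X * coeffwise T c := by
  ext1 n
  cases n <;> simp

theorem coeffwise_derivative (T : k[X] →ₗ[k] R) (c : k[X][X]) :
    coeffwise T (derivative c) = derivative (coeffwise T c) := by
  ext1 n
  rw [coeff_coeffwise, coeff_derivative, coeff_derivative, coeff_coeffwise, ← Nat.cast_succ,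
    ← Nat.cast_succ, mul_comm, ← nsmul_eq_mul, map_nsmul, nsmul_eq_mul]
  exact Nat.cast_comm _ _

variable {g : k[X]} (hg : g.Monic)

theorem coeffwise_divMonic_C_mul (c : k[X][X]) : coeffwise (divMonic hg) (C g * c) = c := by
  ext1 n
  rw [coeff_coeffwise, coeff_C_mul, divMonic_mul]

theorem coeffwise_divMonic_C_X_mul (c : k[X][X]) :
    coeffwise (divMonic hg) (C X * c) =
      C X * coeffwise (divMonic hg) c + (coeffwise (residue hg) c).map C := by
  ext1 n
  rw [coeff_coeffwise, coeff_C_mul, divMonic_X_mul, coeff_add, coeff_C_mul, coeff_coeffwise,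
    coeff_map, coeff_coeffwise]

/-- If every coefficient of large degree can be cancelled and `C h * k[t][y]` is contained in a
subspace, then the subspace has finite codimension. -/
theorem finite_quotient_of_coeff {R : Submodule k k[X][X]} {n₀ : ℕ} {h : k[X]} (h0 : h ≠ 0)
    (hcoeff : ∀ n ≥ n₀, ∀ f, ∃ r ∈ R, r.coeff n = f ∧ ∀ a > n, r.coeff a = 0)
    (hmul : ∀ c, C h * c ∈ R) : Module.Finite k (k[X][X] ⧸ R) := by
  let V : Submodule k k[X][X] := ⨆ a ∈ Finset.range n₀,
    (degreeLT k h.natDegree).map ((monomial a).restrictScalars k)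
  have hV : V.FG := Submodule.fg_biSup _ _ fun a _ => by
    refine Submodule.FG.map _ ?_
    classical
    rw [degreeLT_eq_span_X_pow]
    exact ⟨_, rfl⟩
  have hRV (N : ℕ) : ∀ c : k[X][X], (∀ a ≥ N, c.coeff a = 0) → c ∈ R ⊔ V := by
    induction N with
    | zero =>
      intro c hc
      rw [show c = 0 from Polynomial.ext fun a => hc a a.zero_le]
      exact zero_mem _
    | succ N ih =>
      intro c hc
      suffices ∃ r ∈ R ⊔ V, r.coeff N = c.coeff N ∧ ∀ a > N, r.coeff a = 0 by
        obtain ⟨r, hr, hN, ha⟩ := this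
        rw [← sub_add_cancel c r]
        refine add_mem (ih _ fun a haN => ?_) hr
        rw [coeff_sub]
        obtain rfl | haN := haN.eq_or_lt
        · rw [hN, sub_self]
        · rw [hc a haN, ha a haN, sub_zero]
      by_cases hN : n₀ ≤ N
      · obtain ⟨r, hr, h⟩ := hcoeff N hN (c.coeff N)
        exact ⟨r, Submodule.mem_sup_left hr, h⟩
      · refine ⟨monomial N (c.coeff N), ?_, coeff_monomial_same _ _,
          fun a ha => coeff_monomial_of_ne _ ha.ne'⟩
        rw [← EuclideanDomain.div_add_mod (c.coeff N) h, map_add, ← C_mul_monomial]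
        refine add_mem (Submodule.mem_sup_left (hmul _)) (Submodule.mem_sup_right ?_)
        refine Submodule.mem_iSup_of_mem N (Submodule.mem_iSup_of_mem
          (Finset.mem_range.mpr (not_le.mp hN)) ⟨c.coeff N % h, ?_, rfl⟩)
        rw [SetLike.mem_coe, mem_degreeLT, ← degree_eq_natDegree h0]
        exact EuclideanDomain.mod_lt _ h0
  have : Module.Finite k V := Module.Finite.iff_fg.mpr hV
  refine Module.Finite.of_surjective (R.mkQ ∘ₗ V.subtype) fun u => ?_
  obtain ⟨c, rfl⟩ := R.mkQ_surjective u
  obtain ⟨r, hr, v, hv, rfl⟩ := Submodule.mem_sup.mp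
    (hRV (c.natDegree + 1) c fun a => coeff_eq_zero_of_natDegree_lt)
  refine ⟨⟨v, hv⟩, ?_⟩
  have hr : R.mkQ r = 0 := (Submodule.Quotient.mk_eq_zero R).mpr hr
  rw [map_add, hr, zero_add]
  rfl

end Coeffwise

namespace WeylPresentation
open MulOpposite

variable {k A : Type*} [Field k] [Ring A] [Algebra k A] (W : WeylPresentation k A)

/-- The ideal of coefficients of `∂ⁿ` in the elements of order at most `n` of a right ideal. -/
noncomputable def leadIdeal (I : Submodule Aᵐᵒᵖ A) : ℕ →o Ideal k[X] where
  toFun n :=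
    { carrier := {f | ∃ m ∈ I, (∀ a > n, (W.sym m).coeff a = 0) ∧ (W.sym m).coeff n = f}
      add_mem' := by
        rintro _ _ ⟨m, hm, hm', rfl⟩ ⟨l, hl, hl', rfl⟩
        refine ⟨m + l, I.add_mem hm hl, fun a ha => ?_, ?_⟩
        · rw [map_add, coeff_add, hm' a ha, hl' a ha, add_zero]
        · rw [map_add, coeff_add]
      zero_mem' := ⟨0, I.zero_mem, by simp⟩
      smul_mem' := by
        rintro f _ ⟨m, hm, hm', rfl⟩
        refine ⟨op (aeval W.t f) • m, I.smul_mem _ hm, fun a ha => ?_,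
          isFiltered_sym.coeff_op_aeval f hm' le_rfl⟩
        exact (isFiltered_sym.coeff_op_aeval f hm' ha.le).trans (by
          rw [LinearEquiv.coe_coe, hm' a ha, mul_zero]) }
  monotone' := monotone_nat_of_le_succ fun n => by
    rintro _ ⟨m, hm, hm', rfl⟩
    refine ⟨m * W.d, I.smul_mem (op W.d) hm, fun a ha => ?_, ?_⟩
    · obtain ⟨a, rfl⟩ := Nat.exists_eq_succ_of_ne_zero (by omega : a ≠ 0)
      rw [sym_mul_d, Nat.succ_eq_add_one, coeff_X_mul, hm' a (by omega)]
    · rw [sym_mul_d, coeff_X_mul]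

variable {W} {I : Submodule Aᵐᵒᵖ A}

theorem coeff_mem_leadIdeal {m : A} (hm : m ∈ I) {n : ℕ} (h : ∀ a > n, (W.sym m).coeff a = 0) :
    (W.sym m).coeff n ∈ W.leadIdeal I n := ⟨m, hm, h, rfl⟩

variable (W I) in
theorem exists_leadIdeal_le : ∃ n₀, ∀ n, W.leadIdeal I n ≤ W.leadIdeal I n₀ := by
  obtain ⟨n₀, h⟩ := monotone_stabilizes_iff_noetherian.mpr inferInstance (W.leadIdeal I)
  exact ⟨n₀, fun n => ((W.leadIdeal I).monotone (le_max_right n₀ n)).trans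
    (h _ (le_max_left _ _)).ge⟩

/-- A right ideal that meets `k[t]` comes from Calogero–Moser data. -/
theorem exists_rep_of_aeval_mem {p : k[X]} (hp : p ≠ 0) (hpI : aeval W.t p ∈ I) :
    ∃ (d : ℕ) (D : CMData k (Fin d)), W.Rep D I := by
  classical
  obtain ⟨n₀, hn₀⟩ := W.exists_leadIdeal_le I
  have hp₀ : p ∈ W.leadIdeal I n₀ := hn₀ 0 ⟨_, hpI, by
    rw [sym_aeval_t]
    exact ⟨fun a ha => coeff_C_of_ne_zero (by omega), coeff_C_zero⟩⟩
  obtain ⟨g, hg, hgI⟩ : ∃ g : k[X], g.Monic ∧ ∀ f, f ∈ W.leadIdeal I n₀ ↔ g ∣ f := by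
    let g := Submodule.IsPrincipal.generator (W.leadIdeal I n₀)
    have hdvd (f) : f ∈ W.leadIdeal I n₀ ↔ g ∣ f := Submodule.IsPrincipal.mem_iff_generator_dvd _
    have hg0 : g ≠ 0 := fun h => hp (zero_dvd_iff.mp (h ▸ (hdvd p).mp hp₀))
    exact ⟨normalize g, monic_normalize hg0, fun f => by rw [normalize_dvd_iff, hdvd]⟩
  let s : I →ₗ[k] k[X][X] := W.sym.toLinearMap ∘ₗ (I.subtype.restrictScalars k)
  have hs (m : I) : s m = W.sym m := rfl
  have hs_t (m : I) : s (op W.t • m) = C X * s m + derivative (s m) := W.sym_mul_t _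
  have hs_d (m : I) : s (op W.d • m) = X * s m := W.sym_mul_d _
  let ρ : I →ₗ[k] k[X][X] := coeffwise (divMonic hg) ∘ₗ s
  have hρ (m) : ρ m = coeffwise (divMonic hg) (s m) := rfl
  have hdvd {m : I} {n : ℕ} (hm : ∀ a > n, (s m).coeff a = 0) : g ∣ (s m).coeff n :=
    (hgI _).mp (hn₀ n (coeff_mem_leadIdeal m.2 hm))
  have hlead {m : I} (hm : s m ≠ 0) : (ρ m).coeff (s m).natDegree ≠ 0 := by
    intro h0
    obtain ⟨q, hq⟩ := hdvd (m := m) fun a => coeff_eq_zero_of_natDegree_lt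
    rw [hρ, coeff_coeffwise, hq, divMonic_mul] at h0
    rw [h0, mul_zero, coeff_natDegree, leadingCoeff_eq_zero] at hq
    exact hm hq
  have hcoeff {m : I} {n : ℕ} (hm : ∀ a > n, (ρ m).coeff a = 0) :
      ∀ a > n, (s m).coeff a = 0 := by
    by_cases h0 : s m = 0
    · simp [h0]
    · intro a ha
      refine coeff_eq_zero_of_natDegree_lt (lt_of_le_of_lt ?_ ha)
      by_contra! hlt
      exact hlead h0 (hm _ hlt)
  have hfin : Module.Finite k (k[X][X] ⧸ LinearMap.range ρ) := by
    obtain ⟨h, rfl⟩ := (hgI p).mp hp₀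
    refine finite_quotient_of_coeff (n₀ := n₀) (right_ne_zero_of_mul hp) (fun n hn f => ?_)
      fun c => ?_
    · obtain ⟨m, hm, hm', hmn⟩ :=
        (W.leadIdeal I).monotone hn ((hgI (g * f)).mpr (dvd_mul_right g f))
      refine ⟨_, ⟨⟨m, hm⟩, rfl⟩, ?_, fun a ha => ?_⟩
      · rw [hρ, coeff_coeffwise, hs, hmn, divMonic_mul]
      · rw [hρ, coeff_coeffwise, hs, hm' a ha, map_zero]
    · refine ⟨⟨_, I.smul_mem (op (W.sym.symm c)) hpI⟩, ?_⟩
      have h : W.sym (aeval W.t (g * h) * W.sym.symm c) = C g * (C h * c) := by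
        rw [sym_aeval_mul, LinearEquiv.apply_symm_apply, map_mul, mul_assoc]
      exact (congrArg (coeffwise _) h).trans (coeffwise_divMonic_C_mul hg _)
  suffices ∃ (d : ℕ) (D : CMData k (Fin d)), W.IsModel D ρ by
    obtain ⟨d, D, h⟩ := this
    exact ⟨d, D, h.rep⟩
  refine exists_isModel (ξ₀ := coeffwise (residue hg) ∘ₗ s)
    (fun m m' hmm => ?_) (fun m => ?_) (fun m => ?_) (fun m => ?_) fun m n hm a ha => ?_
  · by_contra hne
    refine hlead (m := m - m') ?_ (by rw [map_sub, hmm, sub_self, coeff_zero])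
    rw [hs, Ne, LinearEquiv.map_eq_zero_iff]
    exact fun h => hne (sub_eq_zero.mp (Subtype.ext h))
  · rw [hρ, hs_d, coeffwise_X_mul, hρ]
  · rw [LinearMap.comp_apply, hs_d, coeffwise_X_mul]
    rfl
  · rw [hρ, hs_t, map_add, coeffwise_divMonic_C_X_mul, coeffwise_derivative, add_right_comm]
    rfl
  · have hm := hcoeff hm
    obtain ⟨q, hq⟩ : g ∣ (s m).coeff a := hdvd fun b hb => hm b (by omega)
    rw [LinearMap.comp_apply, coeff_coeffwise, hq, residue_mul]

end WeylPresentation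

namespace WeylPresentation
open MulOpposite

variable {k A : Type*} [Field k] [Ring A] [Algebra k A] {W : WeylPresentation k A}

theorem d_mul_aeval (f : k[X]) :
    W.d * aeval W.t f = aeval W.t f * W.d + aeval W.t (derivative f) := by
  induction f using Polynomial.induction_on' with
  | add f g hf hg => simp only [map_add, mul_add, add_mul, hf, hg]; abel
  | monomial m a =>
    induction m with
    | zero =>
      rw [monomial_zero_left, aeval_C, derivative_C, map_zero, add_zero, Algebra.commutes]
    | succ m ih =>
      rw [← monomial_mul_X, map_mul, aeval_X, ← mul_assoc, ih, derivative_mul, derivative_X,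
        mul_one, map_add, map_mul, aeval_X, add_mul, mul_assoc, sub_eq_iff_eq_add.mp W.d_mul_t]
      noncomm_ring

theorem aeval_mul_aeval_comm (f g : k[X]) :
    aeval W.t f * aeval W.t g = aeval W.t g * aeval W.t f := by
  rw [← map_mul, mul_comm, map_mul]

theorem exists_d_mul_pow (l : k[X]) (s : ℕ) : ∃ e : A,
    W.d * aeval W.t l ^ (s + 1) = aeval W.t l ^ (s + 1) * W.d + e * aeval W.t l ^ s ∧
      e * aeval W.t l ^ s = aeval W.t l ^ s * e := by
  refine ⟨aeval W.t (C (s + 1 : k) * derivative l), ?_, ?_⟩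
  · rw [← map_pow, d_mul_aeval, derivative_pow_succ, ← map_pow, ← map_mul]
    congr 2
    ring
  · rw [← map_pow, aeval_mul_aeval_comm]

/-- Powers of an element of `k[t]` satisfy the right Ore condition. -/
theorem exists_mul_pow_eq (l : k[X]) (x : A) :
    ∀ s : ℕ, ∃ (r : ℕ) (y : A), x * aeval W.t l ^ r = aeval W.t l ^ s * y := by
  induction x using W.induction with
  | algebraMap c => exact fun s => ⟨s, _, Algebra.commutes _ _⟩
  | t =>
    exact fun s => ⟨s, W.t, by rw [← map_pow]; simpa using aeval_mul_aeval_comm (W := W) X (l ^ s)⟩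
  | d =>
    intro s
    obtain ⟨e, he, he'⟩ := W.exists_d_mul_pow l s
    exact ⟨s + 1, aeval W.t l * W.d + e, by rw [he, he', mul_add, ← mul_assoc, ← pow_succ]⟩
  | add a b ha hb =>
    intro s
    obtain ⟨r, y, h⟩ := ha s
    obtain ⟨r', y', h'⟩ := hb s
    refine ⟨r + r', y * aeval W.t l ^ r' + y' * aeval W.t l ^ r, ?_⟩
    rw [add_mul, mul_add, ← mul_assoc, ← mul_assoc, ← h, ← h', mul_assoc, mul_assoc, ← pow_add,
      ← pow_add, add_comm r']
  | mul a b ha hb =>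
    intro s
    obtain ⟨r, y, h⟩ := ha s
    obtain ⟨r', y', h'⟩ := hb r
    exact ⟨r', y * y', by rw [mul_assoc, h', ← mul_assoc, h, mul_assoc]⟩

theorem exists_mul_pow_eq_pow_mul_monomial (l f : k[X]) (i : ℕ) :
    ∀ j : ℕ, ∃ b : A,
      b * aeval W.t l ^ j = aeval W.t l ^ (j + i) * (aeval W.t f * W.d ^ i) := by
  induction i with
  | zero =>
    exact fun j => ⟨aeval W.t f, by rw [pow_zero, mul_one, ← map_pow, aeval_mul_aeval_comm, map_pow,
      add_zero]⟩
  | succ i ih =>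
    intro j
    obtain ⟨b, hb⟩ := ih (j + 1)
    obtain ⟨e, he, -⟩ := W.exists_d_mul_pow l j
    refine ⟨b * W.d * aeval W.t l - b * e, ?_⟩
    calc (b * W.d * aeval W.t l - b * e) * aeval W.t l ^ j
        = b * (W.d * aeval W.t l ^ (j + 1) - e * aeval W.t l ^ j) := by
          rw [pow_succ']; noncomm_ring
      _ = b * aeval W.t l ^ (j + 1) * W.d := by rw [he, add_sub_cancel_right, mul_assoc]
      _ = _ := by rw [hb, pow_succ W.d, add_right_comm j 1 i, add_assoc j i 1]; noncomm_ring

/-- A left Ore condition with an exponent controlled by the order. -/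
theorem exists_mul_pow_eq_pow_mul (l : k[X]) {a : A} {n : ℕ}
    (ha : ∀ i > n, (W.sym a).coeff i = 0) (j : ℕ) :
    ∃ b : A, b * aeval W.t l ^ j = aeval W.t l ^ (j + n) * a := by
  choose b hb using fun i => W.exists_mul_pow_eq_pow_mul_monomial l ((W.sym a).coeff i) i j
  refine ⟨∑ i ∈ Finset.range (n + 1), aeval W.t l ^ (n - i) * b i, ?_⟩
  conv_rhs => rw [← W.normalEval_sym a, (W.sym a).as_sum_range' (n + 1)
    (Nat.lt_succ_of_le (natDegree_le_iff_coeff_eq_zero.mpr ha)), map_sum, Finset.mul_sum]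
  rw [Finset.sum_mul]
  refine Finset.sum_congr rfl fun i hi => ?_
  rw [mul_assoc, hb, normalEval_monomial, ← mul_assoc, ← pow_add]
  congr 2
  have := Finset.mem_range.mp hi
  omega

variable {I : Submodule Aᵐᵒᵖ A}

/-- A right ideal is generated by its elements of order at most `n₀`, once the ideals of leading
coefficients are constant from `n₀` on. -/
theorem le_of_leadIdeal_le {J : Submodule Aᵐᵒᵖ A} {n₀ : ℕ}
    (hn₀ : ∀ n, W.leadIdeal I n ≤ W.leadIdeal I n₀)
    (hJ : ∀ m ∈ I, (∀ a > n₀, (W.sym m).coeff a = 0) → m ∈ J) : I ≤ J := by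
  suffices ∀ n, ∀ m ∈ I, (∀ a > n, (W.sym m).coeff a = 0) → m ∈ J from
    fun m hm => this _ m hm fun a => coeff_eq_zero_of_natDegree_lt
  intro n
  induction n with
  | zero => exact fun m hm h => hJ m hm fun a ha => h a (by omega)
  | succ n ih =>
    intro m hm h
    by_cases hn : n + 1 ≤ n₀
    · exact hJ m hm fun a ha => h a (by omega)
    obtain ⟨m₀, hm₀, h₀, heq⟩ := hn₀ _ (coeff_mem_leadIdeal hm h)
    have hsym := isFiltered_sym.op_d_pow (W := W) (n + 1 - n₀) m₀
    change W.sym (m₀ * W.d ^ (n + 1 - n₀)) = X ^ (n + 1 - n₀) * W.sym m₀ at hsym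
    rw [← sub_add_cancel m (m₀ * W.d ^ (n + 1 - n₀))]
    refine add_mem (ih _ (sub_mem hm (I.smul_mem (op _) hm₀)) fun a ha => ?_)
      (J.smul_mem (op _) (hJ _ hm₀ h₀))
    rw [map_sub, hsym, coeff_sub, coeff_X_pow_mul', if_pos (by omega)]
    obtain rfl | ha := Nat.eq_or_lt_of_le (Nat.succ_le_of_lt ha)
    · rw [Nat.succ_eq_add_one, ← heq, Nat.sub_sub_self (by omega), sub_self]
    · rw [h a ha, h₀ _ (by omega), sub_self]

/-- Elements of a right ideal are left multiples of an element of minimal order, up to a power of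
its leading coefficient. -/
theorem exists_mul_pow_eq_mul {q : A} (hq : q ∈ I) (hq0 : q ≠ 0)
    (hmin : ∀ m ∈ I, m ≠ 0 → (W.sym q).natDegree ≤ (W.sym m).natDegree) {n : ℕ} :
    ∀ m ∈ I, (∀ a ≥ n, (W.sym m).coeff a = 0) →
      ∃ a : A, m * aeval W.t (W.sym q).leadingCoeff ^ n = q * a ∧
        ∀ i ≥ n, (W.sym a).coeff i = 0 := by
  have hl : (W.sym q).leadingCoeff ≠ 0 := by
    rwa [Ne, leadingCoeff_eq_zero, LinearEquiv.map_eq_zero_iff]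
  set l := (W.sym q).leadingCoeff
  have := W.noZeroDivisors
  have hcoeff {m : A} {n : ℕ} (hm : ∀ a > n, (W.sym m).coeff a = 0) (f : k[X]) {a : ℕ}
      (ha : n ≤ a) : (W.sym (m * aeval W.t f)).coeff a = f * (W.sym m).coeff a :=
    isFiltered_sym.coeff_op_aeval f hm ha
  suffices ∀ m ∈ I, (∀ a ≥ n, (W.sym m).coeff a = 0) → ∃ a : A, m * aeval W.t l ^ n = q * a by
    intro m hm h
    obtain ⟨a, ha⟩ := this m hm h
    refine ⟨a, ha, fun i hi => ?_⟩
    by_cases ha0 : a = 0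
    · rw [ha0, map_zero, coeff_zero]
    refine coeff_eq_zero_of_natDegree_lt ?_
    by_contra! hni
    have hdeg := natDegree_sym_mul (W := W) hq0 ha0
    have h0 : W.sym (q * a) = 0 := by
      rw [← leadingCoeff_eq_zero, leadingCoeff, hdeg, ← ha, ← map_pow,
        hcoeff (n := n) (fun a ha => h a ha.le) _ (by omega), h _ (by omega), mul_zero]
    rw [LinearEquiv.map_eq_zero_iff, mul_eq_zero] at h0
    tauto
  induction n with
  | zero =>
    intro m _ h
    have : m = 0 := W.sym.map_eq_zero_iff.mp (Polynomial.ext fun a => h a a.zero_le)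
    exact ⟨0, by rw [this, zero_mul, mul_zero]⟩
  | succ n ih =>
    intro m hm h
    set f := (W.sym m).coeff n with hf
    by_cases hf0 : f = 0
    · obtain ⟨a, ha⟩ := ih m hm fun a ha => by
        obtain rfl | ha := ha.eq_or_lt
        exacts [hf0, h a ha]
      exact ⟨a * aeval W.t l, by rw [pow_succ, ← mul_assoc, ha, mul_assoc]⟩
    have hle : (W.sym q).natDegree ≤ n := by
      refine (hmin m hm ?_).trans (natDegree_le_iff_coeff_eq_zero.mpr h)
      rintro rfl
      exact hf0 (by rw [hf, map_zero, coeff_zero])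
    set c : A := aeval W.t f * W.d ^ (n - (W.sym q).natDegree) with hc
    have hqc {a : ℕ} (ha : n ≤ a) : (W.sym (q * c)).coeff a =
        (W.sym q).coeff (a - (n - (W.sym q).natDegree)) * f := by
      have := isFiltered_sym.coeff_op_smul (W := W) (m := q) (b := c)
        (n := (W.sym q).natDegree) (l := n - (W.sym q).natDegree)
        (fun a => coeff_eq_zero_of_natDegree_lt)
        (fun a ha => by rw [hc, sym_aeval_mul_d_pow, coeff_monomial_of_ne _ ha.ne'])
        (a := a) (by omega)
      rwa [hc, sym_aeval_mul_d_pow, coeff_monomial_same] at this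
    obtain ⟨a, ha⟩ := ih (m * aeval W.t l - q * c)
      (sub_mem (I.smul_mem (op _) hm) (I.smul_mem (op _) hq)) fun a ha => by
        rw [map_sub, coeff_sub, hcoeff h _ ha, hqc ha]
        obtain rfl | ha := ha.eq_or_lt
        · rw [Nat.sub_sub_self hle, sub_eq_zero]
          rfl
        · rw [h a ha, coeff_eq_zero_of_natDegree_lt (by omega), mul_zero, zero_mul, sub_zero]
    refine ⟨c * aeval W.t l ^ n + a, ?_⟩
    rw [mul_add, ← ha, pow_succ']
    noncomm_ring

/-- Every nonzero right ideal is isomorphic to one that meets `k[t]`. -/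
theorem exists_equiv_aeval_mem (hI : I ≠ ⊥) :
    ∃ (J : Submodule Aᵐᵒᵖ A) (p : k[X]), p ≠ 0 ∧ aeval W.t p ∈ J ∧ Nonempty (I ≃ₗ[Aᵐᵒᵖ] J) := by
  have := W.noZeroDivisors
  have hex : ∃ n, ∃ q ∈ I, q ≠ 0 ∧ (W.sym q).natDegree = n := by
    obtain ⟨q, hq, hq0⟩ := I.ne_bot_iff.mp hI
    exact ⟨_, q, hq, hq0, rfl⟩
  classical
  obtain ⟨q, hq, hq0, hqn⟩ := Nat.find_spec hex
  have hmin (m) (hm : m ∈ I) (hm0 : m ≠ 0) : (W.sym q).natDegree ≤ (W.sym m).natDegree :=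
    hqn.le.trans (Nat.find_min' hex ⟨m, hm, hm0, rfl⟩)
  have hl : (W.sym q).leadingCoeff ≠ 0 := by
    rwa [Ne, leadingCoeff_eq_zero, LinearEquiv.map_eq_zero_iff]
  set l := (W.sym q).leadingCoeff
  obtain ⟨n₀, hn₀⟩ := W.exists_leadIdeal_le I
  let N := n₀ + 1 + n₀
  have hpow (s : ℕ) : aeval W.t l ^ s ≠ 0 := by
    rw [← map_pow]
    exact W.aeval_t_ne_zero (pow_ne_zero s hl)
  let G : Submodule Aᵐᵒᵖ (A × A) :=
    { carrier := {m | m.1 ∈ I ∧ ∃ (s : ℕ) (a : A), m.1 * aeval W.t l ^ s = q * a ∧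
        m.2 * aeval W.t l ^ s = aeval W.t l ^ N * a}
      add_mem' := by
        rintro ⟨m, b⟩ ⟨m', b'⟩ ⟨hm, s, a, h₁, h₂⟩ ⟨hm', s', a', h₁', h₂'⟩
        dsimp only at *
        refine ⟨add_mem hm hm', s + s', a * aeval W.t l ^ s' + a' * aeval W.t l ^ s, ?_, ?_⟩
        · change (m + m') * _ = _
          rw [mul_add, ← mul_assoc, ← mul_assoc, ← h₁, ← h₁', mul_assoc, mul_assoc, ← pow_add,
            ← pow_add, add_comm s', add_mul]
        · change (b + b') * _ = _
          rw [mul_add, ← mul_assoc, ← mul_assoc, ← h₂, ← h₂', mul_assoc, mul_assoc, ← pow_add,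
            ← pow_add, add_comm s', add_mul]
      zero_mem' := ⟨zero_mem _, 0, 0, by simp⟩
      smul_mem' := by
        rintro x ⟨m, b⟩ ⟨hm, s, a, h₁, h₂⟩
        obtain ⟨x, rfl⟩ := op_surjective x
        dsimp only at *
        obtain ⟨r, y, hy⟩ := W.exists_mul_pow_eq l x s
        refine ⟨I.smul_mem _ hm, r, a * y, ?_, ?_⟩
        · change m * x * _ = _
          rw [mul_assoc, hy, ← mul_assoc, h₁, mul_assoc]
        · change b * x * _ = _
          rw [mul_assoc, hy, ← mul_assoc, h₂, mul_assoc] }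
  let φ : G →ₗ[Aᵐᵒᵖ] A := LinearMap.fst Aᵐᵒᵖ A A ∘ₗ G.subtype
  let ψ : G →ₗ[Aᵐᵒᵖ] A := LinearMap.snd Aᵐᵒᵖ A A ∘ₗ G.subtype
  have hφ : Function.Injective φ := by
    refine LinearMap.ker_eq_bot.mp (LinearMap.ker_eq_bot'.mpr ?_)
    rintro ⟨⟨m, b⟩, hm, s, a, h₁, h₂⟩ (rfl : m = 0)
    have ha : a = 0 := (mul_eq_zero.mp (h₁.symm.trans (zero_mul _))).resolve_left hq0
    have hb : b = 0 := by
      rw [ha, mul_zero] at h₂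
      exact (mul_eq_zero.mp h₂).resolve_right (hpow s)
    subst hb
    rfl
  have hψ : Function.Injective ψ := by
    refine LinearMap.ker_eq_bot.mp (LinearMap.ker_eq_bot'.mpr ?_)
    rintro ⟨⟨m, b⟩, hm, s, a, h₁, h₂⟩ (rfl : b = 0)
    have ha : a = 0 := (mul_eq_zero.mp (h₂.symm.trans (zero_mul _))).resolve_left (hpow N)
    have hb : m = 0 := by
      rw [ha, mul_zero] at h₁
      exact (mul_eq_zero.mp h₁).resolve_right (hpow s)
    subst hb
    rfl
  have hrange : LinearMap.range φ = I := by
    refine le_antisymm ?_ (W.le_of_leadIdeal_le hn₀ fun m hm h => ?_)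
    · rintro _ ⟨g, rfl⟩
      exact g.2.1
    · obtain ⟨a, ha, ha'⟩ := W.exists_mul_pow_eq_mul hq hq0 hmin (n := n₀ + 1) m hm fun a => h a
      obtain ⟨b, hb⟩ := W.exists_mul_pow_eq_pow_mul l (fun i hi => ha' i hi) (n₀ + 1)
      exact ⟨⟨(m, b), hm, n₀ + 1, a, ha, hb⟩, rfl⟩
  refine ⟨LinearMap.range ψ, l ^ N, pow_ne_zero N hl,
    ⟨⟨(q, aeval W.t (l ^ N)), hq, 0, 1, by simp, by simp⟩, rfl⟩, ⟨?_⟩⟩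
  exact (LinearEquiv.ofEq _ _ hrange.symm).trans
    ((LinearEquiv.ofInjective φ hφ).symm.trans (LinearEquiv.ofInjective ψ hψ))

/-- Every nonzero right ideal comes from Calogero–Moser data. -/
theorem exists_rep (hI : I ≠ ⊥) : ∃ (d : ℕ) (D : CMData k (Fin d)), W.Rep D I := by
  obtain ⟨J, p, hp, hpJ, ⟨e⟩⟩ := W.exists_equiv_aeval_mem hI
  obtain ⟨d, D, h⟩ := W.exists_rep_of_aeval_mem hp hpJ
  exact ⟨d, D, Rep.of_equiv h e.symm⟩

end WeylPresentation

namespace CMData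
open Matrix

variable {k n n' : Type*} [Field k] [Fintype n] [DecidableEq n] [Fintype n'] [DecidableEq n']
  {D : CMData k n} {D' : CMData k n'}

theorem addRight_eq_self {Z : Matrix n n k} (hZ : Commute Z D.x) (h : Z = 0) :
    D.addRight Z hZ = D := by
  subst h
  cases D
  simp [addRight]

theorem Iso.ev_eq (E : D.Iso D') (c : k[X][X]) : D'.ev c = E.e (D.ev c) := by
  induction c using Polynomial.induction_on' with
  | add f g hf hg => rw [map_add, map_add, map_add, hf, hg]
  | monomial m f =>
    induction m with
    | zero =>
      rw [monomial_zero_left, ev_C, ev_C]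
      induction f using Polynomial.induction_on' with
      | add f g hf hg => rw [map_add, map_add, add_mulVec, add_mulVec, hf, hg, map_add]
      | monomial b a =>
        induction b with
        | zero =>
          rw [monomial_zero_left, aeval_C, aeval_C, Algebra.algebraMap_eq_smul_one,
            Algebra.algebraMap_eq_smul_one, smul_mulVec, smul_mulVec, one_mulVec, one_mulVec,
            map_smul, E.map_i]
        | succ b ih =>
          rw [← X_mul_monomial, map_mul, map_mul, aeval_X, aeval_X, ← mulVec_mulVec,
            ← mulVec_mulVec, ih, E.map_x]
    | succ m ih => rw [← X_mul_monomial, ev_X_mul, ev_X_mul, ih, E.map_y]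

theorem Iso.corr_eq (E : D.Iso D') (c : k[X][X]) : D'.corr c = D.corr c := by
  induction c using Polynomial.induction_on' with
  | add f g hf hg => rw [map_add, map_add, hf, hg]
  | monomial m f =>
    induction m with
    | zero => rw [monomial_zero_left, corr_C, corr_C]
    | succ m ih => rw [← X_mul_monomial, corr_X_mul, corr_X_mul, ih, E.ev_eq, E.dot_j]

end CMData

namespace WeylPresentation
open MulOpposite

variable {k A : Type*} [Field k] [Semiring A] [Algebra k A] {I J : Submodule Aᵐᵒᵖ A}

theorem mapRight_mul (σ τ : A ≃ₐ[k] A) (I : Submodule Aᵐᵒᵖ A) :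
    mapRight (σ * τ) I = mapRight σ (mapRight τ I) := by
  ext a
  simp only [mem_mapRight]
  constructor
  · rintro ⟨b, hb, rfl⟩
    exact ⟨_, ⟨b, hb, rfl⟩, rfl⟩
  · rintro ⟨_, ⟨b, hb, rfl⟩, rfl⟩
    exact ⟨b, hb, rfl⟩

theorem mapRight_one (I : Submodule Aᵐᵒᵖ A) : mapRight (1 : A ≃ₐ[k] A) I = I := by
  ext a
  exact ⟨fun ⟨b, hb, h⟩ => h ▸ hb, fun h => ⟨a, h, rfl⟩⟩

theorem symm_apply_mem {σ : A ≃ₐ[k] A} {a : A} (h : a ∈ mapRight σ I) : σ.symm a ∈ I := by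
  obtain ⟨b, hb, rfl⟩ := h
  simpa using hb

/-- Isomorphisms of right ideals are transported by automorphisms. -/
noncomputable def mapRightEquiv (σ : A ≃ₐ[k] A) (e : I ≃ₗ[Aᵐᵒᵖ] J) :
    mapRight σ I ≃ₗ[Aᵐᵒᵖ] mapRight σ J where
  toFun x := ⟨σ (e ⟨σ.symm x, symm_apply_mem x.2⟩),
    ⟨_, Subtype.prop _, rfl⟩⟩
  invFun x := ⟨σ (e.symm ⟨σ.symm x, symm_apply_mem x.2⟩),
    ⟨_, Subtype.prop _, rfl⟩⟩
  left_inv x := by simp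
  right_inv x := by simp
  map_add' x y := by
    have h : (⟨σ.symm ↑(x + y), symm_apply_mem (x + y).2⟩ : I) =
        ⟨σ.symm x, symm_apply_mem x.2⟩ + ⟨σ.symm y, symm_apply_mem y.2⟩ :=
      Subtype.ext (map_add σ.symm _ _)
    refine Subtype.ext ((congrArg (fun z => σ (e z)) h).trans ?_)
    rw [map_add e, Submodule.coe_add, map_add]
    rfl
  map_smul' a x := by
    have h : (⟨σ.symm ↑(a • x), symm_apply_mem (a • x).2⟩ : I) =
        op (σ.symm a.unop) • ⟨σ.symm x, symm_apply_mem x.2⟩ :=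
      Subtype.ext (map_mul σ.symm _ _)
    refine Subtype.ext ((congrArg (fun z => σ (e z)) h).trans ?_)
    rw [map_smul e]
    exact (map_mul σ _ _).trans (congrArg _ (σ.apply_symm_apply _))

theorem nonempty_mapRight_equiv_iff (σ : A ≃ₐ[k] A) :
    Nonempty (mapRight σ I ≃ₗ[Aᵐᵒᵖ] mapRight σ J) ↔ Nonempty (I ≃ₗ[Aᵐᵒᵖ] J) := by
  refine ⟨fun ⟨e⟩ => ?_, fun ⟨e⟩ => ⟨mapRightEquiv σ e⟩⟩
  have h := mapRightEquiv σ⁻¹ e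
  rw [← mapRight_mul, ← mapRight_mul, inv_mul_cancel, mapRight_one, mapRight_one] at h
  exact ⟨h⟩

/-- Membership of a conjugate in the stabilizer of the isomorphism class of a right ideal. -/
theorem nonempty_mapRight_conj_equiv_iff (β w : A ≃ₐ[k] A) :
    Nonempty (mapRight (w⁻¹ * β * w) I ≃ₗ[Aᵐᵒᵖ] I) ↔
      Nonempty (mapRight β (mapRight w I) ≃ₗ[Aᵐᵒᵖ] mapRight w I) := by
  rw [← nonempty_mapRight_equiv_iff w, ← mapRight_mul, ← mapRight_mul, mul_assoc,
    mul_inv_cancel_left]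

end WeylPresentation

namespace WeylPresentation

variable {k A n n' : Type*} [Field k] [Ring A] [Algebra k A] {W : WeylPresentation k A}
  [Fintype n] [DecidableEq n] [Fintype n'] [DecidableEq n'] {D : CMData k n} {D' : CMData k n'}
  {I J : Submodule Aᵐᵒᵖ A}

theorem Rep.of_iso (h : W.Rep D I) (E : D.Iso D') : W.Rep D' I := by
  obtain ⟨ρ, hρ⟩ := h.exists_isModel
  refine IsModel.rep (ρ := ρ) ⟨hρ.injective, fun c => ?_, hρ.op_d, fun m => ?_⟩
  · rw [hρ.mem_range, E.ev_eq, LinearEquiv.map_eq_zero_iff]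
  · rw [hρ.op_t, E.corr_eq]

/-- Annihilating polynomials of `X - g(Y)` are detected by the stabilizer of the class of `I`. -/
theorem Rep.trace_aeval_eq_zero [CharZero k] (hI : W.Rep D I) (hJ : W.Rep D' J)
    (h : ∀ σ : A ≃ₐ[k] A, Nonempty (mapRight σ I ≃ₗ[Aᵐᵒᵖ] I) →
      Nonempty (mapRight σ J ≃ₗ[Aᵐᵒᵖ] J)) {g p : k[X]}
    (hp : aeval (D.x - aeval D.y g) p = 0) : (aeval (D'.x - aeval D'.y g) p).trace = 0 := by
  have hIw := hI.shiftT g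
  have hJw := hJ.shiftT g
  rw [sub_eq_add_neg] at hp ⊢
  have hβI := hIw.shiftD p
  rw [CMData.addRight_eq_self (h := neg_eq_zero.mpr (by simpa [CMData.addLeft] using hp))] at hβI
  obtain ⟨e⟩ := (nonempty_mapRight_conj_equiv_iff _ _).mp
    (h _ ((nonempty_mapRight_conj_equiv_iff _ _).mpr (hβI.nonempty_equiv hIw)))
  have htr := (hJw.of_equiv e.symm).trace_eq (hJw.shiftD p)
  simpa [CMData.addRight, CMData.addLeft] using htr

/-- A right ideal is determined up to isomorphism by the stabilizer of its class. -/
theorem nonempty_equiv_of_stabilizer [CharZero k] (W : WeylPresentation k A) (hI : I ≠ ⊥)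
    (hJ : J ≠ ⊥) (h : ∀ σ : A ≃ₐ[k] A, Nonempty (mapRight σ I ≃ₗ[Aᵐᵒᵖ] I) ↔
      Nonempty (mapRight σ J ≃ₗ[Aᵐᵒᵖ] J)) : Nonempty (I ≃ₗ[Aᵐᵒᵖ] J) := by
  obtain ⟨d, D, hD⟩ := W.exists_rep hI
  obtain ⟨d', D', hD'⟩ := W.exists_rep hJ
  obtain ⟨E⟩ := D.nonempty_iso D'
    (fun g p => hD.trace_aeval_eq_zero hD' fun σ => (h σ).mp)
    (fun g p => hD'.trace_aeval_eq_zero hD fun σ => (h σ).mpr)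
  exact (hD.of_iso E).nonempty_equiv hD'

/-- In an algebra presented as the first Weyl algebra, the stabilizer of the isomorphism class of
a nonzero right ideal is self-normalizing. -/
theorem nonempty_mapRight_equiv_of_normalizes {k A : Type*} [Field k] [CharZero k] [Semiring A]
    [Algebra k A] {t d : A} (h : d * t = t * d + 1)
    (hb : Function.Bijective (normalEval (k := k) t d)) {I : Submodule Aᵐᵒᵖ A} (hI : I ≠ ⊥)
    {γ : A ≃ₐ[k] A} (hγ : ∀ σ : A ≃ₐ[k] A, Nonempty (mapRight σ I ≃ₗ[Aᵐᵒᵖ] I) ↔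
      Nonempty (mapRight (γ⁻¹ * σ * γ) I ≃ₗ[Aᵐᵒᵖ] I)) :
    Nonempty (mapRight γ I ≃ₗ[Aᵐᵒᵖ] I) := by
  let _ : Ring A := Algebra.semiringToRing k
  let W : WeylPresentation k A := ⟨t, d, by rw [h, add_sub_cancel_left], hb⟩
  have hJ : mapRight γ I ≠ ⊥ := by
    refine fun hJ => hI ((Submodule.eq_bot_iff _).mpr fun x hx => ?_)
    have hx' : γ x ∈ mapRight γ I := ⟨x, hx, rfl⟩
    rw [hJ, Submodule.mem_bot] at hx'
    exact (map_eq_zero_iff γ γ.injective).mp hx'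
  obtain ⟨e⟩ := W.nonempty_equiv_of_stabilizer hI hJ fun σ =>
    (hγ σ).trans (nonempty_mapRight_conj_equiv_iff σ γ)
  exact ⟨e.symm⟩

end WeylPresentation

/-- Main theorem: for any right ideal `I` of the first Weyl algebra `A₁`, the
Stafford subgroup `H(I)` is equal to its own normalizer in `Aut_k(A₁)`: if
`γ H(I) γ⁻¹ = H(I)` then `γ ∈ H(I)`. -/
theorem stmt19 {k : Type} [Field k] [CharZero k]
    (I : Submodule (WeylA k)ᵐᵒᵖ (WeylA k))
    (γ : WeylA k ≃ₐ[k] WeylA k)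
    (hγ : (fun τ => γ * τ * γ⁻¹) '' Hgrp I = Hgrp I) :
    γ ∈ Hgrp I := by
  rcases eq_or_ne I ⊥ with rfl | hI
  · refine ⟨LinearEquiv.ofEq _ _ ((Submodule.eq_bot_iff _).mpr ?_)⟩
    rintro _ ⟨x, hx, rfl⟩
    rw [(Submodule.mem_bot _).mp hx, map_zero]
  have hconj (σ : WeylA k ≃ₐ[k] WeylA k) : σ ∈ Hgrp I ↔ γ⁻¹ * σ * γ ∈ Hgrp I := by
    nth_rw 1 [← hγ]
    constructor
    · rintro ⟨τ, hτ, rfl⟩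
      simpa [mul_assoc] using hτ
    · exact fun h => ⟨_, h, by simp [mul_assoc]⟩
  exact WeylPresentation.nonempty_mapRight_equiv_of_normalizes (WeylA.d_mul_t k)
    ⟨WeylA.normalEval_injective, WeylA.normalEval_surjective⟩ hI hconj
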